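/- Let M be a II₁ factor with faithful tracial state τ and let (M_n)_{n∈ℕ} be an increasing sequence of von Neumann subalgebras of M, each an infinite-dimensional factor, with M = vN(⋃_n M_n). For each n let A_n be a MASA in M_n with A_n ⊆ A_{n+1}; assume the τ-preserving conditional expectations E_{A_n} exist and that the commuting square condition holds: E_{A_{n+1}}(x) = E_{A_n}(x) for every x ∈ M_n and every n. Set A := vN(⋃_n A_n) and P := vN(⋃_n N_{M_n}(A_n)''). Then A is a MASA in M and N_M(A)'' ⊆ P. -/

import Mathlib

open scoped ComplexOrder

noncomputable section

variable {H : Type*} [NormedAddCommGroup H] [InnerProductSpace ℂ H] [CompleteSpace H]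

/-- The von Neumann algebra generated by a set of bounded operators `S`:
the double commutant of `S ∪ S*`. -/
def vNgen (S : Set (H →L[ℂ] H)) : Set (H →L[ℂ] H) :=
  Set.centralizer (Set.centralizer (S ∪ star '' S))

/-- `M` is a von Neumann algebra acting on `H`: a unital *-subalgebra of `B(H)`
equal to its double commutant. -/
structure IsVonNeumannAlgebra (M : Set (H →L[ℂ] H)) : Prop where
  one_mem : (1 : H →L[ℂ] H) ∈ M
  add_mem : ∀ x ∈ M, ∀ y ∈ M, x + y ∈ M
  mul_mem : ∀ x ∈ M, ∀ y ∈ M, x * y ∈ M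
  smul_mem : ∀ (c : ℂ), ∀ x ∈ M, c • x ∈ M
  star_mem : ∀ x ∈ M, star x ∈ M
  double_commutant : Set.centralizer (Set.centralizer M) = M

/-- `τ` is a faithful tracial state on `M`. -/
structure IsFaithfulTracialState (M : Set (H →L[ℂ] H)) (τ : (H →L[ℂ] H) → ℂ) : Prop where
  map_add : ∀ x ∈ M, ∀ y ∈ M, τ (x + y) = τ x + τ y
  map_smul : ∀ (c : ℂ), ∀ x ∈ M, τ (c • x) = c * τ x
  map_one : τ 1 = 1
  nonneg : ∀ x ∈ M, 0 ≤ τ (star x * x)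
  tracial : ∀ x ∈ M, ∀ y ∈ M, τ (x * y) = τ (y * x)
  faithful : ∀ x ∈ M, τ (star x * x) = 0 → x = 0

/-- `M` is infinite dimensional: it is not contained in the span of finitely many operators. -/
def IsInfiniteDimensionalSet (M : Set (H →L[ℂ] H)) : Prop :=
  ∀ s : Finset (H →L[ℂ] H),
    ¬ (M ⊆ (Submodule.span ℂ (s : Set (H →L[ℂ] H)) : Set (H →L[ℂ] H)))

/-- `M` is a factor: its center consists of scalar multiples of the identity. -/
def IsFactor (M : Set (H →L[ℂ] H)) : Prop :=
  ∀ x ∈ M, (∀ y ∈ M, x * y = y * x) → ∃ c : ℂ, x = c • (1 : H →L[ℂ] H)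

/-- `M` is a II₁ factor with faithful tracial state `τ`. -/
structure IsII1Factor (M : Set (H →L[ℂ] H)) (τ : (H →L[ℂ] H) → ℂ) : Prop where
  vna : IsVonNeumannAlgebra M
  factor : IsFactor M
  infdim : IsInfiniteDimensionalSet M
  trace : IsFaithfulTracialState M τ

/-- The 2-norm `‖x‖₂ = τ(x*x)^{1/2}` associated to the trace `τ`. -/
def norm2 (τ : (H →L[ℂ] H) → ℂ) (x : H →L[ℂ] H) : ℝ :=
  Real.sqrt (τ (star x * x)).re

/-- `E` is the `τ`-preserving conditional expectation of `M` onto `B`. -/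
def IsCondExp (M B : Set (H →L[ℂ] H)) (τ : (H →L[ℂ] H) → ℂ)
    (E : (H →L[ℂ] H) → (H →L[ℂ] H)) : Prop :=
  (∀ x ∈ M, E x ∈ B) ∧ (∀ x ∈ M, ∀ b ∈ B, τ ((x - E x) * b) = 0)

/-- `A` is a maximal abelian *-subalgebra (MASA) of `M`. -/
def IsMasa (M A : Set (H →L[ℂ] H)) : Prop :=
  A ⊆ M ∧ (∀ a ∈ A, star a ∈ A) ∧ {x ∈ M | ∀ a ∈ A, x * a = a * x} = A

/-- `u` is a unitary operator. -/
def IsUnitary (u : H →L[ℂ] H) : Prop :=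
  star u * u = 1 ∧ u * star u = 1

/-- The set of normalizing unitaries of `A` in `M`: unitaries `u ∈ M` with `uAu* = A`. -/
def normalizerSet (M A : Set (H →L[ℂ] H)) : Set (H →L[ℂ] H) :=
  {u | u ∈ M ∧ IsUnitary u ∧ (fun a => u * a * star u) '' A = A}

/-- The normalizing algebra `N_M(A)''` of `A` in `M`. -/
def normAlg (M A : Set (H →L[ℂ] H)) : Set (H →L[ℂ] H) :=
  vNgen (normalizerSet M A)

/-- The triple `B ⊆ N ⊆ M` satisfies the relative weak asymptotic homomorphism property
relative to the trace `τ` and the conditional expectations `EB` and `EN`. -/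
def RelWAHP (M N B : Set (H →L[ℂ] H)) (τ : (H →L[ℂ] H) → ℂ)
    (EB EN : (H →L[ℂ] H) → (H →L[ℂ] H)) : Prop :=
  ∀ (n : ℕ) (x : Fin n → (H →L[ℂ] H)), (∀ i, x i ∈ M) →
    ∀ ε : ℝ, 0 < ε → ∃ u ∈ B, IsUnitary u ∧
      ∀ i j, norm2 τ (EB (x i * u * x j) - EB (EN (x i) * u * EN (x j))) < ε

section NormalizersOfTowers

open scoped InnerProductSpace Topology

namespace VonNeumannAlgebra

theorem mem_of_forall_commute (M : VonNeumannAlgebra H) {x : H →L[ℂ] H}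
    (h : ∀ T ∈ M.commutant, T * x = x * T) : x ∈ M := by
  rw [← M.commutant_commutant, mem_commutant_iff]
  exact h

theorem smul_mem' (M : VonNeumannAlgebra H) {x : H →L[ℂ] H} (c : ℂ) (hx : x ∈ M) : c • x ∈ M :=
  M.toStarSubalgebra.smul_mem hx c

/-- The projection onto the closed span of a set of vectors invariant under the commutant of `M`
belongs to `M`. -/
theorem exists_projection_span (M : VonNeumannAlgebra H) (V : Set H)
    (hV : ∀ T ∈ M.commutant, ∀ v ∈ V, T v ∈ V) :
    ∃ e ∈ M, IsStarProjection e ∧ (∀ v ∈ V, e v = v) ∧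
      ∀ g : H →L[ℂ] H, (∀ v ∈ V, g v = 0) → g * e = 0 := by
  set K : Submodule ℂ H := (Submodule.span ℂ V).topologicalClosure with hK
  have hcl : IsClosed (K : Set H) := Submodule.isClosed_topologicalClosure _
  have : CompleteSpace K := hcl.completeSpace_coe
  have hVK : ∀ v ∈ V, v ∈ K := fun v hv =>
    Submodule.le_topologicalClosure _ (Submodule.subset_span hv)
  have hrange : (K.starProjection).range = K := by
    exact Submodule.range_starProjection K
  refine ⟨K.starProjection, ?_, isStarProjection_starProjection, ?_, ?_⟩
  · rw [IsStarProjection.mem_iff isStarProjection_starProjection]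
    intro T hT
    rw [hrange, Module.End.mem_invtSubmodule]
    have hspan : Submodule.span ℂ V ≤ (Submodule.span ℂ V).comap (T : H →ₗ[ℂ] H) :=
      Submodule.span_le.2 fun v hv => Submodule.subset_span (hV T hT v hv)
    intro x hx
    have : T x ∈ closure (Submodule.span ℂ V : Set H) :=
      map_mem_closure T.continuous hx (fun y hy => hspan hy)
    exact this
  · intro v hv
    exact (Submodule.starProjection_eq_self_iff).2 (hVK v hv)
  · intro g hg
    ext x
    have h1 : Submodule.span ℂ V ≤ LinearMap.ker (g : H →ₗ[ℂ] H) :=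
      Submodule.span_le.2 fun v hv => hg v hv
    have h2 : K ≤ LinearMap.ker (g : H →ₗ[ℂ] H) :=
      Submodule.topologicalClosure_minimal _ h1 g.isClosed_ker
    exact h2 (K.starProjection_apply_mem x)

theorem exists_projection_range (M : VonNeumannAlgebra H) (S : Set (H →L[ℂ] H))
    (hS : ∀ s ∈ S, s ∈ M) :
    ∃ e ∈ M, IsStarProjection e ∧ (∀ s ∈ S, e * s = s) ∧
      ∀ g : H →L[ℂ] H, (∀ s ∈ S, g * s = 0) → g * e = 0 := by
  obtain ⟨e, heM, he, h1, h2⟩ := M.exists_projection_span {v | ∃ s ∈ S, ∃ ξ, v = s ξ} (by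
    rintro T hT v ⟨s, hs, ξ, rfl⟩
    refine ⟨s, hs, T ξ, ?_⟩
    have := mem_commutant_iff.1 hT s (hS s hs)
    exact (DFunLike.congr_fun this ξ).symm)
  refine ⟨e, heM, he, fun s hs => ?_, fun g hg => h2 g ?_⟩
  · ext ξ
    exact h1 _ ⟨s, hs, ξ, rfl⟩
  · rintro v ⟨s, hs, ξ, rfl⟩
    exact DFunLike.congr_fun (hg s hs) ξ

theorem cfc_mem (M : VonNeumannAlgebra H) {a : H →L[ℂ] H} (ha : a ∈ M)
    (f : ℝ → ℝ) : cfc f a ∈ M := by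
  refine M.mem_of_forall_commute fun T hT => ?_
  have : Commute a T := mem_commutant_iff.1 hT a ha
  exact (this.cfc_real f).symm

theorem exists_sqrt_mem (M : VonNeumannAlgebra H) {a : H →L[ℂ] H} (ha : a ∈ M) (h0 : 0 ≤ a) :
    ∃ b ∈ M, 0 ≤ b ∧ star b = b ∧ b * b = a := by
  have hsa : IsSelfAdjoint a := IsSelfAdjoint.of_nonneg h0
  have hb : 0 ≤ CFC.sqrt a := CFC.sqrt_nonneg a
  refine ⟨CFC.sqrt a, ?_, hb, (IsSelfAdjoint.of_nonneg hb).star_eq, CFC.sqrt_mul_sqrt_self a h0⟩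
  rw [CFC.sqrt_eq_real_sqrt a h0]
  rw [cfcₙ_eq_cfc]
  exact M.cfc_mem ha _

/-- The spectral projection of a self-adjoint element for the interval `(t, ∞)`. -/
theorem exists_spectral_projection (M : VonNeumannAlgebra H) {a : H →L[ℂ] H} (ha : a ∈ M)
    (hsa : IsSelfAdjoint a) (t : ℝ) :
    ∃ e ∈ M, ∃ c ∈ M, ∃ d ∈ M, IsStarProjection e ∧ 0 ≤ c ∧ 0 ≤ d ∧
      a - (t : ℂ) • 1 = c - d ∧ e * c = c ∧ e * d = 0 ∧ ∀ g, g * c = 0 → g * e = 0 := by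
  set b : H →L[ℂ] H := a - (t : ℂ) • 1 with hb
  have hbM : b ∈ M := sub_mem ha (M.smul_mem' _ (one_mem M))
  have hbsa : IsSelfAdjoint b := by
    refine hsa.sub ?_
    rw [isSelfAdjoint_iff]; simp
  have hcM : b⁺ ∈ M := by
    rw [CFC.posPart_def, cfcₙ_eq_cfc]; exact M.cfc_mem hbM _
  have hdM : b⁻ ∈ M := by
    rw [CFC.negPart_def, cfcₙ_eq_cfc]; exact M.cfc_mem hbM _
  obtain ⟨e, heM, he, h1, h2⟩ := M.exists_projection_range {b⁺} (by simpa using hcM)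
  refine ⟨e, heM, b⁺, hcM, b⁻, hdM, he, CFC.posPart_nonneg b, CFC.negPart_nonneg b,
    (CFC.posPart_sub_negPart b hbsa).symm, h1 _ rfl, ?_, fun g hg => h2 g (by simpa using hg)⟩
  have h3 : b⁻ * e = 0 := h2 _ (by simp [CFC.negPart_mul_posPart])
  have := congrArg star h3
  simpa [he.isSelfAdjoint.star_eq, (IsSelfAdjoint.of_nonneg (CFC.negPart_nonneg b)).star_eq]
    using this

/-- In a factor `x M y = 0` forces `x = 0` or `y = 0`. -/
theorem eq_zero_or_eq_zero_of_factor (M : VonNeumannAlgebra H)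
    (hM : IsFactor (M : Set (H →L[ℂ] H))) {x y : H →L[ℂ] H} (hy : y ∈ M)
    (h : ∀ z ∈ M, x * z * y = 0) : x = 0 ∨ y = 0 := by
  set V : Set H := {v | ∃ z ∈ M, ∃ ξ, v = z (y ξ)}
  obtain ⟨e, heM, he, h1, h2⟩ := M.exists_projection_span V (by
    rintro T hT v ⟨z, hz, ξ, rfl⟩
    refine ⟨z, hz, T ξ, ?_⟩
    have := mem_commutant_iff.1 hT (z * y) (mul_mem hz hy)
    exact (DFunLike.congr_fun this ξ).symm)
  obtain ⟨e', he'M, he', h1', h2'⟩ := M.commutant.exists_projection_span V (by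
    rw [commutant_commutant]
    rintro T hT v ⟨z, hz, ξ, rfl⟩
    exact ⟨T * z, mul_mem hT hz, ξ, rfl⟩)
  have hee : e' * e = e := by
    have := h2 (1 - e') (fun v hv => by simp [h1' v hv])
    rw [sub_mul, one_mul, sub_eq_zero] at this
    exact this.symm
  have hee' : e * e' = e' := by
    have := h2' (1 - e) (fun v hv => by simp [h1 v hv])
    rw [sub_mul, one_mul, sub_eq_zero] at this
    exact this.symm
  have heq : e = e' := by
    have := congrArg star hee
    simp only [star_mul, he.isSelfAdjoint.star_eq, he'.isSelfAdjoint.star_eq] at this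
    rw [← this, hee']
  obtain ⟨c, hc⟩ := hM e heM (fun z hz => by
    have := mem_commutant_iff.1 he'M z hz
    rw [heq]; exact this.symm)
  have hxe : x * e = 0 := h2 x (by
    rintro v ⟨z, hz, ξ, rfl⟩
    exact DFunLike.congr_fun (h z hz) ξ)
  have hey : e * y = y := by
    ext ξ
    exact h1 _ ⟨1, one_mem M, ξ, rfl⟩
  rw [hc] at hxe hey
  by_cases hc0 : c = 0
  · right
    rw [← hey, hc0]; simp
  · left
    simpa [hc0] using hxe

end VonNeumannAlgebra

section WeakOperator

open ContinuousLinearMapWOT Filter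

/-- A set of bounded operators that is closed in the weak operator topology. -/
def IsWOTClosed (C : Set (H →L[ℂ] H)) : Prop :=
  IsClosed {x : H →WOT[ℂ] H | x.toCLM ∈ C}

theorem isCompact_wot_closedBall (r : ℝ) :
    IsCompact {x : H →WOT[ℂ] H | ‖x.toCLM‖ ≤ r} := by
  rw [isCompact_iff_ultrafilter_le_nhds]
  intro 𝒰 h𝒰
  have hmem : ∀ᶠ x in (𝒰 : Filter (H →WOT[ℂ] H)), ‖x.toCLM‖ ≤ r := by
    have := le_principal_iff.1 h𝒰
    exact this
  have hbound : ∀ v w : H, ∀ x : H →WOT[ℂ] H, ‖x.toCLM‖ ≤ r → ‖⟪x v, w⟫_ℂ‖ ≤ r * ‖v‖ * ‖w‖ := by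
    intro v w x hx
    refine (norm_inner_le_norm _ _).trans ?_
    gcongr
    exact (x.toCLM.le_opNorm v).trans (by gcongr)
  have hlim : ∀ v w : H, ∃ c : ℂ, ‖c‖ ≤ r * ‖v‖ * ‖w‖ ∧
      Tendsto (fun x : H →WOT[ℂ] H => ⟪x v, w⟫_ℂ) 𝒰 (𝓝 c) := by
    intro v w
    have hc := isCompact_closedBall (0 : ℂ) (r * ‖v‖ * ‖w‖)
    rw [isCompact_iff_ultrafilter_le_nhds] at hc
    obtain ⟨c, hc1, hc2⟩ := hc (𝒰.map (fun x : H →WOT[ℂ] H => ⟪x v, w⟫_ℂ)) (by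
      simp only [le_principal_iff, Ultrafilter.mem_coe, Ultrafilter.mem_map]
      filter_upwards [hmem] with x hx
      simpa using hbound v w x hx)
    exact ⟨c, by simpa using hc1, hc2⟩
  choose B hB1 hB2 using hlim
  let B' : H →ₗ⋆[ℂ] H →ₗ[ℂ] ℂ := LinearMap.mk₂'ₛₗ (starRingEnd ℂ) (RingHom.id ℂ) B
    (fun v v' w => tendsto_nhds_unique (hB2 _ _) (by
      simpa [inner_add_left] using (hB2 v w).add (hB2 v' w)))
    (fun c v w => tendsto_nhds_unique (hB2 _ _) (by
      simpa [inner_smul_left, mul_comm] using (hB2 v w).const_mul (starRingEnd ℂ c)))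
    (fun v w w' => tendsto_nhds_unique (hB2 _ _) (by
      simpa [inner_add_right] using (hB2 v w).add (hB2 v w')))
    (fun c v w => tendsto_nhds_unique (hB2 _ _) (by
      simpa [inner_smul_right] using (hB2 v w).const_mul c))
  let B'' := B'.mkContinuous₂ r hB1
  have hr : 0 ≤ r := by
    obtain ⟨x, hx⟩ := hmem.exists
    exact (norm_nonneg _).trans hx
  refine ⟨ofCLM (InnerProductSpace.continuousLinearMapOfBilin B''), ?_, ?_⟩
  · change ‖InnerProductSpace.continuousLinearMapOfBilin B''‖ ≤ r
    refine ContinuousLinearMap.opNorm_le_bound _ hr fun v => ?_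
    set T := InnerProductSpace.continuousLinearMapOfBilin B''
    have h1 : ⟪T v, T v⟫_ℂ = B v (T v) :=
      InnerProductSpace.continuousLinearMapOfBilin_apply B'' v (T v)
    have h2 := hB1 v (T v)
    rw [← h1, inner_self_eq_norm_sq_to_K] at h2
    simp only [Complex.coe_algebraMap, norm_pow, Complex.norm_real, norm_norm] at h2
    by_cases h0 : ‖T v‖ = 0
    · rw [h0]; positivity
    · have : 0 < ‖T v‖ := lt_of_le_of_ne (norm_nonneg _) (Ne.symm h0)
      nlinarith
  · rw [le_nhds_iff_forall_inner_apply_le_nhds]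
    intro v w
    have h1 : ⟪w, (ofCLM (InnerProductSpace.continuousLinearMapOfBilin B'') : H →WOT[ℂ] H) v⟫_ℂ
        = starRingEnd ℂ (B v w) := by
      rw [← inner_conj_symm]
      congr 1
      exact InnerProductSpace.continuousLinearMapOfBilin_apply B'' v w
    rw [h1]
    have := (Complex.continuous_conj.tendsto _).comp (hB2 v w)
    refine Tendsto.congr (fun x => ?_) this
    simp

theorem IsWOTClosed.inter {C D : Set (H →L[ℂ] H)} (hC : IsWOTClosed C) (hD : IsWOTClosed D) :
    IsWOTClosed (C ∩ D) :=
  IsClosed.inter hC hD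

theorem isWOTClosed_setOf_forall {ι : Sort*} {p : ι → (H →L[ℂ] H) → Prop}
    (h : ∀ i, IsWOTClosed {x | p i x}) : IsWOTClosed {x | ∀ i, p i x} := by
  have : {x : H →WOT[ℂ] H | x.toCLM ∈ {x | ∀ i, p i x}} = ⋂ i, {x | p i x.toCLM} := by
    ext; simp
  rw [IsWOTClosed, this]
  exact isClosed_iInter h

theorem isWOTClosed_closedBall (r : ℝ) : IsWOTClosed {x : H →L[ℂ] H | ‖x‖ ≤ r} :=
  (isCompact_wot_closedBall r).isClosed

theorem continuous_wot_mul_mul (a b : H →L[ℂ] H) :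
    Continuous fun x : H →WOT[ℂ] H => (ofCLM (a * x.toCLM * b) : H →WOT[ℂ] H) := by
  rw [ContinuousLinearMapWOT.continuous_iff]
  intro v w
  have : (fun x : H →WOT[ℂ] H => ⟪w, (ofCLM (a * x.toCLM * b) : H →WOT[ℂ] H) v⟫_ℂ) =
      fun x => ⟪star a w, x (b v)⟫_ℂ := by
    ext x
    rw [ContinuousLinearMap.star_eq_adjoint, ContinuousLinearMap.adjoint_inner_left]
    rfl
  rw [this]
  fun_prop

theorem isWOTClosed_mul_eq (a b c d : H →L[ℂ] H) :
    IsWOTClosed {x : H →L[ℂ] H | a * x * b = c * x * d} := by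
  have := isClosed_eq (continuous_wot_mul_mul a b) (continuous_wot_mul_mul c d)
  have hs : {x : H →WOT[ℂ] H | x.toCLM ∈ {x : H →L[ℂ] H | a * x * b = c * x * d}} =
      {x | (ofCLM (a * x.toCLM * b) : H →WOT[ℂ] H) = ofCLM (c * x.toCLM * d)} := by
    ext x
    exact ⟨fun h => congrArg ofCLM h, fun h => congrArg toCLM h⟩
  rw [IsWOTClosed, hs]
  exact this

theorem isWOTClosed_mul_eq_const (a b c : H →L[ℂ] H) :
    IsWOTClosed {x : H →L[ℂ] H | a * x * b = c} := by
  have := isClosed_eq (continuous_wot_mul_mul a b)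
    (continuous_const (y := (ofCLM c : H →WOT[ℂ] H)))
  have hs : {x : H →WOT[ℂ] H | x.toCLM ∈ {x : H →L[ℂ] H | a * x * b = c}} =
      {x | (ofCLM (a * x.toCLM * b) : H →WOT[ℂ] H) = ofCLM c} := by
    ext x
    exact ⟨fun h => congrArg ofCLM h, fun h => congrArg toCLM h⟩
  rw [IsWOTClosed, hs]
  exact this

theorem VonNeumannAlgebra.isWOTClosed (M : VonNeumannAlgebra H) :
    IsWOTClosed (M : Set (H →L[ℂ] H)) := by
  have : (M : Set (H →L[ℂ] H)) = {x | ∀ T : M.commutant, (T : H →L[ℂ] H) * x * 1 = 1 * x * T} := by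
    ext x
    simp only [Set.mem_ofPred_eq, mul_one, one_mul, SetLike.mem_coe]
    exact ⟨fun hx T => (VonNeumannAlgebra.mem_commutant_iff.1 T.2 x hx).symm,
      fun h => M.mem_of_forall_commute fun T hT => h ⟨T, hT⟩⟩
  rw [this]
  exact isWOTClosed_setOf_forall fun T => isWOTClosed_mul_eq _ _ _ _

theorem isWOTClosed_isSelfAdjoint : IsWOTClosed {x : H →L[ℂ] H | IsSelfAdjoint x} := by
  have := isClosed_eq (continuous_star (R := H →WOT[ℂ] H)) continuous_id
  have hs : {x : H →WOT[ℂ] H | x.toCLM ∈ {x : H →L[ℂ] H | IsSelfAdjoint x}} =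
      {x | star x = id x} := by
    ext x
    exact ⟨fun h => congrArg ofCLM h, fun h => congrArg toCLM h⟩
  rw [IsWOTClosed, hs]
  exact this

/-- The functional `x ↦ ∑ ⟪η, x ξ⟫`, the sum ranging over the pairs `(η, ξ)` in a list. -/
def vecSum (l : List (H × H)) (x : H →L[ℂ] H) : ℂ :=
  (l.map fun p => ⟪p.1, x p.2⟫_ℂ).sum

theorem continuous_vecSum (l : List (H × H)) :
    Continuous fun x : H →WOT[ℂ] H => vecSum l x.toCLM := by
  induction l with
  | nil => simpa [vecSum] using continuous_const
  | cons p l ih =>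
    simp only [vecSum, List.map_cons, List.sum_cons] at ih ⊢
    refine Continuous.add ?_ ih
    change Continuous fun x : H →WOT[ℂ] H => ⟪p.1, x p.2⟫_ℂ
    fun_prop

theorem isWOTClosed_vecSum (l : List (H × H)) (a b : H →L[ℂ] H) {Z : Set ℂ} (hZ : IsClosed Z) :
    IsWOTClosed {x : H →L[ℂ] H | vecSum l (a * x * b) ∈ Z} :=
  hZ.preimage ((continuous_vecSum l).comp (continuous_wot_mul_mul a b))

/-- Finite intersection property for weakly closed sets and bounded operators. -/
theorem exists_forall_mem_of_finite {ι : Type*} (t : ι → Set (H →L[ℂ] H))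
    (ht : ∀ i, IsWOTClosed (t i)) (r : ℝ)
    (h : ∀ u : Finset ι, ∃ x : H →L[ℂ] H, ‖x‖ ≤ r ∧ ∀ i ∈ u, x ∈ t i) :
    ∃ x : H →L[ℂ] H, ‖x‖ ≤ r ∧ ∀ i, x ∈ t i := by
  obtain ⟨x, hx⟩ := (isCompact_wot_closedBall (H := H) r).inter_iInter_nonempty
    (fun i => {x : H →WOT[ℂ] H | x.toCLM ∈ t i}) ht (fun u => by
      obtain ⟨x, hx, hxu⟩ := h u
      exact ⟨ofCLM x, hx, by simpa using hxu⟩)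
  exact ⟨x.toCLM, hx.1, by simpa using hx.2⟩

/-- An element `v` of `C` which is not the midpoint of a nontrivial segment in `C`. -/
def IsExtremeIn (C : Set (H →L[ℂ] H)) (v : H →L[ℂ] H) : Prop :=
  v ∈ C ∧ ∀ y, v + y ∈ C → v - y ∈ C → y = 0

theorem isExtremeIn_of_mem_extremePoints {C : Set (H →L[ℂ] H)} {v : H →WOT[ℂ] H}
    (hv : v ∈ Set.extremePoints ℝ {x : H →WOT[ℂ] H | x.toCLM ∈ C}) : IsExtremeIn C v.toCLM := by
  refine ⟨hv.1, fun y h1 h2 => ?_⟩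
  have := hv.2 (x₁ := v + ofCLM y) h1 (x₂ := v - ofCLM y) h2
    ⟨1 / 2, 1 / 2, by norm_num, by norm_num, by norm_num, by module⟩
  have : (ofCLM y : H →WOT[ℂ] H) = 0 := by simpa using this
  exact congrArg toCLM this

theorem convex_wot {C : Set (H →L[ℂ] H)} (hC : Convex ℝ C) :
    Convex ℝ {x : H →WOT[ℂ] H | x.toCLM ∈ C} :=
  fun _ hx _ hy _ _ ha hb hab => hC hx hy ha hb hab

theorem exists_isExtremeIn {C : Set (H →L[ℂ] H)} (hC : IsWOTClosed C) {r : ℝ}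
    (hr : ∀ x ∈ C, ‖x‖ ≤ r) (hne : C.Nonempty) : ∃ v, IsExtremeIn C v := by
  have hcomp : IsCompact {x : H →WOT[ℂ] H | x.toCLM ∈ C} :=
    (isCompact_wot_closedBall r).of_isClosed_subset hC fun x hx => hr _ hx
  obtain ⟨x, hx⟩ := hne
  obtain ⟨v, hv⟩ := hcomp.extremePoints_nonempty ⟨ofCLM x, hx⟩
  exact ⟨_, isExtremeIn_of_mem_extremePoints hv⟩

theorem subset_of_isExtremeIn_mem {C D : Set (H →L[ℂ] H)} (hC : IsWOTClosed C) {r : ℝ}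
    (hr : ∀ x ∈ C, ‖x‖ ≤ r) (hconv : Convex ℝ C) (hD : IsWOTClosed D) (hDconv : Convex ℝ D)
    (h : ∀ v, IsExtremeIn C v → v ∈ D) : C ⊆ D := by
  have hcomp : IsCompact {x : H →WOT[ℂ] H | x.toCLM ∈ C} :=
    (isCompact_wot_closedBall r).of_isClosed_subset hC fun x hx => hr _ hx
  intro x hx
  have hmem : (ofCLM x : H →WOT[ℂ] H) ∈ {x : H →WOT[ℂ] H | x.toCLM ∈ C} := hx
  rw [← closure_convexHull_extremePoints hcomp (convex_wot hconv)] at hmem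
  have hsub : closure (convexHull ℝ (Set.extremePoints ℝ {x : H →WOT[ℂ] H | x.toCLM ∈ C})) ⊆
      {x : H →WOT[ℂ] H | x.toCLM ∈ D} := closure_minimal (convexHull_min
    (fun v hv => h _ (isExtremeIn_of_mem_extremePoints hv)) (convex_wot hDconv)) hD
  exact hsub hmem

end WeakOperator

section Projections

theorem IsStarProjection.eq_sq {e : H →L[ℂ] H} (he : IsStarProjection e) : e * e = e :=
  he.isIdempotentElem.eq

theorem IsStarProjection.star_eq' {e : H →L[ℂ] H} (he : IsStarProjection e) : star e = e :=
  he.isSelfAdjoint.star_eq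

theorem mul_eq_zero_of_conj_eq_zero {b g : H →L[ℂ] H} (hb : 0 ≤ b) (h : star g * b * g = 0) :
    b * g = 0 := by
  have hs := CFC.sqrt_mul_sqrt_self b hb
  have hsa : star (CFC.sqrt b) = CFC.sqrt b :=
    (IsSelfAdjoint.of_nonneg (CFC.sqrt_nonneg b)).star_eq
  have h2 : star (CFC.sqrt b * g) * (CFC.sqrt b * g) = 0 := by
    rw [star_mul, hsa, ← mul_assoc, mul_assoc (star g), hs, h]
  have h3 := (CStarRing.star_mul_self_eq_zero_iff _).1 h2
  rw [← hs, mul_assoc, h3, mul_zero]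

/-- The first binary digit of a positive contraction. -/
theorem VonNeumannAlgebra.exists_halving (M : VonNeumannAlgebra H) {a e : H →L[ℂ] H} (ha : a ∈ M)
    (h0 : 0 ≤ a) (h1 : a ≤ 1) (hae : a * e = a) :
    ∃ p ∈ M, ∃ b ∈ M, IsStarProjection p ∧ 0 ≤ b ∧ b ≤ 1 ∧ p * e = p ∧ b * e = b ∧
      a = (1 / 2 : ℂ) • (p + b) := by
  obtain ⟨p, hpM, c, hcM, d, hdM, hp, hc, hd, hacd, hpc, hpd, -⟩ :=
    M.exists_spectral_projection ha (IsSelfAdjoint.of_nonneg h0) (1 / 2)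
  have hcs := (IsSelfAdjoint.of_nonneg hc).star_eq
  have hds := (IsSelfAdjoint.of_nonneg hd).star_eq
  have hcp : c * p = c := by
    have := congrArg star hpc; rwa [star_mul, hcs, hp.star_eq'] at this
  have hdp : d * p = 0 := by
    have := congrArg star hpd; rwa [star_mul, hds, hp.star_eq', star_zero] at this
  have ha' : a = (1 / 2 : ℂ) • 1 + c - d := by
    rw [sub_eq_iff_eq_add] at hacd; rw [hacd]; push_cast; abel
  have hap : a * p = (1 / 2 : ℂ) • p + c := by
    rw [ha', sub_mul, add_mul, hdp, hcp, smul_mul_assoc, one_mul, sub_zero]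
  have hpa : p * a = (1 / 2 : ℂ) • p + c := by
    rw [ha', mul_sub, mul_add, hpd, hpc, mul_smul_comm, mul_one, sub_zero]
  have hhalf : (0 : ℂ) ≤ 1 / 2 := by
    simp
  have hpe : p * e = p := by
    have hk : (0 : H →L[ℂ] H) ≤ (1 / 2 : ℂ) • p + c :=
      add_nonneg (smul_nonneg hhalf hp.nonneg) hc
    have h3 : ((1 / 2 : ℂ) • p + c) * (1 - e) = 0 := by
      rw [← hpa, mul_sub, mul_one, mul_assoc, hae, sub_self]
    have h4 : star (1 - e) * ((1 / 2 : ℂ) • p) * (1 - e) +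
        star (1 - e) * c * (1 - e) = 0 := by
      rw [← add_mul, ← mul_add, mul_assoc, h3, mul_zero]
    have h5 := (add_eq_zero_iff_of_nonneg
      (star_left_conjugate_nonneg (smul_nonneg hhalf hp.nonneg) _)
      (star_left_conjugate_nonneg hc _)).1 h4
    have h6 := mul_eq_zero_of_conj_eq_zero (smul_nonneg hhalf hp.nonneg) h5.1
    have h7 : p * (1 - e) = 0 := by simpa using h6
    rw [mul_sub, mul_one, sub_eq_zero] at h7
    exact h7.symm
  have hb : (2 : ℂ) • a - p = (2 : ℂ) • c + star (1 - p) * ((2 : ℂ) • a) * (1 - p) := by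
    have e1 : star (1 - p) * ((2 : ℂ) • a) * (1 - p) = (2 : ℂ) • a - (2 : ℂ) • (p * a)
        - (2 : ℂ) • (a * p) + (2 : ℂ) • (p * a * p) := by
      rw [star_sub, star_one, hp.star_eq']
      simp only [mul_sub, sub_mul, one_mul, mul_one, mul_smul_comm, smul_mul_assoc, mul_assoc]
      module
    rw [e1, mul_assoc, hap, hpa, mul_add, hpc, mul_smul_comm, hp.eq_sq]
    module
  have h2 : (0 : ℂ) ≤ 2 := by norm_num
  refine ⟨p, hpM, (2 : ℂ) • a - p, sub_mem (M.smul_mem' _ ha) hpM, hp, ?_, ?_, hpe, ?_, ?_⟩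
  · rw [hb]
    exact add_nonneg (smul_nonneg h2 hc) (star_left_conjugate_nonneg (smul_nonneg h2 h0) _)
  · have e2 : (1 : H →L[ℂ] H) - ((2 : ℂ) • a - p) =
        (2 : ℂ) • (star p * (1 - a) * p) + (2 : ℂ) • d := by
      rw [hp.star_eq', mul_assoc, sub_mul, hap, one_mul, mul_sub, mul_add, hp.eq_sq, hpc,
        mul_smul_comm, hp.eq_sq, ha']
      module
    rw [← sub_nonneg, e2]
    exact add_nonneg (smul_nonneg h2 (star_left_conjugate_nonneg (sub_nonneg.2 h1) _))
      (smul_nonneg h2 hd)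
  · rw [sub_mul, smul_mul_assoc, hae, hpe]
  · module

theorem exists_smul_le_one (a : H →L[ℂ] H) (h0 : 0 ≤ a) :
    ∃ c : ℝ, 0 < c ∧ (c : ℂ) • a ≤ 1 := by
  refine ⟨(‖a‖ + 1)⁻¹, by positivity, ?_⟩
  have h1 : a ≤ algebraMap ℝ _ ‖a‖ := IsSelfAdjoint.le_algebraMap_norm_self (IsSelfAdjoint.of_nonneg h0)
  have h2 : a ≤ ((‖a‖ + 1 : ℝ) : ℂ) • (1 : H →L[ℂ] H) := by
    refine h1.trans ?_
    rw [← sub_nonneg]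
    have : ((‖a‖ + 1 : ℝ) : ℂ) • (1 : H →L[ℂ] H) - algebraMap ℝ _ ‖a‖ = 1 := by
      ext x
      simp [Algebra.algebraMap_eq_smul_one, add_smul]
    rw [this]; exact zero_le_one
  have h3 : (0 : ℂ) ≤ ((‖a‖ + 1)⁻¹ : ℝ) := by
    rw [Complex.zero_le_real]; positivity
  have := smul_le_smul_of_nonneg_left h2 h3
  rwa [smul_smul, ← Complex.ofReal_mul, inv_mul_cancel₀ (by positivity), Complex.ofReal_one,
    one_smul] at this

/-- Operators commuting with the projections of `M` commute with `M`. -/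
theorem VonNeumannAlgebra.commute_of_forall_projection (M : VonNeumannAlgebra H)
    {S T : H →L[ℂ] H}
    (h : ∀ p ∈ M, IsStarProjection p → S * p = p * T) {x : H →L[ℂ] H} (hx : x ∈ M) :
    S * x = x * T := by
  have key : ∀ n : ℕ, ∀ a ∈ M, 0 ≤ a → a ≤ 1 →
      ‖S * a - a * T‖ ≤ (1 / 2) ^ n * (‖S‖ + ‖T‖) := by
    intro n
    induction n with
    | zero =>
      intro a ha h0 h1
      have hn : ‖a‖ ≤ 1 := (CStarAlgebra.norm_le_one_iff_of_nonneg a h0).2 h1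
      calc ‖S * a - a * T‖ ≤ ‖S * a‖ + ‖a * T‖ := norm_sub_le _ _
        _ ≤ ‖S‖ * ‖a‖ + ‖a‖ * ‖T‖ := add_le_add (norm_mul_le _ _) (norm_mul_le _ _)
        _ ≤ _ := by
          have := norm_nonneg S
          have := norm_nonneg T
          nlinarith
    | succ n ih =>
      intro a ha h0 h1
      obtain ⟨p, hpM, b, hbM, hp, hb0, hb1, -, -, hab⟩ :=
        M.exists_halving ha h0 h1 (e := 1) (mul_one a)
      have h3 : S * a - a * T = (1 / 2 : ℂ) • (S * b - b * T) := by
        rw [hab, mul_smul_comm, smul_mul_assoc, mul_add, add_mul, h p hpM hp]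
        module
      rw [h3, norm_smul, pow_succ']
      have := ih b hbM hb0 hb1
      have h4 : ‖(1 / 2 : ℂ)‖ = 1 / 2 := by simp
      rw [h4, mul_assoc]
      gcongr
  have key2 : ∀ a ∈ M, 0 ≤ a → S * a = a * T := by
    intro a ha h0
    obtain ⟨c, hc, hca⟩ := exists_smul_le_one a h0
    have h2 : ‖S * ((c : ℂ) • a) - ((c : ℂ) • a) * T‖ ≤ 0 := by
      refine ge_of_tendsto' (x := Filter.atTop)
        (f := fun n : ℕ => (1 / 2 : ℝ) ^ n * (‖S‖ + ‖T‖)) ?_ fun n =>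
        key n _ (M.smul_mem' _ ha) (smul_nonneg (by simpa using hc.le) h0) hca
      have := (tendsto_pow_atTop_nhds_zero_of_lt_one (r := (1 / 2 : ℝ)) (by norm_num)
        (by norm_num)).mul_const (‖S‖ + ‖T‖)
      simpa using this
    have h3 := norm_le_zero_iff.1 h2
    rw [mul_smul_comm, smul_mul_assoc, ← smul_sub, smul_eq_zero, sub_eq_zero] at h3
    exact h3.resolve_left (by exact_mod_cast hc.ne')
  have key3 : ∀ a ∈ M, IsSelfAdjoint a → S * a = a * T := by
    intro a ha hsa
    have hpos : a⁺ ∈ M := by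
      rw [CFC.posPart_def, cfcₙ_eq_cfc]; exact M.cfc_mem ha _
    have hneg : a⁻ ∈ M := by
      rw [CFC.negPart_def, cfcₙ_eq_cfc]; exact M.cfc_mem ha _
    rw [← CFC.posPart_sub_negPart a hsa, mul_sub, sub_mul, key2 _ hpos (CFC.posPart_nonneg a),
      key2 _ hneg (CFC.negPart_nonneg a)]
  have hsum : x = (1 / 2 : ℂ) • (x + star x) + (Complex.I / 2) • (-Complex.I • (x - star x)) := by
    rw [smul_smul]
    have : Complex.I / 2 * -Complex.I = 1 / 2 := by
      linear_combination (-1 / 2) * Complex.I_mul_I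
    rw [this]; module
  have hm1 : S * (x + star x) = (x + star x) * T :=
    key3 _ (add_mem hx (star_mem hx)) (by rw [isSelfAdjoint_iff]; simp [add_comm])
  have hm2 : S * (-Complex.I • (x - star x)) = (-Complex.I • (x - star x)) * T :=
    key3 _ (M.smul_mem' _ (sub_mem hx (star_mem hx))) (by
      rw [isSelfAdjoint_iff, star_smul, star_sub, star_star, star_neg]
      simp only [Complex.star_def, Complex.conj_I]
      module)
  rw [hsum, mul_add, add_mul, mul_smul_comm, mul_smul_comm, hm1, hm2]
  simp only [smul_mul_assoc]

end Projections

namespace IsFaithfulTracialState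

variable {M : VonNeumannAlgebra H} {τ : (H →L[ℂ] H) → ℂ}

theorem map_zero (hτ : IsFaithfulTracialState (M : Set (H →L[ℂ] H)) τ) : τ 0 = 0 := by
  have := hτ.map_smul 0 1 (one_mem M)
  simpa using this

theorem map_neg (hτ : IsFaithfulTracialState (M : Set (H →L[ℂ] H)) τ) {x : H →L[ℂ] H}
    (hx : x ∈ M) : τ (-x) = -τ x := by
  have := hτ.map_smul (-1) x hx
  simpa using this

theorem map_sub (hτ : IsFaithfulTracialState (M : Set (H →L[ℂ] H)) τ) {x y : H →L[ℂ] H}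
    (hx : x ∈ M) (hy : y ∈ M) : τ (x - y) = τ x - τ y := by
  have h2 : -y ∈ (M : Set (H →L[ℂ] H)) := neg_mem hy
  rw [sub_eq_add_neg, hτ.map_add x hx _ h2, hτ.map_neg hy, sub_eq_add_neg]

theorem map_sum (hτ : IsFaithfulTracialState (M : Set (H →L[ℂ] H)) τ) {ι : Type*}
    (s : Finset ι) (f : ι → H →L[ℂ] H) (hf : ∀ i ∈ s, f i ∈ M) :
    τ (∑ i ∈ s, f i) = ∑ i ∈ s, τ (f i) := by
  classical
  induction s using Finset.induction_on with
  | empty => simpa using hτ.map_zero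
  | insert a s ha ih =>
    rw [Finset.sum_insert ha, Finset.sum_insert ha,
      hτ.map_add _ (hf a (Finset.mem_insert_self a s)) _
        (sum_mem fun i hi => hf i (Finset.mem_insert_of_mem hi)),
      ih fun i hi => hf i (Finset.mem_insert_of_mem hi)]

theorem map_star (hτ : IsFaithfulTracialState (M : Set (H →L[ℂ] H)) τ) {x : H →L[ℂ] H}
    (hx : x ∈ M) : τ (star x) = starRingEnd ℂ (τ x) := by
  have key : ∀ c : ℂ, (c * τ (star x) + starRingEnd ℂ c * τ x).im = 0 := by
    intro c
    have hsx : star x ∈ M := star_mem hx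
    have h1 := (Complex.nonneg_iff.1 (hτ.nonneg (x + c • 1)
      (add_mem hx (M.smul_mem' c (one_mem M))))).2
    have h2 : star (x + c • (1 : H →L[ℂ] H)) * (x + c • 1) =
        star x * x + (c • star x + (starRingEnd ℂ c • x + (starRingEnd ℂ c * c) • 1)) := by
      rw [star_add, star_smul, star_one]
      simp only [add_mul, mul_add, smul_mul_assoc, mul_smul_comm, one_mul, mul_one,
        Complex.star_def]
      module
    have m1 : star x * x ∈ M := mul_mem hsx hx
    have m2 := M.smul_mem' c hsx
    have m3 := M.smul_mem' (starRingEnd ℂ c) hx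
    have m4 := M.smul_mem' (starRingEnd ℂ c * c) (one_mem M)
    rw [h2, hτ.map_add _ m1 _ (add_mem m2 (add_mem m3 m4)), hτ.map_add _ m2 _ (add_mem m3 m4),
      hτ.map_add _ m3 _ m4, hτ.map_smul _ _ hsx, hτ.map_smul _ _ hx, hτ.map_smul _ _ (one_mem M),
      hτ.map_one] at h1
    have h3 := (Complex.nonneg_iff.1 (hτ.nonneg x hx)).2
    simp only [Complex.add_im, Complex.mul_im, Complex.mul_re, Complex.conj_re,
      Complex.conj_im, Complex.one_re, Complex.one_im] at h1 ⊢
    linarith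
  have k1 := key 1
  have k2 := key Complex.I
  simp at k1 k2
  apply Complex.ext
  · simp; linarith
  · simp; linarith

theorem nonneg_of_nonneg (hτ : IsFaithfulTracialState (M : Set (H →L[ℂ] H)) τ) {a : H →L[ℂ] H}
    (ha : a ∈ M) (h0 : 0 ≤ a) : 0 ≤ (τ a).re := by
  obtain ⟨b, hb, -, hbs, rfl⟩ := M.exists_sqrt_mem ha h0
  have := (Complex.nonneg_iff.1 (hτ.nonneg b hb)).1
  rwa [hbs] at this

theorem re_mono (hτ : IsFaithfulTracialState (M : Set (H →L[ℂ] H)) τ) {a b : H →L[ℂ] H}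
    (ha : a ∈ M) (hb : b ∈ M) (hab : a ≤ b) : (τ a).re ≤ (τ b).re := by
  have := hτ.nonneg_of_nonneg (sub_mem hb ha) (sub_nonneg.2 hab)
  rw [hτ.map_sub hb ha, Complex.sub_re] at this
  linarith

theorem norm2_sq (hτ : IsFaithfulTracialState (M : Set (H →L[ℂ] H)) τ) {x : H →L[ℂ] H}
    (hx : x ∈ M) : norm2 τ x ^ 2 = (τ (star x * x)).re :=
  Real.sq_sqrt (Complex.nonneg_iff.1 (hτ.nonneg x hx)).1

theorem norm2_nonneg (τ : (H →L[ℂ] H) → ℂ) (x : H →L[ℂ] H) : 0 ≤ norm2 τ x :=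
  Real.sqrt_nonneg _

theorem im_eq_zero (hτ : IsFaithfulTracialState (M : Set (H →L[ℂ] H)) τ) {x : H →L[ℂ] H}
    (hx : x ∈ M) : (τ (star x * x)).im = 0 :=
  (Complex.nonneg_iff.1 (hτ.nonneg x hx)).2.symm

/-- The semi-inner product `⟨x, y⟩ = τ(x*y)` on `M`. -/
@[reducible]
def core (hτ : IsFaithfulTracialState (M : Set (H →L[ℂ] H)) τ) :
    PreInnerProductSpace.Core ℂ M.toStarSubalgebra where
  inner x y := τ (star (x : H →L[ℂ] H) * y)
  conj_inner_symm x y := by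
    rw [← hτ.map_star (mul_mem (star_mem y.2) x.2), star_mul, star_star]
  re_inner_nonneg x := (Complex.nonneg_iff.1 (hτ.nonneg x x.2)).1
  add_left x y z := by
    simp only [AddMemClass.coe_add, star_add, add_mul]
    exact hτ.map_add _ (mul_mem (star_mem x.2) z.2) _ (mul_mem (star_mem y.2) z.2)
  smul_left x y c := by
    change τ (star (c • (x : H →L[ℂ] H)) * y) = _
    rw [star_smul, smul_mul_assoc]
    exact hτ.map_smul _ _ (mul_mem (star_mem x.2) y.2)

theorem norm_tau_star_mul_le (hτ : IsFaithfulTracialState (M : Set (H →L[ℂ] H)) τ)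
    {x y : H →L[ℂ] H} (hx : x ∈ M) (hy : y ∈ M) :
    ‖τ (star x * y)‖ ≤ norm2 τ x * norm2 τ y := by
  have h := @InnerProductSpace.Core.inner_mul_inner_self_le ℂ M.toStarSubalgebra _ _ _ hτ.core
    ⟨x, hx⟩ ⟨y, hy⟩
  change ‖τ (star x * y)‖ * ‖τ (star y * x)‖ ≤ (τ (star x * x)).re * (τ (star y * y)).re at h
  have h2 : τ (star y * x) = starRingEnd ℂ (τ (star x * y)) := by
    rw [← hτ.map_star (mul_mem (star_mem hx) hy), star_mul, star_star]
  rw [h2, RCLike.norm_conj, ← hτ.norm2_sq hx, ← hτ.norm2_sq hy] at h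
  have := norm2_nonneg τ x
  have := norm2_nonneg τ y
  refine abs_le_of_sq_le_sq' ?_ (by positivity) |>.2
  nlinarith

theorem norm2_add_le (hτ : IsFaithfulTracialState (M : Set (H →L[ℂ] H)) τ)
    {x y : H →L[ℂ] H} (hx : x ∈ M) (hy : y ∈ M) :
    norm2 τ (x + y) ≤ norm2 τ x + norm2 τ y := by
  have h0x := norm2_nonneg τ x
  have h0y := norm2_nonneg τ y
  refine abs_le_of_sq_le_sq' ?_ (by positivity) |>.2
  have hsx : star x ∈ M := star_mem hx
  have hsy : star y ∈ M := star_mem hy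
  rw [hτ.norm2_sq (add_mem hx hy), star_add, add_mul, mul_add, mul_add,
    hτ.map_add _ (add_mem (mul_mem hsx hx) (mul_mem hsx hy)) _
      (add_mem (mul_mem hsy hx) (mul_mem hsy hy)),
    hτ.map_add _ (mul_mem hsx hx) _ (mul_mem hsx hy),
    hτ.map_add _ (mul_mem hsy hx) _ (mul_mem hsy hy)]
  have h1 := (Complex.abs_re_le_norm _).trans (hτ.norm_tau_star_mul_le hx hy)
  have h2 := (Complex.abs_re_le_norm _).trans (hτ.norm_tau_star_mul_le hy hx)
  have h1' := (abs_le.1 h1).2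
  have h2' := (abs_le.1 h2).2
  simp only [Complex.add_re]
  rw [← hτ.norm2_sq hx, ← hτ.norm2_sq hy]
  nlinarith

theorem norm2_neg (τ : (H →L[ℂ] H) → ℂ) (x : H →L[ℂ] H) : norm2 τ (-x) = norm2 τ x := by
  simp [norm2]

theorem norm2_sub_le (hτ : IsFaithfulTracialState (M : Set (H →L[ℂ] H)) τ)
    {x y : H →L[ℂ] H} (hx : x ∈ M) (hy : y ∈ M) (z : H →L[ℂ] H) (hz : z ∈ M) :
    norm2 τ (x - y) ≤ norm2 τ (x - z) + norm2 τ (z - y) := by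
  have := hτ.norm2_add_le (sub_mem hx hz) (sub_mem hz hy)
  rwa [sub_add_sub_cancel] at this

theorem norm2_star (hτ : IsFaithfulTracialState (M : Set (H →L[ℂ] H)) τ)
    {x : H →L[ℂ] H} (hx : x ∈ M) : norm2 τ (star x) = norm2 τ x := by
  rw [norm2, norm2, star_star, hτ.tracial _ hx _ (star_mem hx)]

theorem star_mul_self_le (a : H →L[ℂ] H) : star a * a ≤ ((‖a‖ ^ 2 : ℝ) : ℂ) • 1 := by
  have := CStarAlgebra.star_mul_le_algebraMap_norm_sq (a := a)
  rw [Algebra.algebraMap_eq_smul_one] at this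
  convert this using 1
  exact (RCLike.real_smul_eq_coe_smul (K := ℂ) _ _).symm

theorem norm2_mul_le (hτ : IsFaithfulTracialState (M : Set (H →L[ℂ] H)) τ)
    {a x : H →L[ℂ] H} (ha : a ∈ M) (hx : x ∈ M) : norm2 τ (a * x) ≤ ‖a‖ * norm2 τ x := by
  have h0x := norm2_nonneg τ x
  have hsx : star x ∈ M := star_mem hx
  refine abs_le_of_sq_le_sq' ?_ (by positivity) |>.2
  rw [mul_pow, hτ.norm2_sq (mul_mem ha hx), hτ.norm2_sq hx]
  have h1 := star_left_conjugate_le_conjugate (star_mul_self_le a) x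
  have h2 : star (a * x) * (a * x) = star x * (star a * a) * x := by
    simp [mul_assoc]
  have h3 : star x * (((‖a‖ ^ 2 : ℝ) : ℂ) • 1) * x = ((‖a‖ ^ 2 : ℝ) : ℂ) • (star x * x) := by
    simp
  rw [h3] at h1
  rw [h2]
  refine (hτ.re_mono (mul_mem (mul_mem hsx (mul_mem (star_mem ha) ha)) hx)
    (M.smul_mem' _ (mul_mem hsx hx)) h1).trans ?_
  rw [hτ.map_smul _ _ (mul_mem hsx hx), Complex.re_ofReal_mul]

theorem norm2_mul_le' (hτ : IsFaithfulTracialState (M : Set (H →L[ℂ] H)) τ)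
    {a x : H →L[ℂ] H} (ha : a ∈ M) (hx : x ∈ M) : norm2 τ (x * a) ≤ norm2 τ x * ‖a‖ := by
  have := hτ.norm2_mul_le (star_mem ha) (star_mem hx)
  rwa [← star_mul, hτ.norm2_star (mul_mem hx ha), hτ.norm2_star hx, norm_star, mul_comm] at this

theorem norm_tau_le (hτ : IsFaithfulTracialState (M : Set (H →L[ℂ] H)) τ)
    {x : H →L[ℂ] H} (hx : x ∈ M) : ‖τ x‖ ≤ norm2 τ x := by
  have := hτ.norm_tau_star_mul_le (one_mem M) hx
  simpa [norm2, hτ.map_one] using this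

end IsFaithfulTracialState

/-- A positive functional on `M`, real valued. -/
structure IsPositiveFunctional (M : VonNeumannAlgebra H) (φ : (H →L[ℂ] H) → ℝ) : Prop where
  map_add : ∀ x ∈ M, ∀ y ∈ M, φ (x + y) = φ x + φ y
  map_smul : ∀ (c : ℝ), ∀ x ∈ M, φ ((c : ℂ) • x) = c * φ x
  nonneg : ∀ x ∈ M, 0 ≤ x → 0 ≤ φ x

namespace IsPositiveFunctional

variable {M : VonNeumannAlgebra H} {φ ψ : (H →L[ℂ] H) → ℝ}

theorem map_zero (hφ : IsPositiveFunctional M φ) : φ 0 = 0 := by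
  have := hφ.map_smul 0 1 (one_mem M)
  simpa using this

theorem map_sub (hφ : IsPositiveFunctional M φ) {x y : H →L[ℂ] H} (hx : x ∈ M) (hy : y ∈ M) :
    φ (x - y) = φ x - φ y := by
  have := hφ.map_add (x - y) (sub_mem hx hy) y hy
  rw [sub_add_cancel] at this
  linarith

theorem mono (hφ : IsPositiveFunctional M φ) {x y : H →L[ℂ] H} (hx : x ∈ M) (hy : y ∈ M)
    (hxy : x ≤ y) : φ x ≤ φ y := by
  have := hφ.nonneg _ (sub_mem hy hx) (sub_nonneg.2 hxy)
  rw [hφ.map_sub hy hx] at this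
  linarith

/-- An inequality between positive functionals may be tested on projections. -/
theorem le_of_forall_projection (hφ : IsPositiveFunctional M φ) (hψ : IsPositiveFunctional M ψ)
    {e : H →L[ℂ] H}
    (h : ∀ p ∈ M, IsStarProjection p → p * e = p → φ p ≤ ψ p) {a : H →L[ℂ] H} (ha : a ∈ M)
    (h0 : 0 ≤ a) (hae : a * e = a) : φ a ≤ ψ a := by
  have key : ∀ n : ℕ, ∀ a ∈ M, 0 ≤ a → a ≤ 1 → a * e = a →
      φ a ≤ ψ a + (1 / 2) ^ n * φ 1 := by
    intro n
    induction n with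
    | zero =>
      intro a ha h0 h1 _
      have := hφ.mono ha (one_mem M) h1
      have := hψ.nonneg a ha h0
      linarith
    | succ n ih =>
      intro a ha h0 h1 hae
      obtain ⟨p, hpM, b, hbM, hp, hb0, hb1, hpe, hbe, hab⟩ := M.exists_halving ha h0 h1 hae
      have hhalf : (1 / 2 : ℂ) = ((1 / 2 : ℝ) : ℂ) := by push_cast; rfl
      have h3 := h p hpM hp hpe
      have h4 := ih b hbM hb0 hb1 hbe
      rw [hab, hhalf, hφ.map_smul _ _ (add_mem hpM hbM), hψ.map_smul _ _ (add_mem hpM hbM),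
        hφ.map_add _ hpM _ hbM, hψ.map_add _ hpM _ hbM, pow_succ']
      linarith
  obtain ⟨c, hc, hca⟩ := exists_smul_le_one a h0
  have h2 : φ ((c : ℂ) • a) ≤ ψ ((c : ℂ) • a) := by
    refine ge_of_tendsto' (x := Filter.atTop)
      (f := fun n : ℕ => ψ ((c : ℂ) • a) + (1 / 2 : ℝ) ^ n * φ 1) ?_ fun n =>
      key n _ (M.smul_mem' _ ha) (smul_nonneg (by simpa using hc.le) h0) hca
        (by rw [smul_mul_assoc, hae])
    have := ((tendsto_pow_atTop_nhds_zero_of_lt_one (r := (1 / 2 : ℝ)) (by norm_num)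
      (by norm_num)).mul_const (φ 1)).const_add (ψ ((c : ℂ) • a))
    simpa using this
  rw [hφ.map_smul _ _ ha, hψ.map_smul _ _ ha] at h2
  exact le_of_mul_le_mul_left h2 hc

/-- If `φ q < ψ q` and `ψ` is a vector functional then `φ ≤ ψ` on some nonzero corner. -/
theorem exists_projection_le (hφ : IsPositiveFunctional M φ) (hψ : IsPositiveFunctional M ψ)
    {l : List (H × H)} (hl : ∀ x ∈ M, ψ x = (vecSum l x).re) {q : H →L[ℂ] H} (hqM : q ∈ M)
    (hq : IsStarProjection q) (hlt : φ q < ψ q) :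
    ∃ e ∈ M, IsStarProjection e ∧ e ≠ 0 ∧ e * q = e ∧
      ∀ a ∈ M, 0 ≤ a → a * e = a → φ a ≤ ψ a := by
  obtain ⟨g, -, hg⟩ := zorn_le_nonempty₀
    {g : H →L[ℂ] H | g ∈ M ∧ IsStarProjection g ∧ g * q = g ∧ ψ g ≤ φ g} (by
    intro c hcs hc y hyc
    set s := sSup (φ '' c)
    have hbdd : BddAbove (φ '' c) := by
      refine ⟨φ 1, ?_⟩
      rintro _ ⟨g, hg, rfl⟩
      exact hφ.mono (hcs hg).1 (one_mem M) (hcs hg).2.1.le_one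
    have hle : ∀ g ∈ c, φ g ≤ s := fun g hg => le_csSup hbdd ⟨g, hg, rfl⟩
    have hfin : ∀ u : Finset c, ∃ g ∈ c, ∀ h ∈ u, (h : H →L[ℂ] H) ≤ g := by
      classical
      intro u
      induction u using Finset.induction_on with
      | empty => exact ⟨y, hyc, by simp⟩
      | insert a u _ ih =>
        obtain ⟨g, hg, hgu⟩ := ih
        obtain h | h := hc.total a.2 hg
        · refine ⟨g, hg, ?_⟩
          rintro b hb
          obtain rfl | hb := Finset.mem_insert.1 hb
          · exact h
          · exact hgu b hb
        · refine ⟨a, a.2, ?_⟩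
          rintro b hb
          obtain rfl | hb := Finset.mem_insert.1 hb
          · exact le_rfl
          · exact (hgu b hb).trans h
    obtain ⟨x, -, hx⟩ := exists_forall_mem_of_finite (ι := Option c)
      (fun i => i.elim (((M : Set (H →L[ℂ] H)) ∩ {x | IsSelfAdjoint x} ∩
        {x | 1 * x * q = 1 * x * 1}) ∩ ({x | vecSum l (1 * x * 1) ∈ {z | z.re ≤ s}} ∩
        {x | ∀ y : {y : H →L[ℂ] H // ∀ g ∈ c, y * g = 0}, y.1 * x * 1 = 0 * x * 0}))
        (fun g => {x | 1 * x * g = (g : H →L[ℂ] H)})) (by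
        rintro (_ | g)
        · exact (((M.isWOTClosed).inter isWOTClosed_isSelfAdjoint).inter
            (isWOTClosed_mul_eq _ _ _ _)).inter ((isWOTClosed_vecSum l 1 1
              (isClosed_le Complex.continuous_re continuous_const)).inter
              (isWOTClosed_setOf_forall fun y => isWOTClosed_mul_eq _ _ _ _))
        · exact isWOTClosed_mul_eq_const _ _ _) 1 (by
        intro u
        obtain ⟨g, hg, hgu⟩ := hfin (Finset.eraseNone u)
        obtain ⟨hgM, hgp, hgq, hgle⟩ := hcs hg
        refine ⟨g, hgp.norm_le, ?_⟩
        rintro (_ | h) hu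
        · refine ⟨⟨⟨hgM, hgp.isSelfAdjoint⟩, ?_⟩, ?_, ?_⟩
          · simpa using hgq
          · have := hgle.trans (hle g hg)
            rw [hl g hgM] at this
            simpa using this
          · rintro ⟨y, hy⟩
            simpa using hy g hg
        · have := hgu h (by simpa using hu)
          have := ((hcs h.2).2.1.le_iff_mul_eq_right hgp).1 this
          simpa using this)
    obtain ⟨⟨⟨hxM, hxs⟩, hxq⟩, hxl, hxy⟩ := hx none
    have hxc : ∀ g ∈ c, x * g = g := fun g hg => by simpa using hx (some ⟨g, hg⟩)
    have hxx : x * x = x := by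
      have := hxy ⟨1 - x, fun g hg => by rw [sub_mul, one_mul, hxc g hg, sub_self]⟩
      simp only [mul_one, mul_zero, sub_mul, one_mul, sub_eq_zero] at this
      exact this.symm
    have hxp : IsStarProjection x := ⟨hxx, hxs⟩
    have hub : ∀ g ∈ c, g ≤ x := fun g hg =>
      ((hcs hg).2.1.le_iff_mul_eq_right hxp).2 (hxc g hg)
    refine ⟨x, ⟨hxM, hxp, by simpa using hxq, ?_⟩, hub⟩
    have h1 : ψ x ≤ s := by
      rw [hl x hxM]; simpa using hxl
    refine h1.trans (csSup_le ⟨_, y, hyc, rfl⟩ ?_)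
    rintro _ ⟨g, hg, rfl⟩
    exact hφ.mono (hcs hg).1 hxM (hub g hg)) 0
    ⟨zero_mem M, IsStarProjection.zero _, zero_mul _, by rw [hφ.map_zero, hψ.map_zero]⟩
  obtain ⟨⟨hgM, hgp, hgq, hgle⟩, hmax⟩ := hg
  have hep : IsStarProjection (q - g) := hgp.sub_of_mul_eq_left hq hgq
  have hge : g * (q - g) = 0 := by rw [mul_sub, hgq, hgp.eq_sq, sub_self]
  refine ⟨q - g, sub_mem hqM hgM, hep, ?_, by rw [sub_mul, hq.eq_sq, hgq], ?_⟩
  · intro h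
    rw [sub_eq_zero] at h
    subst h
    exact absurd hgle (not_le.2 hlt)
  · intro a ha h0 hae
    refine hφ.le_of_forall_projection hψ (fun p hpM hp hpe => ?_) ha h0 hae
    by_contra! hcon
    have hep' : (q - g) * p = p := by
      have := congrArg star hpe
      rwa [star_mul, hep.star_eq', hp.star_eq'] at this
    have hgp0 : g * p = 0 := by rw [← hep', ← mul_assoc, hge, zero_mul]
    have hpq : p * q = p := by
      rw [← hpe, mul_assoc, sub_mul, hq.eq_sq, hgq]
    have h1 := hmax (y := g + p) ⟨add_mem hgM hpM, hgp.add hp hgp0, by rw [add_mul, hgq, hpq], by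
      rw [hφ.map_add _ hgM _ hpM, hψ.map_add _ hgM _ hpM]; linarith⟩
      (le_add_of_nonneg_right hp.nonneg)
    have h2 : p = 0 := le_antisymm (by simpa using h1) hp.nonneg
    rw [h2, hφ.map_zero, hψ.map_zero] at hcon
    exact lt_irrefl _ hcon

end IsPositiveFunctional

section Contractions

theorem norm_le_one_iff_star_mul_self_le {x : H →L[ℂ] H} : ‖x‖ ≤ 1 ↔ star x * x ≤ 1 := by
  rw [← CStarAlgebra.norm_le_one_iff_of_nonneg _ (star_mul_self_nonneg x),
    CStarRing.norm_star_mul_self]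
  constructor
  · intro h
    exact mul_le_one₀ h (norm_nonneg _) h
  · intro h
    by_contra! hc
    nlinarith

theorem norm_sub_half_le {v : H →L[ℂ] H} (hv : ‖v‖ ≤ 1) :
    ‖v - (1 / 2 : ℂ) • (v * (1 - star v * v))‖ ≤ 1 := by
  have h1 : v - (1 / 2 : ℂ) • (v * (1 - star v * v)) =
      (1 / 2 : ℂ) • v + (1 / 2 : ℂ) • (v * (star v * v)) := by
    rw [mul_sub, mul_one]; module
  rw [h1]
  refine (norm_add_le _ _).trans ?_
  rw [norm_smul, norm_smul]
  have h2 : ‖v * (star v * v)‖ ≤ 1 := by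
    refine (norm_mul_le _ _).trans (mul_le_one₀ hv (norm_nonneg _) ?_)
    rw [CStarRing.norm_star_mul_self]
    exact mul_le_one₀ hv (norm_nonneg _) hv
  have h4 : ‖(1 / 2 : ℂ)‖ = 1 / 2 := by simp
  rw [h4]; linarith

theorem norm_add_half_le {v : H →L[ℂ] H} (hv : ‖v‖ ≤ 1) :
    ‖v + (1 / 2 : ℂ) • (v * (1 - star v * v))‖ ≤ 1 := by
  rw [norm_le_one_iff_star_mul_self_le] at hv ⊢
  set h := star v * v with hh
  have hs : star h = h := by simp [hh]
  have h1 : v + (1 / 2 : ℂ) • (v * (1 - h)) = v * ((3 / 2 : ℂ) • 1 - (1 / 2 : ℂ) • h) := by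
    rw [mul_sub, mul_sub, mul_smul_comm, mul_smul_comm, mul_one]; module
  have hstar : star ((3 / 2 : ℂ) • (1 : H →L[ℂ] H) - (1 / 2 : ℂ) • h) =
      (3 / 2 : ℂ) • 1 - (1 / 2 : ℂ) • h := by
    rw [star_sub, star_smul, star_smul, star_one, hs]; simp
  have h2 : (1 : H →L[ℂ] H) - star (v * ((3 / 2 : ℂ) • 1 - (1 / 2 : ℂ) • h)) *
      (v * ((3 / 2 : ℂ) • 1 - (1 / 2 : ℂ) • h)) =
      (1 / 4 : ℂ) • (star (1 - h) * (1 - h) * (1 - h)) +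
        (3 / 4 : ℂ) • (star (1 - h) * (1 - h)) := by
    rw [star_mul, hstar, mul_assoc, ← mul_assoc (star v), ← hh, star_sub, star_one, hs]
    simp only [mul_sub, sub_mul, mul_smul_comm, smul_mul_assoc, mul_one, one_mul, mul_assoc]
    module
  rw [h1, ← sub_nonneg, h2]
  have c1 : (0 : ℂ) ≤ 1 / 4 := by
    simp
  have c2 : (0 : ℂ) ≤ 3 / 4 := by
    have : (0 : ℂ) ≤ ((3 / 4 : ℝ) : ℂ) := Complex.zero_le_real.2 (by norm_num)
    simpa using this
  exact add_nonneg (smul_nonneg c1 (star_left_conjugate_nonneg (sub_nonneg.2 hv) _))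
    (smul_nonneg c2 (star_mul_self_nonneg _))

theorem convex_of_smul_add {C : Set (H →L[ℂ] H)}
    (h : ∀ x ∈ C, ∀ y ∈ C, ∀ a b : ℝ, 0 ≤ a → 0 ≤ b → a + b = 1 →
      (a : ℂ) • x + (b : ℂ) • y ∈ C) : Convex ℝ C := by
  intro x hx y hy a b ha hb hab
  have := h x hx y hy a b ha hb hab
  rwa [Complex.coe_smul, Complex.coe_smul] at this

theorem VonNeumannAlgebra.exists_comparison (M : VonNeumannAlgebra H)
    (hM : IsFactor (M : Set (H →L[ℂ] H))) {e f : H →L[ℂ] H} (heM : e ∈ M) (hfM : f ∈ M)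
    (he : IsStarProjection e) (hf : IsStarProjection f) :
    ∃ w ∈ M, e * w = w ∧ w * f = w ∧ w * star w * w = w ∧ (w * star w = e ∨ star w * w = f) := by
  obtain ⟨v, ⟨⟨hvM, hvn⟩, hve⟩, hext⟩ := exists_isExtremeIn
    (C := (M : Set (H →L[ℂ] H)) ∩ {w | ‖w‖ ≤ 1} ∩ {w | e * w * f = 1 * w * 1})
    ((M.isWOTClosed.inter (isWOTClosed_closedBall 1)).inter (isWOTClosed_mul_eq _ _ _ _))
    (r := 1) (fun x hx => hx.1.2) ⟨0, ⟨zero_mem M, by simp⟩, by simp⟩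
  replace hve : e * v * f = v := by simpa using hve
  have hvsM : star v ∈ M := star_mem hvM
  have hev : e * v = v := by
    conv_lhs => rw [← hve, ← mul_assoc, ← mul_assoc, he.eq_sq]
    exact hve
  have hvf : v * f = v := by
    conv_lhs => rw [← hve, mul_assoc, hf.eq_sq]
    exact hve
  have hadd : ∀ y ∈ M, e * y * f = y → e * (v + y) * f = 1 * (v + y) * 1 := by
    intro y _ hy
    rw [mul_add, add_mul, hve, hy]; simp
  have hsub : ∀ y ∈ M, e * y * f = y → e * (v - y) * f = 1 * (v - y) * 1 := by
    intro y _ hy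
    rw [mul_sub, sub_mul, hve, hy]; simp
  have hpi : v * star v * v = v := by
    have hyM : (1 / 2 : ℂ) • (v * (1 - star v * v)) ∈ M :=
      M.smul_mem' _ (mul_mem hvM (sub_mem (one_mem M) (mul_mem hvsM hvM)))
    have hye : e * ((1 / 2 : ℂ) • (v * (1 - star v * v))) * f =
        (1 / 2 : ℂ) • (v * (1 - star v * v)) := by
      rw [mul_smul_comm, smul_mul_assoc]
      congr 1
      simp only [mul_sub, sub_mul, mul_one, ← mul_assoc, hev]
      rw [hvf, mul_assoc _ v f, hvf]
    have := hext ((1 / 2 : ℂ) • (v * (1 - star v * v)))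
      ⟨⟨add_mem hvM hyM, norm_add_half_le hvn⟩, hadd _ hyM hye⟩
      ⟨⟨sub_mem hvM hyM, norm_sub_half_le hvn⟩, hsub _ hyM hye⟩
    have h2 : v * (1 - star v * v) = 0 := by simpa using this
    rw [mul_sub, mul_one, sub_eq_zero, ← mul_assoc] at h2
    exact h2.symm
  have hpi' : star v * v * star v = star v := by
    have := congrArg star hpi
    simpa [mul_assoc] using this
  have hp1 : IsStarProjection (v * star v) :=
    ⟨by rw [IsIdempotentElem, ← mul_assoc, hpi], by simp [isSelfAdjoint_iff]⟩
  have hp2 : IsStarProjection (star v * v) :=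
    ⟨by rw [IsIdempotentElem, ← mul_assoc, hpi'], by simp [isSelfAdjoint_iff]⟩
  have hd1 : IsStarProjection (e - v * star v) :=
    hp1.sub_of_mul_eq_right he (by rw [← mul_assoc, hev])
  have hd2 : IsStarProjection (f - star v * v) :=
    hp2.sub_of_mul_eq_left hf (by rw [mul_assoc, hvf])
  have hd1M : e - v * star v ∈ M := sub_mem heM (mul_mem hvM hvsM)
  have hd2M : f - star v * v ∈ M := sub_mem hfM (mul_mem hvsM hvM)
  have hz : ∀ z ∈ M, ‖z‖ ≤ 1 → (e - v * star v) * z * (f - star v * v) = 0 := by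
    intro z hzM hzn
    set y := (e - v * star v) * z * (f - star v * v) with hy
    have hyM : y ∈ M := mul_mem (mul_mem hd1M hzM) hd2M
    have hyn : ‖y‖ ≤ 1 := by
      refine (norm_mul_le _ _).trans (mul_le_one₀ ((norm_mul_le _ _).trans
        (mul_le_one₀ hd1.norm_le (norm_nonneg _) hzn)) (norm_nonneg _) hd2.norm_le)
    have hed : e * (e - v * star v) = e - v * star v := by
      rw [mul_sub, he.eq_sq, ← mul_assoc, hev]
    have hdf : (f - star v * v) * f = f - star v * v := by
      rw [sub_mul, hf.eq_sq, mul_assoc, hvf]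
    have hye : e * y * f = y := by
      rw [hy, ← mul_assoc, ← mul_assoc, hed, mul_assoc _ _ f, hdf]
    have hvy : star v * y = 0 := by
      have : star v * (e - v * star v) = 0 := by
        have hsv : star v * e = star v := by
          have := congrArg star hev
          rwa [star_mul, he.star_eq'] at this
        rw [mul_sub, hsv, ← mul_assoc, hpi', sub_self]
      rw [hy, ← mul_assoc, ← mul_assoc, this, zero_mul, zero_mul]
    have hyv : star y * v = 0 := by
      have := congrArg star hvy
      simpa using this
    have hyd : y * (f - star v * v) = y := by
      rw [hy, mul_assoc, hd2.eq_sq]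
    have hyy : star y * y ≤ f - star v * v := by
      have h1 := star_left_conjugate_le_conjugate (norm_le_one_iff_star_mul_self_le.1 hyn)
        (f - star v * v)
      rw [mul_one, hd2.star_eq', hd2.eq_sq] at h1
      have h2 : (f - star v * v) * (star y * y) * (f - star v * v) = star y * y := by
        have h3 : (f - star v * v) * star y = star y := by
          have := congrArg star hyd
          rwa [star_mul, hd2.star_eq'] at this
        rw [← mul_assoc, h3, mul_assoc, hyd]
      rwa [h2] at h1
    have hsum : star v * v + star y * y ≤ 1 := by
      have := add_le_add_right hyy (star v * v)
      refine this.trans ?_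
      rw [add_sub_cancel]
      exact hf.le_one
    refine hext y ⟨⟨add_mem hvM hyM, ?_⟩, hadd y hyM hye⟩ ⟨⟨sub_mem hvM hyM, ?_⟩, hsub y hyM hye⟩
    · refine norm_le_one_iff_star_mul_self_le.2 ?_
      rw [star_add, add_mul, mul_add, mul_add, hvy, hyv, add_zero, zero_add]
      exact hsum
    · refine norm_le_one_iff_star_mul_self_le.2 ?_
      rw [star_sub, sub_mul, mul_sub, mul_sub, hvy, hyv, sub_zero, zero_sub, sub_neg_eq_add]
      exact hsum
  have hz' : ∀ z ∈ M, (e - v * star v) * z * (f - star v * v) = 0 := by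
    intro z hzM
    have hpos : (0 : ℝ) < ‖z‖ + 1 := by positivity
    have := hz ((((‖z‖ + 1)⁻¹ : ℝ) : ℂ) • z) (M.smul_mem' _ hzM) (by
      rw [norm_smul, Complex.norm_real, norm_inv, Real.norm_of_nonneg hpos.le,
        inv_mul_le_iff₀ hpos]
      linarith)
    rw [mul_smul_comm, smul_mul_assoc, smul_eq_zero] at this
    exact this.resolve_left (by exact_mod_cast (inv_pos.2 hpos).ne')
  refine ⟨v, hvM, hev, hvf, hpi, ?_⟩
  obtain h | h := M.eq_zero_or_eq_zero_of_factor hM hd2M hz'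
  · exact Or.inl (sub_eq_zero.1 h).symm
  · exact Or.inr (sub_eq_zero.1 h).symm

end Contractions

section Normality

theorem inner_self_apply_nonneg {x : H →L[ℂ] H} (hx : 0 ≤ x) (ξ : H) : 0 ≤ (⟪ξ, x ξ⟫_ℂ).re :=
  ((ContinuousLinearMap.nonneg_iff_isPositive x).1 hx).re_inner_nonneg_right ξ

theorem isPositiveFunctional_vector (M : VonNeumannAlgebra H) (ξ : H) {c : ℝ} (hc : 0 ≤ c) :
    IsPositiveFunctional M fun x => c * (⟪ξ, x ξ⟫_ℂ).re where
  map_add x _ y _ := by simp [mul_add]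
  map_smul r x _ := by simp; ring
  nonneg x _ hx := mul_nonneg hc (inner_self_apply_nonneg hx ξ)

theorem inner_star_mul_self (x : H →L[ℂ] H) (ξ : H) : (⟪ξ, (star x * x) ξ⟫_ℂ).re = ‖x ξ‖ ^ 2 := by
  rw [mul_apply_eq_comp, ContinuousLinearMap.star_eq_adjoint,
    ContinuousLinearMap.adjoint_inner_right, inner_self_eq_norm_sq_to_K]
  norm_cast

/-- A functional dominated by a vector seminorm is a vector functional. -/
theorem exists_inner_of_bound (M : VonNeumannAlgebra H) (f : (H →L[ℂ] H) → ℂ)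
    (hadd : ∀ x ∈ M, ∀ y ∈ M, f (x + y) = f x + f y)
    (hsmul : ∀ (c : ℂ), ∀ x ∈ M, f (c • x) = c * f x) (ξ : H)
    (hb : ∀ x ∈ M, ‖f x‖ ≤ ‖x ξ‖) : ∃ η : H, ∀ x ∈ M, f x = ⟪η, x ξ⟫_ℂ := by
  let K : Submodule ℂ H :=
    { carrier := {v | ∃ x ∈ M, v = x ξ}
      add_mem' := by
        rintro _ _ ⟨x, hx, rfl⟩ ⟨y, hy, rfl⟩
        exact ⟨x + y, add_mem hx hy, rfl⟩
      zero_mem' := ⟨0, zero_mem M, rfl⟩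
      smul_mem' := by
        rintro c _ ⟨x, hx, rfl⟩
        exact ⟨c • x, M.smul_mem' c hx, rfl⟩ }
  choose g hgM hg using fun v : K => v.2
  have hwd : ∀ x ∈ M, ∀ y ∈ M, x ξ = y ξ → f x = f y := by
    intro x hx y hy hxy
    have h1 := hb (x - y) (sub_mem hx hy)
    have h2 : f x = f (x - y) + f y := by
      rw [← hadd _ (sub_mem hx hy) _ hy, sub_add_cancel]
    rw [sub_apply, hxy, sub_self, norm_zero] at h1
    rw [h2, norm_le_zero_iff.1 h1, zero_add]
  let F : K →ₗ[ℂ] ℂ :=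
    { toFun := fun v => f (g v)
      map_add' := by
        intro v w
        rw [← hadd _ (hgM v) _ (hgM w)]
        refine hwd _ (hgM _) _ (add_mem (hgM v) (hgM w)) ?_
        rw [← hg, add_apply, ← hg, ← hg]; rfl
      map_smul' := by
        intro c v
        rw [RingHom.id_apply, smul_eq_mul, ← hsmul _ _ (hgM v)]
        refine hwd _ (hgM _) _ (M.smul_mem' c (hgM v)) ?_
        rw [← hg, smul_apply, ← hg]; rfl }
  have hF : ∀ v, ‖F v‖ ≤ 1 * ‖v‖ := by
    intro v
    have := hb _ (hgM v)
    rw [← hg] at this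
    rw [one_mul]
    exact this
  obtain ⟨G, hG, -⟩ := exists_extension_norm_eq K (F.mkContinuous 1 hF)
  refine ⟨(InnerProductSpace.toDual ℂ H).symm G, fun x hx => ?_⟩
  rw [InnerProductSpace.toDual_symm_apply]
  have h1 := hG ⟨x ξ, x, hx, rfl⟩
  rw [h1]
  exact hwd _ hx _ (hgM _) (hg ⟨x ξ, x, hx, rfl⟩)

namespace IsFaithfulTracialState

variable {M : VonNeumannAlgebra H} {τ : (H →L[ℂ] H) → ℂ}

theorem isPositiveFunctional (hτ : IsFaithfulTracialState (M : Set (H →L[ℂ] H)) τ) :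
    IsPositiveFunctional M fun x => (τ x).re where
  map_add x hx y hy := by
    have := hτ.map_add x hx y hy
    simp [this]
  map_smul c x hx := by
    have := hτ.map_smul c x hx
    simp only [this, Complex.re_ofReal_mul]
  nonneg x hx h0 := hτ.nonneg_of_nonneg hx h0

/-- The elements `a` such that `x ↦ τ(x a)` is a finite sum of vector functionals on `M`. -/
def IsNormalAt (M : VonNeumannAlgebra H) (τ : (H →L[ℂ] H) → ℂ) (a : H →L[ℂ] H) : Prop :=
  ∃ l : List (H × H), ∀ x ∈ M, τ (x * a) = vecSum l x

theorem isNormalAt_add (hτ : IsFaithfulTracialState (M : Set (H →L[ℂ] H)) τ) {a b : H →L[ℂ] H}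
    (haM : a ∈ M) (hbM : b ∈ M) (ha : IsNormalAt M τ a) (hb : IsNormalAt M τ b) :
    IsNormalAt M τ (a + b) := by
  obtain ⟨l, hl⟩ := ha
  obtain ⟨m, hm⟩ := hb
  refine ⟨l ++ m, fun x hx => ?_⟩
  rw [mul_add, hτ.map_add _ (mul_mem hx haM) _ (mul_mem hx hbM), hl x hx, hm x hx]
  simp [vecSum]

theorem isNormalAt_mul_left {a b : H →L[ℂ] H}
    (hbM : b ∈ M) (ha : IsNormalAt M τ a) : IsNormalAt M τ (b * a) := by
  obtain ⟨l, hl⟩ := ha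
  refine ⟨l.map fun p => (p.1, b p.2), fun x hx => ?_⟩
  rw [← mul_assoc, hl _ (mul_mem hx hbM)]
  simp [vecSum, Function.comp_def]

theorem isNormalAt_mul_right (hτ : IsFaithfulTracialState (M : Set (H →L[ℂ] H)) τ)
    {a b : H →L[ℂ] H} (haM : a ∈ M)
    (hbM : b ∈ M) (ha : IsNormalAt M τ a) : IsNormalAt M τ (a * b) := by
  obtain ⟨l, hl⟩ := ha
  refine ⟨l.map fun p => (star b p.1, p.2), fun x hx => ?_⟩
  rw [← mul_assoc, hτ.tracial _ (mul_mem hx haM) _ hbM, ← mul_assoc, hl _ (mul_mem hbM hx)]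
  simp [vecSum, Function.comp_def, ContinuousLinearMap.star_eq_adjoint,
    ContinuousLinearMap.adjoint_inner_left]

theorem exists_isNormalAt (hτ : IsFaithfulTracialState (M : Set (H →L[ℂ] H)) τ) :
    ∃ e ∈ M, IsStarProjection e ∧ e ≠ 0 ∧ IsNormalAt M τ e := by
  have hne : (1 : H →L[ℂ] H) ≠ 0 := by
    intro h
    have := hτ.map_one
    rw [h, hτ.map_zero] at this
    exact zero_ne_one this
  obtain ⟨ζ, hζ⟩ : ∃ ζ : H, ζ ≠ 0 := by
    by_contra! hc
    exact hne (ContinuousLinearMap.ext fun x => by simp [hc])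
  have hζn : 0 < ‖ζ‖ := norm_pos_iff.2 hζ
  set ξ : H := ((2 / ‖ζ‖ : ℝ) : ℂ) • ζ with hξ
  have hξn : ‖ξ‖ = 2 := by
    rw [hξ, norm_smul, Complex.norm_real, Real.norm_of_nonneg (by positivity)]
    field_simp
  have hψ := isPositiveFunctional_vector M ξ (c := 1) zero_le_one
  obtain ⟨e, heM, he, he0, -, hle⟩ := hτ.isPositiveFunctional.exists_projection_le hψ
    (l := [(ξ, ξ)]) (fun x _ => by simp [vecSum]) (one_mem M) (IsStarProjection.one _) (by
      have h1 := inner_star_mul_self (1 : H →L[ℂ] H) ξ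
      simp only [star_one, mul_one, one_apply_eq_self] at h1
      simp only [hτ.map_one, one_apply_eq_self, h1, hξn]
      norm_num)
  refine ⟨e, heM, he, he0, ?_⟩
  obtain ⟨η, hη⟩ := exists_inner_of_bound M (fun x => τ (x * e))
    (fun x hx y hy => by
      simp only [add_mul]; exact hτ.map_add _ (mul_mem hx heM) _ (mul_mem hy heM))
    (fun c x hx => by simp only [smul_mul_assoc]; exact hτ.map_smul _ _ (mul_mem hx heM)) (e ξ)
    (fun x hx => by
      have hxe := mul_mem hx heM
      refine (hτ.norm_tau_le hxe).trans ?_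
      refine abs_le_of_sq_le_sq' ?_ (norm_nonneg _) |>.2
      rw [hτ.norm2_sq hxe]
      have := hle (star (x * e) * (x * e)) (mul_mem (star_mem hxe) hxe)
        (star_mul_self_nonneg _) (by rw [mul_assoc, mul_assoc, he.eq_sq])
      simp only [inner_star_mul_self, one_mul] at this
      exact this)
  exact ⟨[(η, e ξ)], fun x hx => by simp [vecSum, hη x hx]⟩

theorem tau_pos (hτ : IsFaithfulTracialState (M : Set (H →L[ℂ] H)) τ) {e : H →L[ℂ] H}
    (heM : e ∈ M) (he : IsStarProjection e) (he0 : e ≠ 0) : 0 < (τ e).re := by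
  have h1 : star e * e = e := by rw [he.star_eq', he.eq_sq]
  refine lt_of_le_of_ne (hτ.nonneg_of_nonneg heM he.nonneg) fun h => he0 (hτ.faithful e heM ?_)
  refine Complex.ext ?_ (hτ.im_eq_zero heM)
  rw [h1, ← h]; rfl

/-- The trace of a factor is a finite sum of vector functionals. -/
theorem exists_vecSum (hτ : IsFaithfulTracialState (M : Set (H →L[ℂ] H)) τ)
    (hM : IsFactor (M : Set (H →L[ℂ] H))) :
    ∃ l : List (H × H), ∀ x ∈ M, τ x = vecSum l x := by
  obtain ⟨e, heM, he, he0, hne⟩ := hτ.exists_isNormalAt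
  have hpos := hτ.tau_pos heM he he0
  have key : ∀ n : ℕ, ∀ f ∈ M, IsStarProjection f → (τ f).re ≤ n * (τ e).re →
      IsNormalAt M τ f := by
    intro n
    induction n with
    | zero =>
      intro f hfM hf hle
      have : f = 0 := by
        by_contra h0
        have := hτ.tau_pos hfM hf h0
        simp at hle
        linarith
      subst this
      exact ⟨[], fun x _ => by simp [vecSum, hτ.map_zero]⟩
    | succ n ih =>
      intro f hfM hf hle
      obtain ⟨w, hwM, hew, hwf, hw, h | h⟩ := M.exists_comparison hM heM hfM he hf
      · have hwsM : star w ∈ M := star_mem hwM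
        have hwwM := mul_mem hwsM hwM
        have hw' : star w * w * star w = star w := by
          have := congrArg star hw
          simpa [mul_assoc] using this
        have hp : IsStarProjection (star w * w) :=
          ⟨by rw [IsIdempotentElem, ← mul_assoc, hw'], by simp [isSelfAdjoint_iff]⟩
        have hd : IsStarProjection (f - star w * w) :=
          hp.sub_of_mul_eq_left hf (by rw [mul_assoc, hwf])
        have h1 : IsNormalAt M τ (star w * w) := by
          have := isNormalAt_mul_left hwsM (hτ.isNormalAt_mul_right heM hwM hne)
          rwa [hew] at this
        have h2 : IsNormalAt M τ (f - star w * w) := by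
          refine ih _ (sub_mem hfM hwwM) hd ?_
          rw [hτ.map_sub hfM hwwM, hτ.tracial _ hwsM _ hwM, h, Complex.sub_re]
          push_cast at hle
          linarith
        have := hτ.isNormalAt_add hwwM (sub_mem hfM hwwM) h1 h2
        rwa [add_sub_cancel] at this
      · have hwsM : star w ∈ M := star_mem hwM
        have := isNormalAt_mul_left hwsM (hτ.isNormalAt_mul_right heM hwM hne)
        rwa [hew, h] at this
  obtain ⟨n, hn⟩ := Archimedean.arch (1 : ℝ) hpos
  obtain ⟨l, hl⟩ := key n 1 (one_mem M) (IsStarProjection.one _) (by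
    rw [hτ.map_one]; simpa using hn)
  exact ⟨l, fun x hx => by simpa using hl x hx⟩

/-- A vector `ξ` is bounded when `x ↦ x ξ` is continuous for the `2`-norm. -/
def IsBoundedVector (M : VonNeumannAlgebra H) (τ : (H →L[ℂ] H) → ℂ) (ξ : H) : Prop :=
  ∃ C : ℝ, 0 ≤ C ∧ ∀ x ∈ M, ‖x ξ‖ ≤ C * norm2 τ x

theorem exists_isBoundedVector (hτ : IsFaithfulTracialState (M : Set (H →L[ℂ] H)) τ)
    (hM : IsFactor (M : Set (H →L[ℂ] H))) : ∃ ξ, ξ ≠ 0 ∧ IsBoundedVector M τ ξ := by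
  obtain ⟨l, hl⟩ := hτ.exists_vecSum hM
  have hne : (1 : H →L[ℂ] H) ≠ 0 := by
    intro h
    have := hτ.map_one
    rw [h, hτ.map_zero] at this
    exact zero_ne_one this
  obtain ⟨ζ, hζ⟩ : ∃ ζ : H, ζ ≠ 0 := by
    by_contra! hc
    exact hne (ContinuousLinearMap.ext fun x => by simp [hc])
  obtain ⟨q, hqM, hq, hq1, hq2⟩ := M.exists_projection_span {v | ∃ T ∈ M.commutant, v = T ζ} (by
    rintro T hT _ ⟨S, hS, rfl⟩
    exact ⟨T * S, mul_mem hT hS, rfl⟩)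
  have hqζ : q ζ = ζ := hq1 ζ ⟨1, one_mem _, rfl⟩
  have hq0 : q ≠ 0 := by
    rintro rfl
    exact hζ (by simpa using hqζ.symm)
  have hτq := hτ.tau_pos hqM hq hq0
  have hζn : 0 < ‖ζ‖ := norm_pos_iff.2 hζ
  set c : ℝ := (τ q).re / (2 * ‖ζ‖ ^ 2) with hc
  have hcpos : 0 < c := by positivity
  obtain ⟨e, heM, he, he0, heq, hle⟩ :=
    (isPositiveFunctional_vector M ζ hcpos.le).exists_projection_le hτ.isPositiveFunctional
      (l := l) (fun x hx => by rw [hl x hx]) hqM hq (by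
        have h1 := inner_star_mul_self (1 : H →L[ℂ] H) ζ
        simp only [star_one, mul_one, one_apply_eq_self] at h1
        simp only [hqζ, h1, hc]
        field_simp
        linarith)
  refine ⟨e ζ, fun h0 => he0 ?_, Real.sqrt c⁻¹, Real.sqrt_nonneg _, fun x hx => ?_⟩
  · rw [← heq]
    refine hq2 e ?_
    rintro _ ⟨T, hT, rfl⟩
    have := DFunLike.congr_fun (VonNeumannAlgebra.mem_commutant_iff.1 hT e heM) ζ
    simp only [mul_apply_eq_comp] at this
    rw [this, h0, ContinuousLinearMap.map_zero]
  · have hxe := mul_mem hx heM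
    have h1 := hle (star (x * e) * (x * e)) (mul_mem (star_mem hxe) hxe)
      (star_mul_self_nonneg _) (by rw [mul_assoc, mul_assoc, he.eq_sq])
    simp only [inner_star_mul_self] at h1
    rw [← hτ.norm2_sq hxe] at h1
    have h2 : norm2 τ (x * e) ≤ norm2 τ x := by
      refine (hτ.norm2_mul_le' heM hx).trans ?_
      exact mul_le_of_le_one_right (norm2_nonneg _ _) he.norm_le
    have h3 := norm2_nonneg τ (x * e)
    have h4 := norm2_nonneg τ x
    refine abs_le_of_sq_le_sq' ?_ (by positivity) |>.2
    rw [mul_pow, Real.sq_sqrt (by positivity)]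
    change c * ‖x (e ζ)‖ ^ 2 ≤ _ at h1
    rw [← div_eq_inv_mul, le_div_iff₀ hcpos]
    nlinarith

theorem eq_zero_of_isBoundedVector (hτ : IsFaithfulTracialState (M : Set (H →L[ℂ] H)) τ)
    (hM : IsFactor (M : Set (H →L[ℂ] H))) {g : H →L[ℂ] H}
    (hg : ∀ ξ, IsBoundedVector M τ ξ → g ξ = 0) : g = 0 := by
  obtain ⟨ζ, hζ0, hζ⟩ := hτ.exists_isBoundedVector hM
  set V : Set H := {ξ | IsBoundedVector M τ ξ}
  obtain ⟨e, heM, he, h1, h2⟩ := M.exists_projection_span V (by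
    rintro T hT v ⟨C, hC, h⟩
    refine ⟨‖T‖ * C, by positivity, fun x hx => ?_⟩
    have := DFunLike.congr_fun (VonNeumannAlgebra.mem_commutant_iff.1 hT x hx) v
    simp only [mul_apply_eq_comp] at this
    rw [this, mul_assoc]
    exact (T.le_opNorm _).trans (mul_le_mul_of_nonneg_left (h x hx) (norm_nonneg _)))
  obtain ⟨e', he'M, he', h1', h2'⟩ := M.commutant.exists_projection_span V (by
    rw [VonNeumannAlgebra.commutant_commutant]
    rintro T hT v ⟨C, hC, h⟩
    refine ⟨C * ‖T‖, by positivity, fun x hx => ?_⟩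
    refine (h (x * T) (mul_mem hx hT)).trans ?_
    rw [mul_assoc, mul_comm ‖T‖]
    exact mul_le_mul_of_nonneg_left (hτ.norm2_mul_le' hT hx) hC)
  have hee : e' * e = e := by
    have := h2 (1 - e') (fun v hv => by simp [h1' v hv])
    rw [sub_mul, one_mul, sub_eq_zero] at this
    exact this.symm
  have hee' : e * e' = e' := by
    have := h2' (1 - e) (fun v hv => by simp [h1 v hv])
    rw [sub_mul, one_mul, sub_eq_zero] at this
    exact this.symm
  have heq : e = e' := by
    have := congrArg star hee
    simp only [star_mul, he.isSelfAdjoint.star_eq, he'.isSelfAdjoint.star_eq] at this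
    rw [← this, hee']
  obtain ⟨c, hc⟩ := hM e heM (fun z hz => by
    have := VonNeumannAlgebra.mem_commutant_iff.1 he'M z hz
    rw [heq]; exact this.symm)
  have hge : g * e = 0 := h2 g hg
  have heζ := h1 ζ hζ
  have hc0 : c ≠ 0 := by
    rintro rfl
    rw [hc] at heζ
    exact hζ0 (by simpa using heζ.symm)
  rw [hc] at hge
  simpa [hc0] using hge

theorem eq_zero_of_forall_inner (hτ : IsFaithfulTracialState (M : Set (H →L[ℂ] H)) τ)
    (hM : IsFactor (M : Set (H →L[ℂ] H))) {v : H}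
    (hv : ∀ η, IsBoundedVector M τ η → ⟪v, η⟫_ℂ = 0) : v = 0 := by
  have h := hτ.eq_zero_of_isBoundedVector hM (g := (innerSL ℂ v).smulRight v) (fun η hη => by
    simp [hv η hη])
  have h2 := DFunLike.congr_fun h v
  simpa using h2

theorem _root_.eq_zero_of_forall_le_mul {a K : ℝ} (h : ∀ ε > 0, a ≤ K * ε) : a ≤ 0 := by
  by_contra! hc
  have h1 := h (a / (2 * (|K| + 1))) (by positivity)
  have h2 : K * (a / (2 * (|K| + 1))) ≤ (|K| + 1) * (a / (2 * (|K| + 1))) := by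
    gcongr
    linarith [le_abs_self K]
  have h3 : (|K| + 1) * (a / (2 * (|K| + 1))) = a / 2 := by
    have : |K| + 1 ≠ 0 := by positivity
    field_simp
  linarith

/-- Von Neumann subalgebras are closed in the `2`-norm. -/
theorem mem_of_norm2_approx (hτ : IsFaithfulTracialState (M : Set (H →L[ℂ] H)) τ)
    (hM : IsFactor (M : Set (H →L[ℂ] H))) (P : VonNeumannAlgebra H) (hP : ∀ y ∈ P, y ∈ M)
    {u : H →L[ℂ] H} (hu : u ∈ M) (h : ∀ ε > 0, ∃ y ∈ P, norm2 τ (u - y) < ε) : u ∈ P := by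
  refine P.mem_of_forall_commute fun T hT => ?_
  rw [← sub_eq_zero]
  refine hτ.eq_zero_of_isBoundedVector hM fun ξ hξ => ?_
  refine hτ.eq_zero_of_forall_inner hM fun η hη => ?_
  obtain ⟨C, hC, hξ⟩ := hξ
  obtain ⟨D, hD, hη⟩ := hη
  rw [← norm_le_zero_iff]
  refine eq_zero_of_forall_le_mul (K := ‖T‖ * C * ‖η‖ + ‖T‖ * ‖ξ‖ * D) fun ε hε => ?_
  obtain ⟨y, hyP, hy⟩ := h ε hε
  have hyM := hP y hyP
  have hTy := VonNeumannAlgebra.mem_commutant_iff.1 hT y hyP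
  have huy : u - y ∈ M := sub_mem hu hyM
  have e1 : T * u - u * T = T * (u - y) - (u - y) * T := by
    rw [mul_sub, sub_mul, hTy]; abel
  rw [e1, sub_apply, inner_sub_left]
  refine (norm_sub_le _ _).trans ?_
  rw [add_mul]
  refine add_le_add ?_ ?_
  · refine (norm_inner_le_norm _ _).trans ?_
    have h1 : ‖(T * (u - y)) ξ‖ ≤ ‖T‖ * (C * ε) :=
      (T.le_opNorm _).trans (mul_le_mul_of_nonneg_left ((hξ _ huy).trans (by gcongr))
        (norm_nonneg _))
    calc _ ≤ ‖T‖ * (C * ε) * ‖η‖ := by gcongr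
      _ = _ := by ring
  · have h0 : ⟪((u - y) * T) ξ, η⟫_ℂ = ⟪T ξ, star (u - y) η⟫_ℂ := by
      rw [ContinuousLinearMap.star_eq_adjoint, ContinuousLinearMap.adjoint_inner_right]; rfl
    rw [h0]
    refine (norm_inner_le_norm _ _).trans ?_
    have h1 : ‖star (u - y) η‖ ≤ D * ε := by
      refine (hη _ (star_mem huy)).trans ?_
      rw [hτ.norm2_star huy]
      gcongr
    calc _ ≤ ‖T‖ * ‖ξ‖ * (D * ε) := by
          gcongr
          exact T.le_opNorm _
      _ = _ := by ring

end IsFaithfulTracialState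

end Normality

section Density

/-- The diagonal amplification of an operator to a finite direct sum. -/
def amplify {ι : Type*} [Fintype ι] (y : H →L[ℂ] H) :
    PiLp 2 (fun _ : ι => H) →L[ℂ] PiLp 2 (fun _ : ι => H) :=
  ((PiLp.continuousLinearEquiv 2 ℂ (fun _ : ι => H)).symm : (ι → H) →L[ℂ] _) ∘L
    (ContinuousLinearMap.pi fun i => y ∘L ContinuousLinearMap.proj i) ∘L
    ((PiLp.continuousLinearEquiv 2 ℂ (fun _ : ι => H)) : _ →L[ℂ] (ι → H))

@[simp]
theorem amplify_apply {ι : Type*} [Fintype ι] (y : H →L[ℂ] H) (v : PiLp 2 (fun _ : ι => H))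
    (i : ι) : amplify y v i = y (v i) := rfl

theorem amplify_inner {ι : Type*} [Fintype ι] (y : H →L[ℂ] H) (v w : PiLp 2 (fun _ : ι => H)) :
    ⟪amplify y v, w⟫_ℂ = ⟪v, amplify (star y) w⟫_ℂ := by
  simp only [PiLp.inner_apply, amplify_apply, ContinuousLinearMap.star_eq_adjoint,
    ContinuousLinearMap.adjoint_inner_right]

/-- The strong form of the double commutant theorem. -/
theorem exists_mem_forall_norm_lt (S : StarSubalgebra ℂ (H →L[ℂ] H)) {x : H →L[ℂ] H}
    (hx : x ∈ Set.centralizer (Set.centralizer (S : Set (H →L[ℂ] H)))) {ι : Type*} [Fintype ι]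
    (ξ : ι → H) {ε : ℝ} (hε : 0 < ε) : ∃ y ∈ S, ∀ i, ‖(x - y) (ξ i)‖ < ε := by
  classical
  set Ξ : PiLp 2 (fun _ : ι => H) := WithLp.toLp 2 ξ
  let W : Submodule ℂ (PiLp 2 (fun _ : ι => H)) :=
    { carrier := {v | ∃ y ∈ S, v = amplify y Ξ}
      add_mem' := by
        rintro _ _ ⟨y, hy, rfl⟩ ⟨z, hz, rfl⟩
        exact ⟨y + z, add_mem hy hz, by ext i; simp⟩
      zero_mem' := ⟨0, zero_mem S, by ext i; simp⟩
      smul_mem' := by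
        rintro c _ ⟨y, hy, rfl⟩
        exact ⟨c • y, S.smul_mem hy c, by ext i; simp⟩ }
  set V := W.topologicalClosure with hV
  have : CompleteSpace V := (Submodule.isClosed_topologicalClosure W).completeSpace_coe
  have hinv : ∀ y ∈ S, ∀ v ∈ V, amplify y v ∈ V := by
    intro y hy v hv
    have : amplify y v ∈ closure (W : Set (PiLp 2 (fun _ : ι => H))) :=
      map_mem_closure (amplify y).continuous hv (by
        rintro _ ⟨z, hz, rfl⟩
        exact ⟨y * z, mul_mem hy hz, by ext i; simp⟩)
    exact this
  have hcomm : ∀ y ∈ S, ∀ v, V.starProjection (amplify y v) = amplify y (V.starProjection v) := by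
    intro y hy v
    refine Submodule.eq_starProjection_of_mem_of_inner_eq_zero
      (hinv y hy _ (V.starProjection_apply_mem v)) fun w hw => ?_
    rw [← map_sub, amplify_inner]
    exact Submodule.starProjection_inner_eq_zero v _ (hinv _ (star_mem hy) w hw)
  let inj (j : ι) : H →L[ℂ] PiLp 2 (fun _ : ι => H) :=
    ((PiLp.continuousLinearEquiv 2 ℂ (fun _ : ι => H)).symm : (ι → H) →L[ℂ] _) ∘L
      ContinuousLinearMap.single ℂ (fun _ => H) j
  let pr (i : ι) : PiLp 2 (fun _ : ι => H) →L[ℂ] H := (ContinuousLinearMap.proj i) ∘L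
    ((PiLp.continuousLinearEquiv 2 ℂ (fun _ : ι => H)) : _ →L[ℂ] (ι → H))
  have hinj : ∀ (y : H →L[ℂ] H) j v, amplify y (inj j v) = inj j (y v) := by
    intro y j v
    ext i
    change y (Pi.single (M := fun _ : ι => H) j v i) = Pi.single (M := fun _ : ι => H) j (y v) i
    by_cases h : i = j
    · subst h; simp
    · simp [h]
  have hentry : ∀ i j, (pr i ∘L V.starProjection ∘L inj j) ∈
      Set.centralizer (S : Set (H →L[ℂ] H)) := by
    intro i j y hy
    ext v
    change y (pr i (V.starProjection (inj j v))) = pr i (V.starProjection (inj j (y v)))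
    rw [← hinj, hcomm y hy]
    rfl
  have hsum : ∀ v : PiLp 2 (fun _ : ι => H), v = ∑ j, inj j (v j) := by
    intro v
    ext i
    rw [WithLp.ofLp_sum, Finset.sum_apply]
    change v i = ∑ j, Pi.single (M := fun _ : ι => H) j (v j) i
    rw [Finset.sum_pi_single]
    simp
  have hxcomm : ∀ v, V.starProjection (amplify x v) = amplify x (V.starProjection v) := by
    intro v
    have h1 : ∀ j u, V.starProjection (amplify x (inj j u)) =
        amplify x (V.starProjection (inj j u)) := by
      intro j u
      rw [hinj]
      ext i
      exact DFunLike.congr_fun (hx _ (hentry i j)) u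
    rw [hsum v]
    simp only [map_sum, h1]
  have hΞ : Ξ ∈ V := Submodule.le_topologicalClosure _ ⟨1, one_mem S, by ext i; simp⟩
  have hmem : amplify x Ξ ∈ closure (W : Set (PiLp 2 (fun _ : ι => H))) := by
    have := V.starProjection_apply_mem (amplify x Ξ)
    rw [hxcomm, Submodule.starProjection_eq_self_iff.2 hΞ] at this
    exact this
  obtain ⟨_, ⟨y, hy, rfl⟩, hd⟩ := Metric.mem_closure_iff.1 hmem ε hε
  refine ⟨y, hy, fun i => ?_⟩
  rw [dist_eq_norm] at hd
  exact (PiLp.norm_apply_le (amplify x Ξ - amplify y Ξ) i).trans_lt hd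

theorem IsFaithfulTracialState.exists_norm2_sub_lt {M : VonNeumannAlgebra H}
    {τ : (H →L[ℂ] H) → ℂ} (hτ : IsFaithfulTracialState (M : Set (H →L[ℂ] H)) τ)
    (hM : IsFactor (M : Set (H →L[ℂ] H))) (S : StarSubalgebra ℂ (H →L[ℂ] H))
    (hS : ∀ y ∈ S, y ∈ M) {x : H →L[ℂ] H} (hxM : x ∈ M)
    (hx : x ∈ Set.centralizer (Set.centralizer (S : Set (H →L[ℂ] H)))) {ε : ℝ} (hε : 0 < ε) :
    ∃ y ∈ S, norm2 τ (x - y) < ε := by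
  obtain ⟨l, hl⟩ := hτ.exists_vecSum hM
  set δ : ℝ := ε / Real.sqrt (l.length + 1) with hδ
  have hδpos : 0 < δ := by positivity
  obtain ⟨y, hyS, hy⟩ := exists_mem_forall_norm_lt S hx
    (ι := Fin l.length ⊕ Fin l.length) (Sum.elim (fun i => (l.get i).1) fun i => (l.get i).2) hδpos
  refine ⟨y, hyS, ?_⟩
  have hd : x - y ∈ M := sub_mem hxM (hS y hyS)
  have h1 : ∀ p ∈ l, ‖⟪p.1, (star (x - y) * (x - y)) p.2⟫_ℂ‖ ≤ δ ^ 2 := by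
    intro p hp
    obtain ⟨i, rfl⟩ := List.mem_iff_get.1 hp
    have a1 := hy (Sum.inl i)
    have a2 := hy (Sum.inr i)
    simp only [Sum.elim_inl, Sum.elim_inr] at a1 a2
    rw [mul_apply_eq_comp, ContinuousLinearMap.star_eq_adjoint,
      ContinuousLinearMap.adjoint_inner_right]
    refine (norm_inner_le_norm _ _).trans ?_
    rw [sq]
    exact mul_le_mul a1.le a2.le (norm_nonneg _) hδpos.le
  have h2 : ∀ m : List (H × H), (∀ p ∈ m, ‖⟪p.1, (star (x - y) * (x - y)) p.2⟫_ℂ‖ ≤ δ ^ 2) →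
      ‖vecSum m (star (x - y) * (x - y))‖ ≤ m.length * δ ^ 2 := by
    intro m
    induction m with
    | nil => intro _; simp [vecSum]
    | cons p m ih =>
      intro hm
      have b1 := ih fun q hq => hm q (List.mem_cons_of_mem _ hq)
      have b2 := hm p List.mem_cons_self
      simp only [vecSum, List.map_cons, List.sum_cons, List.length_cons, Nat.cast_add,
        Nat.cast_one] at b1 ⊢
      refine (norm_add_le _ _).trans ?_
      linarith
  have h3 := (Complex.re_le_norm _).trans (h2 l h1)
  rw [← hl _ (mul_mem (star_mem hd) hd), ← hτ.norm2_sq hd] at h3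
  have h4 : (l.length : ℝ) * δ ^ 2 < ε ^ 2 := by
    rw [hδ, div_pow, Real.sq_sqrt (by positivity), mul_div_assoc', div_lt_iff₀ (by positivity)]
    nlinarith [sq_pos_of_pos hε]
  exact lt_of_pow_lt_pow_left₀ 2 hε.le (h3.trans_lt h4)

end Density

section Intertwiners

/-- A finite partition of unity into projections of `A`. -/
structure IsPartition (A : VonNeumannAlgebra H) {ι : Type} [Fintype ι] (c : ι → H →L[ℂ] H) :
    Prop where
  mem : ∀ i, c i ∈ A
  proj : ∀ i, IsStarProjection (c i)
  orth : ∀ i j, i ≠ j → c i * c j = 0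
  sum_eq : ∑ i, c i = 1

theorem exists_isPartition_refining {A : VonNeumannAlgebra H}
    (hA : ∀ a ∈ A, ∀ b ∈ A, a * b = b * a) (F : Finset (H →L[ℂ] H))
    (hF : ∀ p ∈ F, p ∈ A ∧ IsStarProjection p) :
    ∃ (ι : Type) (_ : Fintype ι) (c : ι → H →L[ℂ] H), IsPartition A c ∧
      ∀ p ∈ F, ∀ i, p * c i = c i ∨ p * c i = 0 := by
  classical
  induction F using Finset.induction_on with
  | empty =>
    refine ⟨Unit, inferInstance, fun _ => 1, ⟨fun _ => one_mem A, fun _ => .one _, ?_, by simp⟩,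
      by simp⟩
    intro i j h
    exact absurd rfl h
  | insert p F _ ih =>
    obtain ⟨ι, _, c, hc, href⟩ := ih fun s hs => hF s (Finset.mem_insert_of_mem hs)
    obtain ⟨hpA, hp⟩ := hF p (Finset.mem_insert_self _ _)
    have hpc : ∀ i, p * c i = c i * p := fun i => hA _ hpA _ (hc.mem i)
    have hpp : p * p = p := hp.eq_sq
    have hcc : ∀ i, c i * c i = c i := fun i => (hc.proj i).eq_sq
    refine ⟨ι ⊕ ι, inferInstance, Sum.elim (fun i => p * c i) (fun i => (1 - p) * c i),
      ⟨?_, ?_, ?_, ?_⟩, ?_⟩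
    · rintro (i | i)
      · exact mul_mem hpA (hc.mem i)
      · exact mul_mem (sub_mem (one_mem A) hpA) (hc.mem i)
    · rintro (i | i)
      · exact hp.mul (hc.proj i) (hpc i)
      · exact hp.one_sub.mul (hc.proj i) ((Commute.one_left _).sub_left (hpc i))
    · have key : ∀ (a b : H →L[ℂ] H) i j, b ∈ A → (i ≠ j ∨ a * b = 0) →
          (a * c i) * (b * c j) = 0 := by
        intro a b i j hb h
        have e : (a * c i) * (b * c j) = a * b * (c i * c j) := by
          rw [mul_assoc, ← mul_assoc (c i), ← hA b hb _ (hc.mem i)]; simp only [mul_assoc]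
        rw [e]
        rcases h with h | h
        · rw [hc.orth i j h, mul_zero]
        · rw [h, zero_mul]
      have h1p : (1 - p) ∈ A := sub_mem (one_mem A) hpA
      rintro (i | i) (j | j) hij <;> simp only [Sum.elim_inl, Sum.elim_inr]
      · exact key _ _ _ _ hpA (Or.inl fun h => hij (by rw [h]))
      · exact key _ _ _ _ h1p (Or.inr (by rw [mul_sub, hpp, mul_one, sub_self]))
      · exact key _ _ _ _ hpA (Or.inr (by rw [sub_mul, hpp, one_mul, sub_self]))
      · exact key _ _ _ _ h1p (Or.inl fun h => hij (by rw [h]))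
    · rw [Fintype.sum_sum_type]
      simp only [Sum.elim_inl, Sum.elim_inr]
      rw [← Finset.mul_sum, ← Finset.mul_sum, hc.sum_eq]
      simp
    · intro s hs
      have hsA := (hF s hs).1
      rw [Finset.mem_insert] at hs
      rintro (i | i) <;> simp only [Sum.elim_inl, Sum.elim_inr]
      · rcases hs with rfl | hs
        · left; rw [← mul_assoc, hpp]
        · rw [← mul_assoc, hA s hsA p hpA, mul_assoc]
          rcases href s hs i with h | h
          · left; rw [h]
          · right; rw [h, mul_zero]
      · rcases hs with rfl | hs
        · right; rw [← mul_assoc, mul_sub, hpp, mul_one, sub_self, zero_mul]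
        · rw [← mul_assoc, hA s hsA _ (sub_mem (one_mem A) hpA), mul_assoc]
          rcases href s hs i with h | h
          · left; rw [h]
          · right; rw [h, mul_zero]

/-- Orthogonal families of projections satisfy Bessel's inequality. -/
theorem sum_norm_sq_le_of_orthogonal {ι : Type*} [Fintype ι] {f : ι → H →L[ℂ] H}
    (hf : ∀ i, IsStarProjection (f i)) (ho : ∀ i j, i ≠ j → f i * f j = 0) (v : H) :
    ∑ i, ‖f i v‖ ^ 2 ≤ ‖v‖ ^ 2 := by
  classical
  have hS : IsStarProjection (∑ i, f i) := by
    refine ⟨?_, ?_⟩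
    · change (∑ i, f i) * (∑ i, f i) = ∑ i, f i
      rw [Finset.sum_mul_sum]
      refine Finset.sum_congr rfl fun i _ => ?_
      rw [Finset.sum_eq_single i (fun j _ hj => ho i j hj.symm) (by simp), (hf i).eq_sq]
    · change star (∑ i, f i) = _
      rw [star_sum]
      exact Finset.sum_congr rfl fun i _ => (hf i).star_eq'
  have hin : ∀ e : H →L[ℂ] H, IsStarProjection e → ((‖e v‖ ^ 2 : ℝ) : ℂ) = ⟪v, e v⟫_ℂ := by
    intro e he
    rw [Complex.ofReal_pow, ← Complex.coe_algebraMap, ← inner_self_eq_norm_sq_to_K (𝕜 := ℂ)]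
    conv_rhs => rw [← he.eq_sq, mul_apply_eq_comp]
    conv_lhs => rw [← ContinuousLinearMap.adjoint_inner_right,
      ← ContinuousLinearMap.star_eq_adjoint, he.star_eq']
  have h1 : ∑ i, ‖f i v‖ ^ 2 = ‖(∑ i, f i) v‖ ^ 2 := by
    apply Complex.ofReal_injective
    rw [hin _ hS, Complex.ofReal_sum, _root_.sum_apply, inner_sum]
    exact Finset.sum_congr rfl fun i _ => hin _ (hf i)
  rw [h1]
  refine pow_le_pow_left₀ (norm_nonneg _) ?_ 2
  refine (ContinuousLinearMap.le_opNorm _ _).trans ?_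
  exact mul_le_of_le_one_left (norm_nonneg _) hS.norm_le

theorem norm_sum_mul_mul_le {ι : Type*} [Fintype ι] {e f : ι → H →L[ℂ] H}
    (he : ∀ i, IsStarProjection (e i)) (heo : ∀ i j, i ≠ j → e i * e j = 0)
    (hf : ∀ i, IsStarProjection (f i)) (hfo : ∀ i j, i ≠ j → f i * f j = 0) (x : H →L[ℂ] H) :
    ‖∑ i, e i * x * f i‖ ≤ ‖x‖ := by
  classical
  refine ContinuousLinearMap.opNorm_le_bound _ (norm_nonneg _) fun v => ?_
  set w := (∑ i, e i * x * f i) v with hw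
  have hwi : ∀ i, e i w = e i (x (f i v)) := by
    intro i
    have : e i * (∑ j, e j * x * f j) = e i * x * f i := by
      rw [Finset.mul_sum, Finset.sum_eq_single i, ← mul_assoc, ← mul_assoc, (he i).eq_sq]
      · intro j _ hj
        rw [← mul_assoc, ← mul_assoc, heo i j hj.symm, zero_mul, zero_mul]
      · simp
    exact DFunLike.congr_fun this v
  have h1 : ‖w‖ ^ 2 ≤ ∑ i, ‖e i w‖ * (‖x‖ * ‖f i v‖) := by
    have : ((‖w‖ ^ 2 : ℝ) : ℂ) = ∑ i, ⟪e i w, x (f i v)⟫_ℂ := by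
      rw [Complex.ofReal_pow, ← Complex.coe_algebraMap, ← inner_self_eq_norm_sq_to_K (𝕜 := ℂ)]
      have hww : ⟪w, w⟫_ℂ = ⟪w, ∑ i, (e i * x * f i) v⟫_ℂ := by
        rw [← _root_.sum_apply]
      rw [hww, inner_sum]
      refine Finset.sum_congr rfl fun i _ => ?_
      rw [mul_apply_eq_comp, mul_apply_eq_comp, ← ContinuousLinearMap.adjoint_inner_left,
        ← ContinuousLinearMap.star_eq_adjoint, (he i).star_eq']
    have h2 : ‖w‖ ^ 2 = ‖((‖w‖ ^ 2 : ℝ) : ℂ)‖ := by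
      rw [Complex.norm_real, Real.norm_of_nonneg (by positivity)]
    rw [h2, this]
    refine (norm_sum_le _ _).trans (Finset.sum_le_sum fun i _ => ?_)
    refine (norm_inner_le_norm _ _).trans ?_
    gcongr
    exact ContinuousLinearMap.le_opNorm _ _
  have h2 : ∑ i, ‖e i w‖ * (‖x‖ * ‖f i v‖) ≤
      (∑ i, ‖e i w‖ ^ 2 + ∑ i, (‖x‖ * ‖f i v‖) ^ 2) / 2 := by
    rw [← Finset.sum_add_distrib, Finset.sum_div]
    refine Finset.sum_le_sum fun i _ => ?_
    nlinarith [sq_nonneg (‖e i w‖ - ‖x‖ * ‖f i v‖)]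
  have h3 := sum_norm_sq_le_of_orthogonal he heo w
  have h4 : ∑ i, (‖x‖ * ‖f i v‖) ^ 2 ≤ (‖x‖ * ‖v‖) ^ 2 := by
    simp only [mul_pow]
    rw [← Finset.mul_sum]
    exact mul_le_mul_of_nonneg_left (sum_norm_sq_le_of_orthogonal hf hfo v) (by positivity)
  exact (abs_le_of_sq_le_sq' (by nlinarith) (by positivity)).2

end Intertwiners

section IntertwinerLimit

/-- A map between the projections of `A` preserving order and orthogonality. -/
structure IsProjectionMap (A : VonNeumannAlgebra H) (q : (H →L[ℂ] H) → (H →L[ℂ] H)) : Prop where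
  mem : ∀ p ∈ A, IsStarProjection p → q p ∈ A
  proj : ∀ p ∈ A, IsStarProjection p → IsStarProjection (q p)
  mono : ∀ p ∈ A, IsStarProjection p → ∀ s ∈ A, IsStarProjection s → p * s = s → q p * q s = q s
  orth : ∀ p ∈ A, IsStarProjection p → ∀ s ∈ A, IsStarProjection s → p * s = 0 → q p * q s = 0

theorem isProjectionMap_id (A : VonNeumannAlgebra H) : IsProjectionMap A fun p => p :=
  ⟨fun _ h _ => h, fun _ _ h => h, fun _ _ _ _ _ _ h => h, fun _ _ _ _ _ _ h => h⟩

variable {M : VonNeumannAlgebra H} {τ : (H →L[ℂ] H) → ℂ}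

theorem IsFaithfulTracialState.norm2_sum_mul_sq
    (hτ : IsFaithfulTracialState (M : Set (H →L[ℂ] H)) τ) {ι : Type*} [Fintype ι]
    {c y : ι → H →L[ℂ] H} (hcM : ∀ i, c i ∈ M) (hc : ∀ i, IsStarProjection (c i))
    (ho : ∀ i j, i ≠ j → c i * c j = 0) (hy : ∀ i, y i ∈ M) :
    norm2 τ (∑ i, c i * y i) ^ 2 = ∑ i, (τ (star (y i) * c i * y i)).re := by
  classical
  have hsum : ∑ i, c i * y i ∈ M := sum_mem fun i _ => mul_mem (hcM i) (hy i)
  have e : star (∑ i, c i * y i) * ∑ i, c i * y i = ∑ i, star (y i) * c i * y i := by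
    rw [star_sum, Finset.sum_mul_sum]
    refine Finset.sum_congr rfl fun i _ => ?_
    rw [Finset.sum_eq_single i]
    · rw [star_mul, (hc i).star_eq', mul_assoc, ← mul_assoc (c i), (hc i).eq_sq, mul_assoc]
    · intro j _ hj
      rw [star_mul, (hc i).star_eq', mul_assoc, ← mul_assoc (c i), ho i j hj.symm, zero_mul,
        mul_zero]
    · simp
  rw [hτ.norm2_sq hsum, e, hτ.map_sum _ _ fun i _ =>
    mul_mem (mul_mem (star_mem (hy i)) (hcM i)) (hy i), Complex.re_sum]

theorem IsFaithfulTracialState.norm2_sum_mul_mul_le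
    (hτ : IsFaithfulTracialState (M : Set (H →L[ℂ] H)) τ) {A : VonNeumannAlgebra H} (hAM : A ≤ M)
    {ι : Type} [Fintype ι] {c r : ι → H →L[ℂ] H} (hc : IsPartition A c) (hrM : ∀ i, r i ∈ M)
    (hr : ∀ i, IsStarProjection (r i)) (ho : ∀ i j, i ≠ j → r i * r j = 0)
    {w : H →L[ℂ] H} (hw : w ∈ M) :
    norm2 τ (∑ i, r i * w * c i) ≤ norm2 τ w := by
  have hcM : ∀ i, c i ∈ M := fun i => hAM (hc.mem i)
  have hwc : ∀ i, w * c i ∈ M := fun i => mul_mem hw (hcM i)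
  refine (sq_le_sq₀ (norm2_nonneg τ _) (norm2_nonneg τ w)).1 ?_
  simp only [mul_assoc]
  rw [hτ.norm2_sum_mul_sq hrM hr ho hwc, hτ.norm2_sq hw]
  have hww : star w * w ∈ M := mul_mem (star_mem hw) hw
  have h1 : ∀ i, (τ (star (w * c i) * r i * (w * c i))).re ≤ (τ (star w * w * c i)).re := by
    intro i
    have h2 : star (w * c i) * r i * (w * c i) ≤ star (w * c i) * (w * c i) := by
      have := star_left_conjugate_le_conjugate (hr i).le_one (w * c i)
      rwa [mul_one] at this
    refine (hτ.re_mono (mul_mem (mul_mem (star_mem (hwc i)) (hrM i)) (hwc i))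
      (mul_mem (star_mem (hwc i)) (hwc i)) h2).trans (le_of_eq ?_)
    rw [star_mul, (hc.proj i).star_eq', mul_assoc,
      hτ.tracial _ (hcM i) _ (mul_mem (star_mem hw) (hwc i))]
    congr 2
    rw [mul_assoc, mul_assoc, (hc.proj i).eq_sq, mul_assoc]
  refine (Finset.sum_le_sum fun i _ => h1 i).trans (le_of_eq ?_)
  rw [← Complex.re_sum, ← hτ.map_sum _ _ fun i _ => mul_mem hww (hcM i), ← Finset.mul_sum,
    hc.sum_eq, mul_one]

/-- An operator almost intertwining the projections of `A` along every finite partition is close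
to an operator that intertwines them exactly. -/
theorem IsFaithfulTracialState.exists_intertwiner
    (hτ : IsFaithfulTracialState (M : Set (H →L[ℂ] H)) τ) (hM : IsFactor (M : Set (H →L[ℂ] H)))
    {N A : VonNeumannAlgebra H} (hNM : N ≤ M) (hAN : A ≤ N)
    (hA : ∀ a ∈ A, ∀ b ∈ A, a * b = b * a)
    {q r : (H →L[ℂ] H) → (H →L[ℂ] H)} (hq : IsProjectionMap A q) (hr : IsProjectionMap A r)
    {x : H →L[ℂ] H} (hx : x ∈ N) {δ : ℝ}
    (hxq : ∀ (ι : Type) [Fintype ι] (c : ι → H →L[ℂ] H), IsPartition A c →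
      norm2 τ (x - ∑ i, c i * x * q (c i)) ≤ δ)
    (hxr : ∀ (ι : Type) [Fintype ι] (c : ι → H →L[ℂ] H), IsPartition A c →
      norm2 τ (x - ∑ i, r (c i) * x * c i) ≤ δ) :
    ∃ y ∈ N, norm2 τ (x - y) ≤ 2 * δ ∧
      ∀ p ∈ A, IsStarProjection p → p * y = y * q p ∧ y * p = r p * y := by
  classical
  have hAM : A ≤ M := hAN.trans hNM
  obtain ⟨l, hl⟩ := hτ.exists_vecSum hM
  let I := {p : H →L[ℂ] H // p ∈ A ∧ IsStarProjection p} ⊕ ({z : H →L[ℂ] H // z ∈ M} ⊕ Unit)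
  let t : I → Set (H →L[ℂ] H) := Sum.elim
    (fun p => {y | p.1 * y * 1 = 1 * y * q p.1} ∩ {y | 1 * y * p.1 = r p.1 * y * 1})
    (Sum.elim (fun z => {y | vecSum l (star z.1 * y * 1) ∈
      Metric.closedBall (τ (star z.1 * x)) (norm2 τ z.1 * (2 * δ))}) fun _ => N)
  have ht : ∀ i, IsWOTClosed (t i) := by
    rintro (p | z | _)
    · exact (isWOTClosed_mul_eq _ _ _ _).inter (isWOTClosed_mul_eq _ _ _ _)
    · exact isWOTClosed_vecSum _ _ _ Metric.isClosed_closedBall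
    · exact N.isWOTClosed
  obtain ⟨y, -, hy⟩ := exists_forall_mem_of_finite t ht ‖x‖ (by
    intro u
    let F : Finset (H →L[ℂ] H) := u.biUnion fun i => Sum.elim (fun p => {p.1}) (fun _ => ∅) i
    have hFmem : ∀ p, Sum.inl p ∈ u → p.1 ∈ F := fun p hp =>
      Finset.mem_biUnion.2 ⟨_, hp, by simp⟩
    have hF : ∀ p ∈ F, p ∈ A ∧ IsStarProjection p := by
      intro p hp
      obtain ⟨i, -, hi⟩ := Finset.mem_biUnion.1 hp
      rcases i with i | i
      · simp only [Sum.elim_inl, Finset.mem_singleton] at hi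
        exact hi ▸ i.2
      · simp at hi
    obtain ⟨ι, _, c, hc, href⟩ := exists_isPartition_refining hA F hF
    have hqA : ∀ i, q (c i) ∈ A := fun i => hq.mem _ (hc.mem i) (hc.proj i)
    have hrA : ∀ i, r (c i) ∈ A := fun i => hr.mem _ (hc.mem i) (hc.proj i)
    have hqp : ∀ i, IsStarProjection (q (c i)) := fun i => hq.proj _ (hc.mem i) (hc.proj i)
    have hrp : ∀ i, IsStarProjection (r (c i)) := fun i => hr.proj _ (hc.mem i) (hc.proj i)
    have hqo : ∀ i j, i ≠ j → q (c i) * q (c j) = 0 := fun i j h =>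
      hq.orth _ (hc.mem i) (hc.proj i) _ (hc.mem j) (hc.proj j) (hc.orth i j h)
    have hro : ∀ i j, i ≠ j → r (c i) * r (c j) = 0 := fun i j h =>
      hr.orth _ (hc.mem i) (hc.proj i) _ (hc.mem j) (hc.proj j) (hc.orth i j h)
    set z : H →L[ℂ] H := ∑ i, c i * x * q (c i) with hz
    have hzN : z ∈ N := sum_mem fun i _ => mul_mem (mul_mem (hAN (hc.mem i)) hx) (hAN (hqA i))
    set y : H →L[ℂ] H := ∑ j, r (c j) * z * c j with hy
    have hyN : y ∈ N := sum_mem fun i _ => mul_mem (mul_mem (hAN (hrA i)) hzN) (hAN (hc.mem i))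
    have hyx : norm2 τ (x - y) ≤ 2 * δ := by
      set w : H →L[ℂ] H := ∑ j, r (c j) * x * c j with hw
      have hwN : w ∈ N := sum_mem fun i _ => mul_mem (mul_mem (hAN (hrA i)) hx) (hAN (hc.mem i))
      have h1 : w - y = ∑ j, r (c j) * (x - z) * c j := by
        rw [hw, hy, ← Finset.sum_sub_distrib]
        refine Finset.sum_congr rfl fun i _ => ?_
        rw [mul_sub, sub_mul]
      have h2 : norm2 τ (w - y) ≤ δ := by
        rw [h1]
        exact (hτ.norm2_sum_mul_mul_le hAM hc (fun i => hAM (hrA i)) hrp hro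
          (sub_mem (hNM hx) (hNM hzN))).trans (hxq ι c hc)
      have h3 := hτ.norm2_sub_le (hNM hx) (hNM hyN) w (hNM hwN)
      have h4 := hxr ι c hc
      linarith
    have hynorm : ‖y‖ ≤ ‖x‖ :=
      (norm_sum_mul_mul_le hrp hro hc.proj hc.orth z).trans
        (norm_sum_mul_mul_le hc.proj hc.orth hqp hqo x)
    refine ⟨y, hynorm, ?_⟩
    rintro (p | s | _) hi
    · obtain ⟨p, hpA, hp⟩ := p
      have hpF : p ∈ F := hFmem _ hi
      have hpz : p * z = z * q p := by
        rw [hz, Finset.mul_sum, Finset.sum_mul]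
        refine Finset.sum_congr rfl fun i _ => ?_
        have hcm : q (c i) * q p = q p * q (c i) := hA _ (hqA i) _ (hq.mem p hpA hp)
        rw [mul_assoc (c i * x), hcm, ← mul_assoc, ← mul_assoc]
        rcases href p hpF i with h | h
        · rw [hq.mono p hpA hp _ (hc.mem i) (hc.proj i) h, h]
        · rw [hq.orth p hpA hp _ (hc.mem i) (hc.proj i) h, h]
          simp
      constructor
      · change p * y * 1 = 1 * y * q p
        rw [mul_one, one_mul, hy, Finset.mul_sum, Finset.sum_mul]
        refine Finset.sum_congr rfl fun i _ => ?_
        rw [mul_assoc _ (c i), hA _ (hc.mem i) _ (hq.mem p hpA hp), ← mul_assoc _ (q p),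
          mul_assoc _ z (q p), ← hpz, ← mul_assoc, ← mul_assoc, ← mul_assoc,
          hA p hpA _ (hrA i)]
      · change 1 * y * p = r p * y * 1
        rw [mul_one, one_mul, hy, Finset.mul_sum, Finset.sum_mul]
        refine Finset.sum_congr rfl fun i _ => ?_
        have hcm : c i * p = p * c i := hA _ (hc.mem i) _ hpA
        rw [mul_assoc _ (c i), hcm, ← mul_assoc (r p), ← mul_assoc (r p)]
        rcases href p hpF i with h | h
        · rw [h, hr.mono p hpA hp _ (hc.mem i) (hc.proj i) h]
        · rw [h, hr.orth p hpA hp _ (hc.mem i) (hc.proj i) h]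
          simp
    · change vecSum l (star s.1 * y * 1) ∈
        Metric.closedBall (τ (star s.1 * x)) (norm2 τ s.1 * (2 * δ))
      have hs := star_mem s.2
      rw [mul_one, ← hl _ (mul_mem hs (hNM hyN)), mem_closedBall_iff_norm', ← hτ.map_sub
        (mul_mem hs (hNM hx)) (mul_mem hs (hNM hyN)), ← mul_sub]
      exact (hτ.norm_tau_star_mul_le s.2 (sub_mem (hNM hx) (hNM hyN))).trans
        (mul_le_mul_of_nonneg_left hyx (norm2_nonneg τ _))
    · exact hyN)
  have hyN : y ∈ N := hy (Sum.inr (Sum.inr ()))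
  refine ⟨y, hyN, ?_, fun p hpA hp => ?_⟩
  · have hxy : x - y ∈ M := sub_mem (hNM hx) (hNM hyN)
    have h1 : vecSum l (star (x - y) * y * 1) ∈
        Metric.closedBall (τ (star (x - y) * x)) (norm2 τ (x - y) * (2 * δ)) :=
      hy (Sum.inr (Sum.inl ⟨x - y, hxy⟩))
    have hs := star_mem hxy
    rw [mul_one, ← hl _ (mul_mem hs (hNM hyN)), mem_closedBall_iff_norm', ← hτ.map_sub
      (mul_mem hs (hNM hx)) (mul_mem hs (hNM hyN)), ← mul_sub] at h1
    have h2 := (Complex.re_le_norm _).trans h1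
    rw [← hτ.norm2_sq hxy, sq] at h2
    rcases (norm2_nonneg τ (x - y)).eq_or_lt with h | h
    · rw [← h]
      have h3 := hxq Unit (fun _ => 1) ⟨fun _ => one_mem A, fun _ => .one _,
        fun i j hij => absurd rfl hij, by simp⟩
      have := (norm2_nonneg τ _).trans h3
      linarith
    · exact le_of_mul_le_mul_left h2 h
  · have h := hy (Sum.inl ⟨p, hpA, hp⟩)
    have h1 : p * y * 1 = 1 * y * q p := h.1
    have h2 : 1 * y * p = r p * y * 1 := h.2
    simp only [mul_one, one_mul] at h1 h2
    exact ⟨h1, h2⟩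

end IntertwinerLimit

section Normalizers

/-- `vNgen S` as a bundled von Neumann algebra. -/
def vNgenAlg (S : Set (H →L[ℂ] H)) : VonNeumannAlgebra H where
  toSubalgebra := Subalgebra.centralizer ℂ (Set.centralizer (S ∪ star '' S))
  star_mem' := by
    have hS : ∀ x ∈ S ∪ star '' S, star x ∈ S ∪ star '' S := by
      rintro x (hx | ⟨y, hy, rfl⟩)
      · exact Or.inr ⟨x, hx, rfl⟩
      · left; rwa [star_star]
    have h1 : ∀ T ∈ Set.centralizer (S ∪ star '' S), star T ∈ Set.centralizer (S ∪ star '' S) := by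
      intro T hT x hx
      have := congr_arg star (hT _ (hS x hx))
      simpa using this.symm
    intro x hx T hT
    have := congr_arg star (hx _ (h1 T hT))
    simpa using this.symm
  centralizer_centralizer' := Set.centralizer_centralizer_centralizer _

theorem subset_vNgenAlg (S : Set (H →L[ℂ] H)) {x : H →L[ℂ] H} (hx : x ∈ S) : x ∈ vNgenAlg S :=
  Set.subset_centralizer_centralizer (Or.inl hx)

theorem vNgen_subset {S : Set (H →L[ℂ] H)} {M : VonNeumannAlgebra H} (h : ∀ x ∈ S, x ∈ M) :
    vNgen S ⊆ M := by
  intro x hx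
  refine M.mem_of_forall_commute fun T hT => ?_
  rw [VonNeumannAlgebra.mem_commutant_iff] at hT
  refine (hx T ?_)
  rintro y (hy | ⟨y, hy, rfl⟩)
  · exact hT y (h y hy)
  · exact hT _ (star_mem (h y hy))

namespace IsMasa

variable {N A : VonNeumannAlgebra H}

theorem le (h : IsMasa (N : Set (H →L[ℂ] H)) A) : A ≤ N := h.1

theorem mul_comm (h : IsMasa (N : Set (H →L[ℂ] H)) A) {a b : H →L[ℂ] H} (ha : a ∈ A) (hb : b ∈ A) :
    a * b = b * a := by
  have : a ∈ {x ∈ (N : Set (H →L[ℂ] H)) | ∀ a ∈ (A : Set (H →L[ℂ] H)), x * a = a * x} := by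
    rw [h.2.2]; exact ha
  exact this.2 b hb

theorem mem_of_forall_projection (h : IsMasa (N : Set (H →L[ℂ] H)) A) {x : H →L[ℂ] H} (hx : x ∈ N)
    (hc : ∀ p ∈ A, IsStarProjection p → x * p = p * x) : x ∈ A := by
  have : x ∈ {x ∈ (N : Set (H →L[ℂ] H)) | ∀ a ∈ (A : Set (H →L[ℂ] H)), x * a = a * x} :=
    ⟨hx, fun a ha => A.commute_of_forall_projection hc ha⟩
  rwa [h.2.2] at this

theorem selfAdjoint_mem_normAlg {U : H →L[ℂ] H} (hU : U ∈ N)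
    (hsa : star U = U) (hUU : U * U = 1) (hUA : ∀ a ∈ A, U * a * U ∈ A) :
    U ∈ vNgenAlg (normalizerSet (N : Set (H →L[ℂ] H)) A) := by
  refine subset_vNgenAlg _ ⟨hU, ⟨by rw [hsa, hUU], by rw [hsa, hUU]⟩, ?_⟩
  rw [hsa]
  apply Set.Subset.antisymm
  · rintro _ ⟨a, ha, rfl⟩
    exact hUA a ha
  · intro a ha
    refine ⟨U * a * U, hUA a ha, ?_⟩
    change U * (U * a * U) * U = a
    rw [← mul_assoc, ← mul_assoc, hUU, one_mul, mul_assoc, hUU, mul_one]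

theorem le_normAlg (h : IsMasa (N : Set (H →L[ℂ] H)) A) :
    A ≤ vNgenAlg (normalizerSet (N : Set (H →L[ℂ] H)) A) := by
  intro a ha
  refine VonNeumannAlgebra.mem_of_forall_commute _ fun T hT => ?_
  rw [VonNeumannAlgebra.mem_commutant_iff] at hT
  refine A.commute_of_forall_projection (fun p hpA hp => ?_) ha
  have hpp := hp.eq_sq
  have hUA : 1 - (2 : ℂ) • p ∈ A := sub_mem (one_mem A) (A.smul_mem' 2 hpA)
  have hU : 1 - (2 : ℂ) • p ∈ vNgenAlg (normalizerSet (N : Set (H →L[ℂ] H)) A) := by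
    refine selfAdjoint_mem_normAlg (h.le hUA) ?_ ?_ fun a ha => mul_mem (mul_mem hUA ha) hUA
    · rw [star_sub, star_one, star_smul, hp.star_eq']; simp
    · simp only [sub_mul, mul_sub, one_mul, mul_one, smul_mul_smul_comm, hpp]
      module
  have h1 := hT _ hU
  rw [sub_mul, mul_sub, one_mul, mul_one, sub_right_inj, smul_mul_assoc, mul_smul_comm] at h1
  exact (smul_right_injective _ (two_ne_zero' ℂ) h1).symm

/-- A partial isometry normalizing `A` whose initial projection is orthogonal to its range
is a corner of a self-adjoint normalizing unitary. -/
theorem mul_mem_normAlg_of_orthogonal (h : IsMasa (N : Set (H →L[ℂ] H)) A) {v p : H →L[ℂ] H}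
    (hv : v ∈ N) (hvA : ∀ a ∈ A, v * a * star v ∈ A) (hvA' : ∀ a ∈ A, star v * a * v ∈ A)
    (hpA : p ∈ A) (hp : IsStarProjection p) (hvp : star v * v * p = p)
    (horth : p * (v * p * star v) = 0) :
    v * p ∈ vNgenAlg (normalizerSet (N : Set (H →L[ℂ] H)) A) := by
  set f := v * p * star v with hf
  set w := v * p with hw
  have hpp := hp.eq_sq
  have hfA : f ∈ A := hvA p hpA
  have hfs : star f = f := by rw [hf, star_mul, star_mul, star_star, hp.star_eq', ← mul_assoc]
  have hwp : w * p = w := by rw [hw, mul_assoc, hpp]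
  have hfw : f * w = w := by
    rw [hf, hw, mul_assoc, ← mul_assoc (star v), hvp, mul_assoc, hpp]
  have hww : w * star w = f := by
    rw [hw, star_mul, hp.star_eq', mul_assoc, ← mul_assoc p, hpp, ← mul_assoc]
  have hsw : star w * w = p := by
    rw [hw, star_mul, hp.star_eq', mul_assoc, ← mul_assoc (star v), hvp, hpp]
  have hff : f * f = f := by
    calc f * f = f * w * star w := by rw [mul_assoc f w, hww]
      _ = f := by rw [hfw, hww]
  have hfp : f * p = 0 := by rw [h.mul_comm hfA hpA, horth]
  have hpw : p * w = 0 := by rw [← hfw, ← mul_assoc, horth, zero_mul]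
  have hwf : w * f = 0 := by rw [← hwp, mul_assoc, horth, mul_zero]
  have hswp : star w * p = 0 := by
    have := congr_arg star hpw
    rwa [star_mul, hp.star_eq', star_zero] at this
  have hw0 : w * w = 0 := by
    calc w * w = w * p * w := by rw [hwp]
      _ = 0 := by rw [mul_assoc, hpw, mul_zero]
  have hsw0 : star w * star w = 0 := by rw [← star_mul, hw0, star_zero]
  set g := 1 - p - f with hg
  have hgA : g ∈ A := sub_mem (sub_mem (one_mem A) hpA) hfA
  have hgs : star g = g := by rw [hg, star_sub, star_sub, star_one, hp.star_eq', hfs]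
  have hgw : g * w = 0 := by rw [hg, sub_mul, sub_mul, hpw, hfw, one_mul, sub_zero, sub_self]
  have hwg : w * g = 0 := by rw [hg, mul_sub, mul_sub, hwp, hwf, mul_one, sub_self, sub_zero]
  have hsgw : star w * g = 0 := by rw [← hgs, ← star_mul, hgw, star_zero]
  have hgsw : g * star w = 0 := by rw [← hgs, ← star_mul, hwg, star_zero]
  have hgg : g * g = g := by
    simp only [hg, sub_mul, mul_sub, one_mul, mul_one, hpp, hff, hfp, horth]
    abel
  have hwN : w ∈ N := mul_mem hv (h.le hpA)
  have hU : w + star w + g ∈ vNgenAlg (normalizerSet (N : Set (H →L[ℂ] H)) A) := by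
    refine selfAdjoint_mem_normAlg (add_mem (add_mem hwN (star_mem hwN)) (h.le hgA)) ?_ ?_ fun a ha => ?_
    · rw [star_add, star_add, star_star, hgs, add_comm (star w)]
    · simp only [add_mul, mul_add, hw0, hsw0, hww, hsw, hgw, hwg, hsgw, hgsw, hgg]
      rw [hg]; abel
    · have hag : a * g = g * a := h.mul_comm ha hgA
      have haf : a * f = f * a := h.mul_comm ha hfA
      have hap : a * p = p * a := h.mul_comm ha hpA
      have e1 : w * a * w = 0 := by
        calc w * a * w = w * (a * f) * w := by
              rw [mul_assoc w a w, mul_assoc w (a * f) w, mul_assoc a f w, hfw]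
          _ = 0 := by rw [haf, ← mul_assoc w f a, hwf, zero_mul, zero_mul]
      have e2 : w * a * g = 0 := by rw [mul_assoc, hag, ← mul_assoc, hwg, zero_mul]
      have e3 : star w * a * star w = 0 := by
        have : star w = p * star w := by
          conv_lhs => rw [← hwp, star_mul, hp.star_eq']
        calc star w * a * star w = star w * (a * p) * star w := by
              rw [mul_assoc (star w) a, mul_assoc (star w) (a * p), mul_assoc a p, ← this]
          _ = 0 := by rw [hap, ← mul_assoc, hswp, zero_mul, zero_mul]
      have e4 : star w * a * g = 0 := by rw [mul_assoc, hag, ← mul_assoc, hsgw, zero_mul]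
      have e5 : g * a * w = 0 := by rw [← hag, mul_assoc, hgw, mul_zero]
      have e6 : g * a * star w = 0 := by rw [← hag, mul_assoc, hgsw, mul_zero]
      have e7 : w * a * star w ∈ A := by
        have := hvA _ (mul_mem (mul_mem hpA ha) hpA)
        have e : w * a * star w = v * (p * a * p) * star v := by
          rw [hw, star_mul, hp.star_eq']; simp only [mul_assoc]
        rwa [e]
      have e8 : star w * a * w ∈ A := by
        have := mul_mem (mul_mem hpA (hvA' a ha)) hpA
        have e : star w * a * w = p * (star v * a * v) * p := by
          rw [hw, star_mul, hp.star_eq']; simp only [mul_assoc]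
        rwa [e]
      simp only [add_mul, mul_add, e1, e2, e3, e4, e5, e6, zero_add, add_zero]
      exact add_mem (add_mem e8 e7) (mul_mem (mul_mem hgA ha) hgA)
  have e : (w + star w + g) * p = w := by
    rw [add_mul, add_mul, hwp, hswp, hg, sub_mul, sub_mul, one_mul, hpp, hfp]
    abel
  rw [← e]
  exact mul_mem hU (h.le_normAlg hpA)

/-- Partial isometries normalizing a MASA belong to its normalizing algebra. -/
theorem partialIsometry_mem_normAlg (h : IsMasa (N : Set (H →L[ℂ] H)) A) {v : H →L[ℂ] H}
    (hv : v ∈ N) (hvv : v * star v * v = v) (hvA : ∀ a ∈ A, v * a * star v ∈ A)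
    (hvA' : ∀ a ∈ A, star v * a * v ∈ A) :
    v ∈ vNgenAlg (normalizerSet (N : Set (H →L[ℂ] H)) A) := by
  set W := vNgenAlg (normalizerSet (N : Set (H →L[ℂ] H)) A) with hW
  have hrA : v * star v ∈ A := by simpa using hvA 1 (one_mem A)
  have hlA : star v * v ∈ A := by simpa using hvA' 1 (one_mem A)
  obtain ⟨e, heA, he, heS, heU⟩ := A.exists_projection_range {a | a ∈ A ∧ v * a ∈ W} fun s hs => hs.1
  have hee := he.eq_sq
  have hve : v * e ∈ W := by
    refine W.mem_of_forall_commute fun T hT => ?_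
    have hTA := fun a (ha : a ∈ A) => VonNeumannAlgebra.mem_commutant_iff.1 hT a (h.le_normAlg ha)
    have h1 := heU (T * v - v * T) (by
      rintro s ⟨hsA, hs⟩
      have := VonNeumannAlgebra.mem_commutant_iff.1 hT _ hs
      rw [sub_mul, mul_assoc T, ← this, mul_assoc v T, ← hTA s hsA, mul_assoc, sub_self])
    rw [sub_mul, sub_eq_zero] at h1
    rw [← mul_assoc, h1, mul_assoc, ← hTA e heA, mul_assoc]
  set p₀ := 1 - e with hp₀
  have hp₀A : p₀ ∈ A := sub_mem (one_mem A) heA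
  have hep₀ : e * p₀ = 0 := by rw [hp₀, mul_sub, mul_one, hee, sub_self]
  have hlp₀ : star v * v * p₀ = p₀ := by
    have h1 : e * (1 - star v * v) = 1 - star v * v := by
      refine heS _ ⟨sub_mem (one_mem A) hlA, ?_⟩
      rw [mul_sub, mul_one, ← mul_assoc, hvv, sub_self]
      exact zero_mem W
    have h2 : (1 - star v * v) * p₀ = 0 := by
      rw [← h1, mul_assoc, h.mul_comm (sub_mem (one_mem A) hlA) hp₀A, ← mul_assoc, hep₀, zero_mul]
    rw [sub_mul, one_mul, sub_eq_zero] at h2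
    exact h2.symm
  have key : ∀ p ∈ A, IsStarProjection p → p₀ * p = p → v * p = p * v * p := by
    intro p hpA hp hpp₀
    have hpp := hp.eq_sq
    have hlp : star v * v * p = p := by rw [← hpp₀, ← mul_assoc, hlp₀]
    set k := star v * p * v with hk
    have hkA : k ∈ A := hvA' p hpA
    have hkp : IsStarProjection k := by
      refine ⟨?_, ?_⟩
      · change k * k = k
        calc k * k = star v * (p * (v * star v)) * p * v := by rw [hk]; simp only [mul_assoc]
          _ = star v * (v * star v * p) * p * v := by rw [h.mul_comm hpA hrA]
          _ = (star v * v * star v) * (p * p) * v := by simp only [mul_assoc]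
          _ = k := by
            have := congr_arg star hvv
            simp only [star_mul, star_star, ← mul_assoc] at this
            rw [hpp, this]
      · change star k = k
        rw [hk, star_mul, star_mul, star_star, hp.star_eq', ← mul_assoc]
    have hsA : p * (1 - k) ∈ A := mul_mem hpA (sub_mem (one_mem A) hkA)
    have hs : IsStarProjection (p * (1 - k)) :=
      hp.mul hkp.one_sub (h.mul_comm hpA (sub_mem (one_mem A) hkA))
    have hfA := hvA p hpA
    have hvk : v * k = p * v := by
      calc v * k = (v * star v * p) * v := by rw [hk]; simp only [mul_assoc]
        _ = p * (v * star v * v) := by rw [h.mul_comm hrA hpA]; simp only [mul_assoc]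
        _ = p * v := by rw [hvv]
    have hvs : v * (p * (1 - k)) = (1 - p) * (v * p) := by
      rw [h.mul_comm hpA (sub_mem (one_mem A) hkA), ← mul_assoc, mul_sub, hvk, mul_one, sub_mul,
        sub_mul, one_mul, mul_assoc p]
    have hmem : v * (p * (1 - k)) ∈ W := by
      refine h.mul_mem_normAlg_of_orthogonal hv hvA hvA' hsA hs ?_ ?_
      · rw [← mul_assoc, hlp]
      · rw [hvs, h.mul_comm hpA (sub_mem (one_mem A) hkA), ← mul_assoc, ← mul_assoc,
          mul_assoc (1 - k) p, mul_sub, mul_one, hpp, sub_self]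
        simp
    have h0 : p * (1 - k) = 0 := by
      rw [← heS _ ⟨hsA, hmem⟩, ← mul_assoc, ← hpp₀, ← mul_assoc, hep₀, zero_mul, zero_mul]
    have h1 := hvs
    rw [h0, mul_zero, sub_mul, one_mul] at h1
    rw [mul_assoc]
    exact sub_eq_zero.1 h1.symm
  have hvp₀ : v * p₀ ∈ A := by
    refine h.mem_of_forall_projection (mul_mem hv (h.le hp₀A)) fun p hpA hp => ?_
    have hpp := hp.eq_sq
    have hp₀p : IsStarProjection p₀ := he.one_sub
    have hc : p₀ * p = p * p₀ := h.mul_comm hp₀A hpA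
    have h1 := key (p₀ * p) (mul_mem hp₀A hpA) (hp₀p.mul hp hc) (by
      rw [← mul_assoc, hp₀p.eq_sq])
    have h1pA : 1 - p ∈ A := sub_mem (one_mem A) hpA
    have hc' : p₀ * (1 - p) = (1 - p) * p₀ := h.mul_comm hp₀A h1pA
    have h2 := key (p₀ * (1 - p)) (mul_mem hp₀A h1pA) (hp₀p.mul hp.one_sub hc') (by
      rw [← mul_assoc, hp₀p.eq_sq])
    have h3 : p * (v * (p₀ * p)) = v * (p₀ * p) := by
      rw [h1, hc, mul_assoc, ← mul_assoc p, ← mul_assoc p, hpp]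
    have h4 : p * (v * (p₀ * (1 - p))) = 0 := by
      have : p * (1 - p) = 0 := by rw [mul_sub, mul_one, hpp, sub_self]
      rw [h2, hc', mul_assoc, mul_assoc (1 - p), ← mul_assoc, this, zero_mul]
    calc v * p₀ * p = p * (v * (p₀ * p)) + p * (v * (p₀ * (1 - p))) := by
          rw [h3, h4, add_zero, mul_assoc]
      _ = p * (v * p₀) := by rw [← mul_add, ← mul_add, ← mul_add, add_sub_cancel, mul_one]
  have : v = v * e + v * p₀ := by rw [← mul_add, hp₀, add_sub_cancel, mul_one]
  rw [this]
  exact add_mem hve (h.le_normAlg hvp₀)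

/-- An operator intertwining the projections of a MASA belongs to its normalizing algebra. -/
theorem intertwiner_mem_normAlg (h : IsMasa (N : Set (H →L[ℂ] H)) A)
    {q r : (H →L[ℂ] H) → (H →L[ℂ] H)} (hq : IsProjectionMap A q) (hr : IsProjectionMap A r)
    {y : H →L[ℂ] H} (hyN : y ∈ N)
    (hy : ∀ p ∈ A, IsStarProjection p → p * y = y * q p ∧ y * p = r p * y) :
    y ∈ vNgenAlg (normalizerSet (N : Set (H →L[ℂ] H)) A) := by
  set W := vNgenAlg (normalizerSet (N : Set (H →L[ℂ] H)) A) with hW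
  let V : Set (H →L[ℂ] H) :=
    {v | ∀ p : {p // p ∈ A ∧ IsStarProjection p}, p.1 * v * 1 = 1 * v * q p.1} ∩
    {v | ∀ p : {p // p ∈ A ∧ IsStarProjection p}, 1 * v * p.1 = r p.1 * v * 1}
  have hVmem : ∀ v, v ∈ V ↔ ∀ p ∈ A, IsStarProjection p → p * v = v * q p ∧ v * p = r p * v := by
    intro v
    constructor
    · intro hv p hpA hp
      have h1 := hv.1 ⟨p, hpA, hp⟩
      have h2 := hv.2 ⟨p, hpA, hp⟩
      simp only [mul_one, one_mul] at h1 h2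
      exact ⟨h1, h2⟩
    · intro hv
      refine ⟨fun p => ?_, fun p => ?_⟩
      · simpa using (hv p.1 p.2.1 p.2.2).1
      · simpa using (hv p.1 p.2.1 p.2.2).2
  let C : Set (H →L[ℂ] H) := (N ∩ V) ∩ {v | ‖v‖ ≤ 1}
  have hC : IsWOTClosed C :=
    (N.isWOTClosed.inter ((isWOTClosed_setOf_forall fun _ => isWOTClosed_mul_eq _ _ _ _).inter
      (isWOTClosed_setOf_forall fun _ => isWOTClosed_mul_eq _ _ _ _))).inter
      (isWOTClosed_closedBall 1)
  have hsmul : ∀ c : ℂ, ∀ v ∈ V, c • v ∈ V := by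
    intro c v hv
    rw [hVmem] at hv ⊢
    intro p hpA hp
    obtain ⟨h1, h2⟩ := hv p hpA hp
    simp only [mul_smul_comm, smul_mul_assoc, h1, h2, and_self]
  have hadd : ∀ v ∈ V, ∀ w ∈ V, v + w ∈ V := by
    intro v hv w hw
    rw [hVmem] at hv hw ⊢
    intro p hpA hp
    obtain ⟨h1, h2⟩ := hv p hpA hp
    obtain ⟨h3, h4⟩ := hw p hpA hp
    simp only [mul_add, add_mul, h1, h2, h3, h4, and_self]
  have hsubset : C ⊆ W := by
    refine subset_of_isExtremeIn_mem hC (r := 1) (fun x hx => hx.2) (convex_of_smul_add ?_)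
      W.isWOTClosed (convex_of_smul_add ?_) ?_
    · rintro x ⟨⟨hxN, hxV⟩, hx1⟩ z ⟨⟨hzN, hzV⟩, hz1⟩ a b ha hb hab
      refine ⟨⟨add_mem (N.smul_mem' _ hxN) (N.smul_mem' _ hzN),
        hadd _ (hsmul _ _ hxV) _ (hsmul _ _ hzV)⟩, ?_⟩
      change ‖_‖ ≤ 1
      refine (norm_add_le _ _).trans ?_
      rw [norm_smul, norm_smul, Complex.norm_of_nonneg ha, Complex.norm_of_nonneg hb]
      change ‖x‖ ≤ 1 at hx1
      change ‖z‖ ≤ 1 at hz1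
      nlinarith
    · intro x hx z hz a b _ _ _
      exact add_mem (W.smul_mem' _ hx) (W.smul_mem' _ hz)
    · rintro v ⟨⟨⟨hvN, hvV⟩, hv1⟩, hext⟩
      have hv := (hVmem v).1 hvV
      have hst : ∀ p ∈ A, IsStarProjection p →
          star v * p = q p * star v ∧ p * star v = star v * r p := by
        intro p hpA hp
        obtain ⟨h1, h2⟩ := hv p hpA hp
        have h3 := congr_arg star h1
        have h4 := congr_arg star h2
        rw [star_mul, star_mul, hp.star_eq', (hq.proj p hpA hp).star_eq'] at h3
        rw [star_mul, star_mul, hp.star_eq', (hr.proj p hpA hp).star_eq'] at h4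
        exact ⟨h3, h4⟩
      have hvA : ∀ a ∈ A, v * a * star v ∈ A := by
        intro a ha
        refine h.mem_of_forall_projection (mul_mem (mul_mem hvN (h.le ha)) (star_mem hvN))
          fun p hpA hp => ?_
        rw [mul_assoc, (hst p hpA hp).1, ← mul_assoc, ← mul_assoc, ← mul_assoc, (hv p hpA hp).1,
          mul_assoc v a, mul_assoc v (q p), h.mul_comm ha (hq.mem p hpA hp)]
      have hvA' : ∀ a ∈ A, star v * a * v ∈ A := by
        intro a ha
        refine h.mem_of_forall_projection (mul_mem (mul_mem (star_mem hvN) (h.le ha)) hvN)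
          fun p hpA hp => ?_
        rw [mul_assoc, (hv p hpA hp).2, ← mul_assoc, ← mul_assoc, ← mul_assoc, (hst p hpA hp).2,
          mul_assoc (star v) a, mul_assoc (star v) (r p), h.mul_comm ha (hr.mem p hpA hp)]
      have hlA : star v * v ∈ A := by simpa using hvA' 1 (one_mem A)
      have hmulA : ∀ a ∈ A, v * a ∈ V := by
        intro a ha
        rw [hVmem]
        intro p hpA hp
        obtain ⟨h1, h2⟩ := hv p hpA hp
        exact ⟨by rw [← mul_assoc, h1, mul_assoc, mul_assoc, h.mul_comm ha (hq.mem p hpA hp)],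
          by rw [mul_assoc, h.mul_comm ha hpA, ← mul_assoc, h2, mul_assoc]⟩
      have hdA : 1 - star v * v ∈ A := sub_mem (one_mem A) hlA
      set d := (1 / 2 : ℂ) • (v * (1 - star v * v)) with hd
      have hdN : d ∈ N := N.smul_mem' _ (mul_mem hvN (h.le hdA))
      have hdV : d ∈ V := hsmul _ _ (hmulA _ hdA)
      have hd0 : d = 0 := by
        refine hext d ⟨⟨add_mem hvN hdN, hadd _ hvV _ hdV⟩, norm_add_half_le hv1⟩
          ⟨⟨sub_mem hvN hdN, ?_⟩, norm_sub_half_le hv1⟩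
        have : v - d = v + (-1 : ℂ) • d := by module
        rw [this]
        exact hadd _ hvV _ (hsmul _ _ hdV)
      have hvv : v * star v * v = v := by
        rw [hd, smul_eq_zero] at hd0
        have h2 := hd0.resolve_left (by norm_num)
        rw [mul_sub, mul_one, sub_eq_zero, ← mul_assoc] at h2
        exact h2.symm
      exact h.partialIsometry_mem_normAlg hvN hvv hvA hvA'
  have hpos : 0 < ‖y‖ + 1 := by positivity
  have hcy : ((‖y‖ + 1 : ℝ) : ℂ)⁻¹ • y ∈ W := by
    refine hsubset ⟨⟨N.smul_mem' _ hyN, hsmul _ _ ((hVmem y).2 hy)⟩, ?_⟩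
    change ‖_‖ ≤ 1
    rw [norm_smul, norm_inv, Complex.norm_of_nonneg hpos.le, inv_mul_le_iff₀ hpos]
    linarith
  have := W.smul_mem' ((‖y‖ + 1 : ℝ) : ℂ) hcy
  rwa [smul_smul, mul_inv_cancel₀ (by exact_mod_cast hpos.ne'), one_smul] at this

end IsMasa

end Normalizers

section ConditionalExpectation

theorem IsStarProjection.mul_nonneg_of_commute {g c : H →L[ℂ] H} (hg : IsStarProjection g)
    (hc : 0 ≤ c) (hgc : g * c = c * g) : 0 ≤ g * c := by
  have := star_left_conjugate_nonneg hc g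
  rwa [hg.star_eq', mul_assoc, ← hgc, ← mul_assoc, hg.eq_sq] at this

/-- `q` is a spectral projection of `b` for the interval `(1/2, ∞)`. -/
def IsHalfSpectral (B : VonNeumannAlgebra H) (b q : H →L[ℂ] H) : Prop :=
  q ∈ B ∧ IsStarProjection q ∧ ∃ c ∈ B, ∃ d ∈ B, 0 ≤ c ∧ 0 ≤ d ∧
    b - ((1 / 2 : ℝ) : ℂ) • 1 = c - d ∧ q * c = c ∧ q * d = 0 ∧ ∀ g, g * c = 0 → g * q = 0

theorem exists_isHalfSpectral (B : VonNeumannAlgebra H) {b : H →L[ℂ] H} (hb : b ∈ B)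
    (hsa : IsSelfAdjoint b) : ∃ q, IsHalfSpectral B b q := by
  obtain ⟨e, heB, c, hcB, d, hdB, he, h⟩ := B.exists_spectral_projection hb hsa (1 / 2)
  exact ⟨e, heB, he, c, hcB, d, hdB, h⟩

namespace IsHalfSpectral

variable {B : VonNeumannAlgebra H} {b b' q q' : H →L[ℂ] H}

theorem mul_eq_of_le (hB : ∀ a ∈ B, ∀ b ∈ B, a * b = b * a) (h : IsHalfSpectral B b q)
    (h' : IsHalfSpectral B b' q') (hbb : b ≤ b') : q' * q = q := by
  obtain ⟨hqB, hq, c, hcB, d, hdB, hc, hd, hcd, hqc, hqd, hg⟩ := h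
  obtain ⟨hqB', hq', c', hcB', d', hdB', hc', hd', hcd', hqc', hqd', -⟩ := h'
  have hgB : 1 - q' ∈ B := sub_mem (one_mem B) hqB'
  have hgp : IsStarProjection (1 - q') := hq'.one_sub
  have hle : c - d ≤ c' - d' := by
    rw [← hcd, ← hcd']
    exact sub_le_sub_right hbb _
  have h1 : 0 ≤ (1 - q') * (q * ((c' - d') - (c - d))) :=
    hgp.mul_nonneg_of_commute (hq.mul_nonneg_of_commute (sub_nonneg.2 hle)
      (hB _ hqB _ (sub_mem (sub_mem hcB' hdB') (sub_mem hcB hdB))))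
      (hB _ hgB _ (mul_mem hqB (sub_mem (sub_mem hcB' hdB') (sub_mem hcB hdB))))
  have h2 : (1 - q') * (q * ((c' - d') - (c - d))) = -(q * d') - (1 - q') * c := by
    have e1 : (1 - q') * (q * (c' - d')) = - (q * d') := by
      rw [← mul_assoc, hB _ hgB _ hqB, mul_assoc]
      have : (1 - q') * (c' - d') = - d' := by
        rw [sub_mul, one_mul, mul_sub, hqc', hqd']; abel
      rw [this, mul_neg]
    rw [mul_sub q, mul_sub (1 - q'), e1, mul_sub q, hqc, hqd, sub_zero]
  have h3 : 0 ≤ q * d' := hq.mul_nonneg_of_commute hd' (hB _ hqB _ hdB')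
  have h4 : 0 ≤ (1 - q') * c := hgp.mul_nonneg_of_commute hc (hB _ hgB _ hcB)
  have h5 : (1 - q') * c = 0 := by
    refine le_antisymm ?_ h4
    rw [h2] at h1
    have h6 := add_le_add h1 h3
    have e : -(q * d') - (1 - q') * c + q * d' = -((1 - q') * c) := by abel
    rw [e, add_zero] at h6
    exact neg_nonneg.1 h6
  have h6 := hg _ h5
  rw [sub_mul, one_mul, sub_eq_zero] at h6
  exact h6.symm

theorem mul_eq_zero_of_add_le (hB : ∀ a ∈ B, ∀ b ∈ B, a * b = b * a) (h : IsHalfSpectral B b q)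
    (h' : IsHalfSpectral B b' q') (hbb : b + b' ≤ 1) : q * q' = 0 := by
  obtain ⟨hqB, hq, c, hcB, d, hdB, hc, hd, hcd, hqc, hqd, hg⟩ := h
  obtain ⟨hqB', hq', c', hcB', d', hdB', hc', hd', hcd', hqc', hqd', hg'⟩ := h'
  have hle : (c - d) + (c' - d') ≤ 0 := by
    rw [← hcd, ← hcd']
    have e : b - ((1 / 2 : ℝ) : ℂ) • 1 + (b' - ((1 / 2 : ℝ) : ℂ) • 1) = b + b' - 1 := by
      push_cast; module
    rw [e]
    exact sub_nonpos.2 hbb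
  have hmB := neg_mem (add_mem (sub_mem hcB hdB) (sub_mem hcB' hdB'))
  have h1 : 0 ≤ q * (q' * (-((c - d) + (c' - d')))) :=
    hq.mul_nonneg_of_commute (hq'.mul_nonneg_of_commute (neg_nonneg.2 hle) (hB _ hqB' _ hmB))
      (hB _ hqB _ (mul_mem hqB' hmB))
  have h2 : q * (q' * (-((c - d) + (c' - d')))) = -(q' * c) - q * c' := by
    have e1 : q * (q' * (c - d)) = q' * c := by
      rw [← mul_assoc, hB _ hqB _ hqB', mul_assoc, mul_sub, hqc, hqd, sub_zero]
    have e2 : q * (q' * (c' - d')) = q * c' := by rw [mul_sub q', hqc', hqd', sub_zero]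
    rw [mul_neg, mul_neg, mul_add, mul_add, e1, e2]
    abel
  have h3 : 0 ≤ q' * c := hq'.mul_nonneg_of_commute hc (hB _ hqB' _ hcB)
  have h4 : 0 ≤ q * c' := hq.mul_nonneg_of_commute hc' (hB _ hqB _ hcB')
  have h5 : q * c' = 0 := by
    refine le_antisymm ?_ h4
    rw [h2] at h1
    have h6 := add_le_add h1 h3
    have e : -(q' * c) - q * c' + q' * c = -(q * c') := by abel
    rw [e, add_zero] at h6
    exact neg_nonneg.1 h6
  exact hg' _ h5

theorem one_sub_le (hB : ∀ a ∈ B, ∀ b ∈ B, a * b = b * a) (h : IsHalfSpectral B b q) (hb : b ∈ B)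
    (hb1 : b ≤ 1) : 1 - q ≤ (2 : ℂ) • (1 - b) := by
  obtain ⟨hqB, hq, c, hcB, d, hdB, hc, hd, hcd, hqc, hqd, hg⟩ := h
  have h1 : 0 ≤ q * (1 - b) :=
    hq.mul_nonneg_of_commute (sub_nonneg.2 hb1) (hB _ hqB _ (sub_mem (one_mem B) hb))
  have h2 : b = c - d + ((1 / 2 : ℝ) : ℂ) • 1 := by rw [← hcd]; abel
  have h3 : (2 : ℂ) • (1 - b) - (1 - q) = (2 : ℂ) • (q * (1 - b)) + (2 : ℂ) • d := by
    have e : q * b = c + ((1 / 2 : ℝ) : ℂ) • q := by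
      rw [h2, mul_add, mul_sub, hqc, hqd, mul_smul_comm, mul_one, sub_zero]
    rw [mul_sub, mul_one, e]
    conv_lhs => rw [h2]
    push_cast; module
  rw [← sub_nonneg, h3]
  have h20 : (0 : ℂ) ≤ 2 := by norm_num
  exact add_nonneg (smul_nonneg h20 h1) (smul_nonneg h20 hd)

end IsHalfSpectral

namespace IsCondExp

variable {M B : VonNeumannAlgebra H} {τ : (H →L[ℂ] H) → ℂ} {E : (H →L[ℂ] H) → (H →L[ℂ] H)}

theorem eq_of_forall (hE : IsCondExp (M : Set (H →L[ℂ] H)) B τ E)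
    (hτ : IsFaithfulTracialState (M : Set (H →L[ℂ] H)) τ) (hBM : B ≤ M)
    {x e : H →L[ℂ] H} (hx : x ∈ M) (he : e ∈ B) (h : ∀ b ∈ B, τ ((x - e) * b) = 0) :
    E x = e := by
  have hEx : E x ∈ B := hE.1 x hx
  have hd : E x - e ∈ B := sub_mem hEx he
  have hs : star (E x - e) ∈ B := star_mem hd
  have h1 : τ ((E x - e) * star (E x - e)) = 0 := by
    have e1 : (E x - e) * star (E x - e) =
        (x - e) * star (E x - e) - (x - E x) * star (E x - e) := by
      rw [← sub_mul]; congr 1; abel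
    rw [e1, hτ.map_sub (mul_mem (sub_mem hx (hBM he)) (hBM hs))
      (mul_mem (sub_mem hx (hBM hEx)) (hBM hs)), h _ hs, hE.2 x hx _ hs, sub_zero]
  rw [hτ.tracial _ (hBM hd) _ (hBM hs)] at h1
  exact sub_eq_zero.1 (hτ.faithful _ (hBM hd) h1)

theorem tau_mul_eq (hE : IsCondExp (M : Set (H →L[ℂ] H)) B τ E)
    (hτ : IsFaithfulTracialState (M : Set (H →L[ℂ] H)) τ) (hBM : B ≤ M)
    {x b : H →L[ℂ] H} (hx : x ∈ M) (hb : b ∈ B) : τ (x * b) = τ (E x * b) := by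
  have h := hE.2 x hx b hb
  rw [sub_mul, hτ.map_sub (mul_mem hx (hBM hb)) (mul_mem (hBM (hE.1 x hx)) (hBM hb))] at h
  exact sub_eq_zero.1 h

theorem apply_of_mem (hE : IsCondExp (M : Set (H →L[ℂ] H)) B τ E)
    (hτ : IsFaithfulTracialState (M : Set (H →L[ℂ] H)) τ) (hBM : B ≤ M)
    {x : H →L[ℂ] H} (hx : x ∈ B) : E x = x :=
  hE.eq_of_forall hτ hBM (hBM hx) hx fun b _ => by rw [sub_self, zero_mul, hτ.map_zero]

theorem map_sub (hE : IsCondExp (M : Set (H →L[ℂ] H)) B τ E)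
    (hτ : IsFaithfulTracialState (M : Set (H →L[ℂ] H)) τ) (hBM : B ≤ M)
    {x y : H →L[ℂ] H} (hx : x ∈ M) (hy : y ∈ M) : E (x - y) = E x - E y := by
  refine hE.eq_of_forall hτ hBM (sub_mem hx hy) (sub_mem (hE.1 x hx) (hE.1 y hy)) fun b hb => ?_
  have e : (x - y - (E x - E y)) * b = (x - E x) * b - (y - E y) * b := by
    rw [← sub_mul]; congr 1; abel
  rw [e, hτ.map_sub (mul_mem (sub_mem hx (hBM (hE.1 x hx))) (hBM hb))
    (mul_mem (sub_mem hy (hBM (hE.1 y hy))) (hBM hb)), hE.2 x hx b hb, hE.2 y hy b hb, sub_zero]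

theorem star_eq (hE : IsCondExp (M : Set (H →L[ℂ] H)) B τ E)
    (hτ : IsFaithfulTracialState (M : Set (H →L[ℂ] H)) τ) (hBM : B ≤ M)
    {x : H →L[ℂ] H} (hx : x ∈ M) (hsa : star x = x) : star (E x) = E x := by
  symm
  refine hE.eq_of_forall hτ hBM hx (star_mem (hE.1 x hx)) fun b hb => ?_
  have hd : x - E x ∈ M := sub_mem hx (hBM (hE.1 x hx))
  have e : (x - star (E x)) * b = star (star b * (x - E x)) := by
    rw [star_mul, star_star, star_sub, hsa]
  have hsb : star b ∈ B := star_mem hb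
  rw [e, hτ.map_star (mul_mem (hBM hsb) hd), hτ.tracial _ (hBM hsb) _ hd,
    hE.2 x hx _ hsb, _root_.map_zero]

theorem nonneg (hE : IsCondExp (M : Set (H →L[ℂ] H)) B τ E)
    (hτ : IsFaithfulTracialState (M : Set (H →L[ℂ] H)) τ) (hBM : B ≤ M)
    {x : H →L[ℂ] H} (hx : x ∈ M) (h0 : 0 ≤ x) : 0 ≤ E x := by
  have hEx := hE.1 x hx
  have hsa : star (E x) = E x := hE.star_eq hτ hBM hx (IsSelfAdjoint.of_nonneg h0).star_eq
  obtain ⟨f, hfB, c, hcB, d, hdB, hf, hc, hd, hcd, hfc, hfd, -⟩ :=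
    B.exists_spectral_projection (neg_mem hEx) (show IsSelfAdjoint (-E x) by
      rw [isSelfAdjoint_iff, star_neg, hsa]) 0
  have hcf : c * f = c := by
    have := congr_arg star hfc
    rwa [star_mul, hf.star_eq', (IsSelfAdjoint.of_nonneg hc).star_eq] at this
  have hdf : d * f = 0 := by
    have := congr_arg star hfd
    rwa [star_mul, hf.star_eq', (IsSelfAdjoint.of_nonneg hd).star_eq, star_zero] at this
  have hEcd : E x = d - c := by
    rw [Complex.ofReal_zero, zero_smul, sub_zero] at hcd
    rw [← neg_sub, ← hcd, neg_neg]
  have h1 : τ (x * f) = - τ c := by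
    rw [hE.tau_mul_eq hτ hBM hx hfB, hEcd, sub_mul, hcf, hdf, zero_sub, hτ.map_neg (hBM hcB)]
  have h2 : 0 ≤ (τ (x * f)).re := by
    have h3 : τ (x * f) = τ (star f * x * f) := by
      rw [hf.star_eq', hτ.tracial _ (mul_mem (hBM hfB) hx) _ (hBM hfB), ← mul_assoc, hf.eq_sq,
        hτ.tracial _ hx _ (hBM hfB)]
    rw [h3]
    exact hτ.nonneg_of_nonneg (mul_mem (mul_mem (star_mem (hBM hfB)) hx) (hBM hfB))
      (star_left_conjugate_nonneg h0 f)
  have hc0 : c = 0 := by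
    obtain ⟨r, hr, -, hrs, rfl⟩ := B.exists_sqrt_mem hcB hc
    have h3 := Complex.nonneg_iff.1 (hτ.nonneg r (hBM hr))
    rw [h1, Complex.neg_re] at h2
    rw [hrs] at h3
    have h4 : τ (star r * r) = 0 := by
      rw [hrs]
      exact Complex.ext (le_antisymm (by simpa using h2) h3.1) h3.2.symm
    rw [hτ.faithful r (hBM hr) h4, mul_zero]
  rw [hEcd, hc0, sub_zero]
  exact hd

theorem mono (hE : IsCondExp (M : Set (H →L[ℂ] H)) B τ E)
    (hτ : IsFaithfulTracialState (M : Set (H →L[ℂ] H)) τ) (hBM : B ≤ M)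
    {x y : H →L[ℂ] H} (hx : x ∈ M) (hy : y ∈ M) (hxy : x ≤ y) : E x ≤ E y := by
  rw [← sub_nonneg, ← hE.map_sub hτ hBM hy hx]
  exact hE.nonneg hτ hBM (sub_mem hy hx) (sub_nonneg.2 hxy)

end IsCondExp

end ConditionalExpectation

section Tower

/-- An increasing chain of von Neumann subalgebras generating `M`, with an increasing chain of
MASAs whose conditional expectations form commuting squares. -/
structure IsCommutingTower (M : VonNeumannAlgebra H) (N B : ℕ → VonNeumannAlgebra H)
    (τ : (H →L[ℂ] H) → ℂ) (E : ℕ → (H →L[ℂ] H) → (H →L[ℂ] H)) : Prop where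
  trace : IsFaithfulTracialState (M : Set (H →L[ℂ] H)) τ
  factor : IsFactor (M : Set (H →L[ℂ] H))
  le : ∀ n, N n ≤ M
  monotone : Monotone N
  gen : (M : Set (H →L[ℂ] H)) = vNgen (⋃ n, (N n : Set (H →L[ℂ] H)))
  masa : ∀ n, IsMasa (N n : Set (H →L[ℂ] H)) (B n)
  monotone_masa : Monotone B
  condExp : ∀ n, IsCondExp (M : Set (H →L[ℂ] H)) (B n) τ (E n)
  square : ∀ n, ∀ x ∈ N n, E (n + 1) x = E n x

theorem IsFaithfulTracialState.exists_norm2_sub_lt_of_monotone {M : VonNeumannAlgebra H}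
    {τ : (H →L[ℂ] H) → ℂ} (hτ : IsFaithfulTracialState (M : Set (H →L[ℂ] H)) τ)
    (hM : IsFactor (M : Set (H →L[ℂ] H))) {N : ℕ → VonNeumannAlgebra H} (hN : Monotone N)
    (hNM : ∀ n, N n ≤ M) {x : H →L[ℂ] H} (hx : x ∈ vNgen (⋃ n, (N n : Set (H →L[ℂ] H))))
    {ε : ℝ} (hε : 0 < ε) : ∃ n, ∃ y ∈ N n, norm2 τ (x - y) < ε := by
  have hdir : Directed (· ≤ ·) fun n => (N n).toStarSubalgebra :=
    Monotone.directed_le fun i j hij => hN hij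
  set S : StarSubalgebra ℂ (H →L[ℂ] H) := ⨆ n, (N n).toStarSubalgebra with hS
  have hmem : ∀ y, y ∈ S ↔ ∃ n, y ∈ N n := by
    intro y
    rw [← SetLike.mem_coe, hS, StarSubalgebra.coe_iSup_of_directed hdir, Set.mem_iUnion]
    rfl
  have hxM : x ∈ M := vNgen_subset (fun y hy => by
    obtain ⟨n, hn⟩ := Set.mem_iUnion.1 hy
    exact hNM n hn) hx
  obtain ⟨y, hy, h⟩ := hτ.exists_norm2_sub_lt hM S (fun y hy => by
    obtain ⟨n, hn⟩ := (hmem y).1 hy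
    exact hNM n hn) hxM (by
    refine Set.centralizer_subset (Set.centralizer_subset ?_) hx
    rintro y (hy | ⟨y, hy, rfl⟩)
    · obtain ⟨n, hn⟩ := Set.mem_iUnion.1 hy
      exact (hmem y).2 ⟨n, hn⟩
    · obtain ⟨n, hn⟩ := Set.mem_iUnion.1 hy
      exact (hmem _).2 ⟨n, star_mem hn⟩) hε
  obtain ⟨n, hn⟩ := (hmem y).1 hy
  exact ⟨n, y, hn, h⟩

namespace IsCommutingTower

variable {M : VonNeumannAlgebra H} {N B : ℕ → VonNeumannAlgebra H}
    {τ : (H →L[ℂ] H) → ℂ} {E : ℕ → (H →L[ℂ] H) → (H →L[ℂ] H)}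

theorem masa_le (h : IsCommutingTower M N B τ E) (n : ℕ) : B n ≤ M := (h.masa n).le.trans (h.le n)

theorem mul_comm (h : IsCommutingTower M N B τ E) (n : ℕ) : ∀ a ∈ B n, ∀ b ∈ B n, a * b = b * a :=
  fun _ ha _ hb => (h.masa n).mul_comm ha hb

theorem vNgen_le (h : IsCommutingTower M N B τ E) :
    vNgenAlg (⋃ n, (B n : Set (H →L[ℂ] H))) ≤ M := fun x hx =>
  vNgen_subset (fun y hy => by
    obtain ⟨n, hn⟩ := Set.mem_iUnion.1 hy
    exact h.masa_le n hn) hx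

theorem le_vNgen (n : ℕ) : B n ≤ vNgenAlg (⋃ n, (B n : Set (H →L[ℂ] H))) := fun _ hx =>
  subset_vNgenAlg _ (Set.mem_iUnion.2 ⟨n, hx⟩)

theorem vNgen_comm (h : IsCommutingTower M N B τ E) {a b : H →L[ℂ] H}
    (ha : a ∈ vNgenAlg (⋃ n, (B n : Set (H →L[ℂ] H))))
    (hb : b ∈ vNgenAlg (⋃ n, (B n : Set (H →L[ℂ] H)))) : a * b = b * a := by
  have key : ∀ x ∈ (⋃ n, (B n : Set (H →L[ℂ] H))) ∪ star '' (⋃ n, (B n : Set (H →L[ℂ] H))),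
      ∃ n, x ∈ B n := by
    rintro x (hx | ⟨y, hy, rfl⟩)
    · exact Set.mem_iUnion.1 hx
    · obtain ⟨n, hn⟩ := Set.mem_iUnion.1 hy
      exact ⟨n, star_mem (show y ∈ B n from hn)⟩
  have h1 : ∀ b ∈ vNgenAlg (⋃ n, (B n : Set (H →L[ℂ] H))),
      b ∈ Set.centralizer ((⋃ n, (B n : Set (H →L[ℂ] H))) ∪
        star '' (⋃ n, (B n : Set (H →L[ℂ] H)))) := by
    intro b hb x hx
    obtain ⟨n, hn⟩ := key x hx
    refine hb x fun y hy => ?_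
    obtain ⟨m, hm⟩ := key y hy
    exact h.mul_comm (max m n) _ (h.monotone_masa (le_max_left m n) hm) _
      (h.monotone_masa (le_max_right m n) hn)
  exact (ha b (h1 b hb)).symm

theorem condExp_eq (h : IsCommutingTower M N B τ E) {n k : ℕ} (hnk : n ≤ k) {x : H →L[ℂ] H}
    (hx : x ∈ N n) : E k x = E n x := by
  induction k, hnk using Nat.le_induction with
  | base => rfl
  | succ k hk ih => rw [h.square k x (h.monotone hk hx), ih]

/-- The conditional expectations of the tower extend the commuting square condition to the limit. -/
theorem tau_mul_eq (h : IsCommutingTower M N B τ E) {n : ℕ} {m s : H →L[ℂ] H} (hm : m ∈ N n)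
    (hs : s ∈ vNgenAlg (⋃ n, (B n : Set (H →L[ℂ] H)))) : τ (m * s) = τ (m * E n s) := by
  have hτ := h.trace
  have hmM := h.le n hm
  have hsM := h.vNgen_le hs
  have hEmB : E n m ∈ B n := (h.condExp n).1 m hmM
  have hEm := h.masa_le n hEmB
  have hEsB : E n s ∈ B n := (h.condExp n).1 s hsM
  have hEs := h.masa_le n hEsB
  have hd : m - E n m ∈ M := sub_mem hmM hEm
  have hsd : star (m - E n m) ∈ M := star_mem hd
  have h1 : τ ((m - E n m) * s) = 0 := by
    refine norm_le_zero_iff.1 (eq_zero_of_forall_le_mul (K := norm2 τ (star (m - E n m)))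
      fun ε hε => ?_)
    obtain ⟨k, a, ha, hlt⟩ := hτ.exists_norm2_sub_lt_of_monotone h.factor h.monotone_masa
      h.masa_le hs hε
    have haM := h.masa_le k ha
    have h2 : τ ((m - E n m) * a) = 0 := by
      rw [← h.condExp_eq (le_max_left n k) hm]
      exact (h.condExp _).2 m hmM a (h.monotone_masa (le_max_right n k) ha)
    have h3 : τ ((m - E n m) * s) = τ (star (star (m - E n m)) * (s - a)) := by
      rw [star_star, mul_sub, hτ.map_sub (mul_mem hd hsM) (mul_mem hd haM), h2, sub_zero]
    rw [h3]
    exact (hτ.norm_tau_star_mul_le hsd (sub_mem hsM haM)).trans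
      (mul_le_mul_of_nonneg_left hlt.le (IsFaithfulTracialState.norm2_nonneg τ _))
  rw [sub_mul, hτ.map_sub (mul_mem hmM hsM) (mul_mem hEm hsM), sub_eq_zero] at h1
  rw [h1, (h.condExp n).tau_mul_eq hτ (h.masa_le n) hmM hEsB, hτ.tracial _ hEm _ hsM,
    (h.condExp n).tau_mul_eq hτ (h.masa_le n) hsM hEmB, hτ.tracial _ hEs _ hEm]

end IsCommutingTower

end Tower

section Limit

theorem IsFaithfulTracialState.norm2_sub_sum_le {M : VonNeumannAlgebra H}
    {τ : (H →L[ℂ] H) → ℂ} (hτ : IsFaithfulTracialState (M : Set (H →L[ℂ] H)) τ)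
    {A B : VonNeumannAlgebra H} (hAM : A ≤ M) (hBM : B ≤ M) {ι : Type} [Fintype ι]
    {c s : ι → H →L[ℂ] H} (hc : IsPartition B c) (hs : IsPartition A s) {u x : H →L[ℂ] H}
    (hu : u ∈ M) (hx : x ∈ M) (hcs : ∀ i, u * s i = c i * u) {ε : ℝ} (hux : norm2 τ (u - x) ≤ ε) :
    norm2 τ (x - ∑ i, c i * x * s i) ≤ 2 * ε := by
  have hd : u - x ∈ M := sub_mem hu hx
  have h1 : ∑ i, c i * u * s i = u := by
    have : ∀ i, c i * u * s i = c i * u := by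
      intro i
      rw [mul_assoc, hcs, ← mul_assoc, (hc.proj i).eq_sq]
    simp only [this]
    rw [← Finset.sum_mul, hc.sum_eq, one_mul]
  have h2 : x - ∑ i, c i * x * s i = (∑ i, c i * (u - x) * s i) - (u - x) := by
    simp only [mul_sub, sub_mul]
    rw [Finset.sum_sub_distrib, h1]
    abel
  have h3 : ∑ i, c i * (u - x) * s i ∈ M :=
    sum_mem fun i _ => mul_mem (mul_mem (hBM (hc.mem i)) hd) (hAM (hs.mem i))
  have h4 := hτ.norm2_sum_mul_mul_le hAM hs (fun i => hBM (hc.mem i)) hc.proj hc.orth hd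
  have h5 := hτ.norm2_add_le h3 (neg_mem hd)
  rw [norm2_neg, ← sub_eq_add_neg, ← h2] at h5
  linarith

namespace IsCommutingTower

variable {M : VonNeumannAlgebra H} {N B : ℕ → VonNeumannAlgebra H}
    {τ : (H →L[ℂ] H) → ℂ} {E : ℕ → (H →L[ℂ] H) → (H →L[ℂ] H)}

/-- Conjugation by a unitary normalizing the limit algebra induces, up to a uniform error, a
projection map on each `B n`. -/
theorem exists_isProjectionMap (h : IsCommutingTower M N B τ E) (n : ℕ) {u : H →L[ℂ] H}
    (hu : u ∈ M) (huu : u * star u = 1) (huu' : star u * u = 1)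
    (huA : ∀ a ∈ vNgenAlg (⋃ n, (B n : Set (H →L[ℂ] H))),
      star u * a * u ∈ vNgenAlg (⋃ n, (B n : Set (H →L[ℂ] H)))) :
    ∃ q, IsProjectionMap (B n) q ∧ ∀ x ∈ N n, ∀ ε, norm2 τ (u - x) ≤ ε →
      ∀ (ι : Type) [Fintype ι] (c : ι → H →L[ℂ] H), IsPartition (B n) c →
        norm2 τ (x - ∑ i, c i * x * q (c i)) ≤ 3 * ε := by
  set A := vNgenAlg (⋃ n, (B n : Set (H →L[ℂ] H))) with hA
  have hτ := h.trace
  have hE := h.condExp n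
  have hBM := h.masa_le n
  have hBA : B n ≤ A := le_vNgen n
  have hAM : A ≤ M := h.vNgen_le
  have hcomm := h.mul_comm n
  have hsproj : ∀ p, IsStarProjection p → IsStarProjection (star u * p * u) := by
    intro p hp
    refine ⟨?_, ?_⟩
    · change star u * p * u * (star u * p * u) = star u * p * u
      calc star u * p * u * (star u * p * u) = star u * p * (u * star u) * p * u := by
            simp only [mul_assoc]
        _ = star u * p * u := by rw [huu, mul_one, mul_assoc (star u), hp.eq_sq]
    · change star (star u * p * u) = _
      rw [star_mul, star_mul, star_star, hp.star_eq', mul_assoc]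
  have hsM : ∀ p ∈ B n, star u * p * u ∈ M := fun p hp =>
    mul_mem (mul_mem (star_mem hu) (hBM hp)) hu
  have hex : ∀ p, ∃ q, p ∈ B n → IsStarProjection p →
      IsHalfSpectral (B n) (E n (star u * p * u)) q := by
    intro p
    by_cases hp : p ∈ B n ∧ IsStarProjection p
    · obtain ⟨q, hq⟩ := exists_isHalfSpectral (B n) (hE.1 _ (hsM p hp.1))
        (hE.star_eq hτ hBM (hsM p hp.1) (hsproj p hp.2).star_eq')
      exact ⟨q, fun _ _ => hq⟩
    · exact ⟨0, fun h1 h2 => absurd ⟨h1, h2⟩ hp⟩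
  choose q hq using hex
  have hE1 : E n 1 = 1 := hE.apply_of_mem hτ hBM (one_mem (B n))
  refine ⟨q, ⟨fun p hp hpp => (hq p hp hpp).1, fun p hp hpp => (hq p hp hpp).2.1, ?_, ?_⟩, ?_⟩
  · intro p hp hpp s hs hss hps
    refine (hq s hs hss).mul_eq_of_le hcomm (hq p hp hpp)
      (hE.mono hτ hBM (hsM s hs) (hsM p hp) ?_)
    exact star_left_conjugate_le_conjugate ((hss.le_iff_mul_eq_right hpp).2 hps) u
  · intro p hp hpp s hs hss hps
    refine (hq p hp hpp).mul_eq_zero_of_add_le hcomm (hq s hs hss) ?_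
    have hcs : p ≤ 1 - s := by
      rw [hpp.le_iff_mul_eq_left hss.one_sub, mul_sub, mul_one, hps, sub_zero]
    have h1 : star u * p * u ≤ 1 - star u * s * u := by
      have := star_left_conjugate_le_conjugate hcs u
      rwa [mul_sub, sub_mul, mul_one, huu'] at this
    have h2 := hE.mono hτ hBM (hsM p hp) (sub_mem (one_mem M) (hsM s hs)) h1
    rw [hE.map_sub hτ hBM (one_mem M) (hsM s hs), hE1] at h2
    exact le_sub_iff_add_le.1 h2
  · intro x hx ε hux ι _ c hc
    have hxM := h.le n hx
    have hcM : ∀ i, c i ∈ M := fun i => hBM (hc.mem i)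
    set s : ι → H →L[ℂ] H := fun i => star u * c i * u with hs
    have hsA : ∀ i, s i ∈ A := fun i => huA _ (hBA (hc.mem i))
    have hsP : IsPartition A s := by
      refine ⟨hsA, fun i => hsproj _ (hc.proj i), fun i j hij => ?_, ?_⟩
      · calc star u * c i * u * (star u * c j * u) = star u * c i * (u * star u) * c j * u := by
              simp only [mul_assoc]
          _ = 0 := by
            rw [huu, mul_one, mul_assoc (star u), hc.orth i j hij, mul_zero, zero_mul]
      · rw [← Finset.sum_mul, ← Finset.mul_sum, hc.sum_eq, mul_one, huu']
    have hε : 0 ≤ ε := (IsFaithfulTracialState.norm2_nonneg τ _).trans hux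
    have h1 : norm2 τ (x - ∑ i, c i * x * s i) ≤ 2 * ε := by
      refine hτ.norm2_sub_sum_le hAM hBM hc hsP hu hxM (fun i => ?_) hux
      rw [hs]
      change u * (star u * c i * u) = _
      rw [← mul_assoc, ← mul_assoc, huu, one_mul]
    have hqs : ∀ i, IsHalfSpectral (B n) (E n (s i)) (q (c i)) :=
      fun i => hq _ (hc.mem i) (hc.proj i)
    have hexp : ∀ t : ι → H →L[ℂ] H, x - ∑ i, c i * x * t i = ∑ i, c i * (x * (1 - t i)) := by
      intro t
      simp only [mul_sub, mul_one]
      rw [Finset.sum_sub_distrib, ← Finset.sum_mul, hc.sum_eq, one_mul]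
      simp only [mul_assoc]
    have hsq : ∀ t : ι → H →L[ℂ] H, (∀ i, t i ∈ M) → (∀ i, IsStarProjection (t i)) →
        norm2 τ (x - ∑ i, c i * x * t i) ^ 2 =
          ∑ i, (τ (star x * c i * x * (1 - t i))).re := by
      intro t htM ht
      have h1t : ∀ i, 1 - t i ∈ M := fun i => sub_mem (one_mem M) (htM i)
      rw [hexp, hτ.norm2_sum_mul_sq hcM hc.proj hc.orth fun i => mul_mem hxM (h1t i)]
      refine Finset.sum_congr rfl fun i _ => ?_
      have hm : star x * c i * x ∈ M := mul_mem (mul_mem (star_mem hxM) (hcM i)) hxM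
      have e : star (x * (1 - t i)) * c i * (x * (1 - t i)) =
          (1 - t i) * ((star x * c i * x) * (1 - t i)) := by
        rw [star_mul, (ht i).one_sub.star_eq']
        simp only [mul_assoc]
      rw [e, hτ.tracial _ (h1t i) _ (mul_mem hm (h1t i)), mul_assoc, (ht i).one_sub.eq_sq]
    have h2 : norm2 τ (x - ∑ i, c i * x * q (c i)) ^ 2 ≤
        2 * norm2 τ (x - ∑ i, c i * x * s i) ^ 2 := by
      rw [hsq _ (fun i => hBM (hqs i).1) fun i => (hqs i).2.1,
        hsq s (fun i => hAM (hsA i)) hsP.proj, Finset.mul_sum]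
      refine Finset.sum_le_sum fun i _ => ?_
      have hmN : star x * c i * x ∈ N n :=
        mul_mem (mul_mem (star_mem hx) ((h.masa n).le (hc.mem i))) hx
      have hm := h.le n hmN
      have hbB : E n (s i) ∈ B n := hE.1 _ (hAM (hsA i))
      have hb1 : E n (s i) ≤ 1 := by
        have := hE.mono hτ hBM (hAM (hsA i)) (one_mem M) (hsP.proj i).le_one
        rwa [hE1] at this
      have h3 : τ (star x * c i * x * (1 - s i)) = τ (star x * c i * x * (1 - E n (s i))) := by
        rw [mul_sub, mul_sub, hτ.map_sub (mul_mem hm (one_mem M)) (mul_mem hm (hAM (hsA i))),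
          hτ.map_sub (mul_mem hm (one_mem M)) (mul_mem hm (hBM hbB)), h.tau_mul_eq hmN (hsA i)]
      have hcx : c i * x ∈ M := mul_mem (hcM i) hxM
      have hconj : ∀ k ∈ M, τ (star x * c i * x * k) = τ ((c i * x) * k * star (c i * x)) := by
        intro k hk
        rw [hτ.tracial _ (mul_mem hcx hk) _ (star_mem hcx), star_mul, (hc.proj i).star_eq']
        congr 1
        calc star x * c i * x * k = star x * (c i * c i) * x * k := by rw [(hc.proj i).eq_sq]
          _ = star x * c i * (c i * x * k) := by simp only [mul_assoc]
      have h1q : 1 - q (c i) ∈ M := sub_mem (one_mem M) (hBM (hqs i).1)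
      have h1b : 1 - E n (s i) ∈ M := sub_mem (one_mem M) (hBM hbB)
      have h2b : (2 : ℂ) • (1 - E n (s i)) ∈ M := M.smul_mem' _ h1b
      have h4 := hτ.re_mono (mul_mem (mul_mem hcx h1q) (star_mem hcx))
        (mul_mem (mul_mem hcx h2b) (star_mem hcx))
        (star_right_conjugate_le_conjugate ((hqs i).one_sub_le hcomm hbB hb1) (c i * x))
      rw [← hconj _ h1q, ← hconj _ h2b, mul_smul_comm, hτ.map_smul _ _ (mul_mem hm h1b), ← h3] at h4
      simpa using h4
    have h5 := IsFaithfulTracialState.norm2_nonneg τ (x - ∑ i, c i * x * s i)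
    exact (abs_le_of_sq_le_sq' (by nlinarith) (by positivity)).2

/-- The limit algebra is a MASA. -/
theorem isMasa (h : IsCommutingTower M N B τ E) :
    IsMasa (M : Set (H →L[ℂ] H)) (vNgenAlg (⋃ n, (B n : Set (H →L[ℂ] H)))) := by
  have hτ := h.trace
  refine ⟨h.vNgen_le, fun a ha => star_mem ha, Set.Subset.antisymm ?_
    fun a ha => ⟨h.vNgen_le ha, fun b hb => h.vNgen_comm ha hb⟩⟩
  rintro x ⟨hxM, hx⟩
  refine hτ.mem_of_norm2_approx h.factor _ (fun y hy => h.vNgen_le hy) hxM fun ε hε => ?_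
  have hxg : x ∈ vNgen (⋃ n, (N n : Set (H →L[ℂ] H))) := h.gen ▸ hxM
  obtain ⟨n, y, hy, hlt⟩ := hτ.exists_norm2_sub_lt_of_monotone h.factor h.monotone h.le hxg
    (ε := ε / 5) (by positivity)
  have hBA := le_vNgen (B := B) n
  have key : ∀ (ι : Type) [Fintype ι] (c : ι → H →L[ℂ] H), IsPartition (B n) c →
      norm2 τ (y - ∑ i, c i * y * c i) ≤ 2 * (ε / 5) := fun ι _ c hc =>
    hτ.norm2_sub_sum_le (h.masa_le n) (h.masa_le n) hc hc hxM (h.le n hy)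
      (fun i => hx _ (hBA (hc.mem i))) hlt.le
  obtain ⟨z, hzN, hyz, hz⟩ := hτ.exists_intertwiner h.factor (h.le n) (h.masa n).le (h.mul_comm n)
    (isProjectionMap_id _) (isProjectionMap_id _) hy key key
  refine ⟨z, hBA ((h.masa n).mem_of_forall_projection hzN fun p hpA hp => (hz p hpA hp).2), ?_⟩
  have := hτ.norm2_sub_le hxM (h.le n hzN) y (h.le n hy)
  linarith

/-- Normalizers of the limit algebra lie in the algebra generated by the normalizing algebras. -/
theorem normalizer_mem (h : IsCommutingTower M N B τ E) {u : H →L[ℂ] H}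
    (hu : u ∈ normalizerSet (M : Set (H →L[ℂ] H))
      (vNgenAlg (⋃ n, (B n : Set (H →L[ℂ] H))))) :
    u ∈ vNgenAlg (⋃ n, normAlg (N n : Set (H →L[ℂ] H)) (B n)) := by
  have hτ := h.trace
  obtain ⟨huM, ⟨huu', huu⟩, huA⟩ := hu
  set A := vNgenAlg (⋃ n, (B n : Set (H →L[ℂ] H))) with hA
  have h1 : ∀ a ∈ A, u * a * star u ∈ A := by
    intro a ha
    have : u * a * star u ∈ (fun a => u * a * star u) '' (A : Set (H →L[ℂ] H)) := ⟨a, ha, rfl⟩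
    rwa [huA] at this
  have h2 : ∀ a ∈ A, star u * a * u ∈ A := by
    intro a ha
    have ha' : a ∈ (A : Set (H →L[ℂ] H)) := ha
    rw [← huA] at ha'
    obtain ⟨b, hb, rfl⟩ := ha'
    have e : star u * (u * b * star u) * u = (star u * u) * b * (star u * u) := by
      simp only [mul_assoc]
    change star u * (u * b * star u) * u ∈ A
    rwa [e, huu', one_mul, mul_one]
  have hWM : ∀ n, vNgenAlg (normalizerSet (N n : Set (H →L[ℂ] H)) (B n)) ≤ M := fun n x hx =>
    vNgen_subset (fun y hy => h.le n hy.1) hx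
  have hPM : ∀ y ∈ vNgenAlg (⋃ n, normAlg (N n : Set (H →L[ℂ] H)) (B n)), y ∈ M := fun y hy =>
    vNgen_subset (fun z hz => by
      obtain ⟨n, hn⟩ := Set.mem_iUnion.1 hz
      exact hWM n hn) hy
  refine hτ.mem_of_norm2_approx h.factor _ hPM huM fun ε hε => ?_
  have hug : u ∈ vNgen (⋃ n, (N n : Set (H →L[ℂ] H))) := h.gen ▸ huM
  obtain ⟨n, x, hx, hlt⟩ := hτ.exists_norm2_sub_lt_of_monotone h.factor h.monotone h.le hug
    (ε := ε / 7) (by positivity)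
  have hxM := h.le n hx
  obtain ⟨q, hq, hqx⟩ := h.exists_isProjectionMap n huM huu huu' h2
  obtain ⟨r, hr, hrx⟩ := h.exists_isProjectionMap n (star_mem huM) (by rwa [star_star])
    (by rwa [star_star]) (by rwa [star_star])
  have hlt' : norm2 τ (star u - star x) ≤ ε / 7 := by
    rw [← star_sub, hτ.norm2_star (sub_mem huM hxM)]
    exact hlt.le
  obtain ⟨y, hyN, hxy, hy⟩ := hτ.exists_intertwiner h.factor (h.le n) (h.masa n).le (h.mul_comm n)
    hq hr hx (δ := 3 * (ε / 7)) (hqx x hx _ hlt.le) (fun ι _ c hc => by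
      have h3 := hrx (star x) (star_mem hx) _ hlt' ι c hc
      have hsum : ∑ i, r (c i) * x * c i ∈ M := sum_mem fun i _ =>
        mul_mem (mul_mem (h.masa_le n (hr.mem _ (hc.mem i) (hc.proj i))) hxM)
          (h.masa_le n (hc.mem i))
      have e : star x - ∑ i, c i * star x * r (c i) = star (x - ∑ i, r (c i) * x * c i) := by
        rw [star_sub, star_sum]
        congr 1
        refine Finset.sum_congr rfl fun i _ => ?_
        rw [star_mul, star_mul, (hc.proj i).star_eq',
          (hr.proj _ (hc.mem i) (hc.proj i)).star_eq', mul_assoc]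
      rwa [e, hτ.norm2_star (sub_mem hxM hsum)] at h3)
  refine ⟨y, subset_vNgenAlg _ (Set.mem_iUnion.2
    ⟨n, (h.masa n).intertwiner_mem_normAlg hq hr hyN hy⟩), ?_⟩
  have := hτ.norm2_sub_le huM (h.le n hyN) x hxM
  linarith

end IsCommutingTower

/-- A concrete von Neumann algebra as a bundled one. -/
def IsVonNeumannAlgebra.toVonNeumannAlgebra {M : Set (H →L[ℂ] H)} (h : IsVonNeumannAlgebra M) :
    VonNeumannAlgebra H where
  carrier := M
  mul_mem' := fun ha hb => h.mul_mem _ ha _ hb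
  add_mem' := fun ha hb => h.add_mem _ ha _ hb
  algebraMap_mem' := fun r => by
    rw [Algebra.algebraMap_eq_smul_one]
    exact h.smul_mem r _ h.one_mem
  star_mem' := fun ha => h.star_mem _ ha
  centralizer_centralizer' := h.double_commutant

theorem IsVonNeumannAlgebra.exists_coe_eq {M : Set (H →L[ℂ] H)} (h : IsVonNeumannAlgebra M) :
    ∃ M' : VonNeumannAlgebra H, (M' : Set (H →L[ℂ] H)) = M :=
  ⟨h.toVonNeumannAlgebra, rfl⟩

/-- A MASA of a von Neumann algebra is a von Neumann algebra. -/
theorem IsMasa.exists_coe_eq {M : VonNeumannAlgebra H} {A : Set (H →L[ℂ] H)}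
    (h : IsMasa (M : Set (H →L[ℂ] H)) A) : ∃ A' : VonNeumannAlgebra H, (A' : Set (H →L[ℂ] H)) = A := by
  refine ⟨vNgenAlg A, Set.Subset.antisymm ?_ fun a ha => subset_vNgenAlg _ ha⟩
  have hstar : A ∪ star '' A = A := by
    refine Set.union_eq_left.2 ?_
    rintro _ ⟨a, ha, rfl⟩
    exact h.2.1 a ha
  have hcomm : ∀ a ∈ A, ∀ b ∈ A, a * b = b * a := by
    intro a ha b hb
    have h1 : a ∈ {x ∈ (M : Set (H →L[ℂ] H)) | ∀ a ∈ A, x * a = a * x} := by rwa [h.2.2]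
    exact h1.2 b hb
  intro x hx
  rw [← h.2.2]
  refine ⟨vNgen_subset (fun y hy => h.1 hy) hx, fun a ha => ?_⟩
  refine (hx a ?_).symm
  rw [hstar]
  exact fun b hb => hcomm b hb a ha

end Limit

end NormalizersOfTowers

/-- For an increasing sequence of II₁ factors `Mₙ` with MASAs `Aₙ ⊆ Mₙ`
satisfying the commuting square condition, `A = vN(⋃ₙ Aₙ)` is a MASA in
`M = vN(⋃ₙ Mₙ)` and `N_M(A)'' ⊆ vN(⋃ₙ N_{Mₙ}(Aₙ)'')`. -/
theorem normalizing_algebra_of_inductive_limit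
    {H : Type*} [NormedAddCommGroup H] [InnerProductSpace ℂ H] [CompleteSpace H]
    (M : Set (H →L[ℂ] H)) (Mseq Aseq : ℕ → Set (H →L[ℂ] H))
    (τ : (H →L[ℂ] H) → ℂ) (E : ℕ → ((H →L[ℂ] H) → (H →L[ℂ] H)))
    (hM : IsII1Factor M τ)
    (hMn : ∀ n, IsVonNeumannAlgebra (Mseq n))
    (hMnf : ∀ n, IsFactor (Mseq n))
    (hMni : ∀ n, IsInfiniteDimensionalSet (Mseq n))
    (hMnM : ∀ n, Mseq n ⊆ M)
    (hmono : ∀ n, Mseq n ⊆ Mseq (n + 1))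
    (hgen : M = vNgen (⋃ n, Mseq n))
    (hAn : ∀ n, IsMasa (Mseq n) (Aseq n))
    (hAmono : ∀ n, Aseq n ⊆ Aseq (n + 1))
    (hE : ∀ n, IsCondExp M (Aseq n) τ (E n))
    (hcs : ∀ n, ∀ x ∈ Mseq n, E (n + 1) x = E n x) :
    IsMasa M (vNgen (⋃ n, Aseq n)) ∧
      normAlg M (vNgen (⋃ n, Aseq n)) ⊆ vNgen (⋃ n, normAlg (Mseq n) (Aseq n)) := by
  obtain ⟨M, rfl⟩ := hM.vna.exists_coe_eq
  choose N hN using fun n => (hMn n).exists_coe_eq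
  obtain rfl : (fun n => (N n : Set (H →L[ℂ] H))) = Mseq := funext hN
  choose B hB using fun n => (hAn n).exists_coe_eq
  obtain rfl : (fun n => (B n : Set (H →L[ℂ] H))) = Aseq := funext hB
  have h : IsCommutingTower M N B τ E :=
    ⟨hM.trace, hM.factor, hMnM, monotone_nat_of_le_succ hmono, hgen, hAn,
      monotone_nat_of_le_succ hAmono, hE, hcs⟩
  exact ⟨h.isMasa, vNgen_subset (M := vNgenAlg _) fun u hu => h.normalizer_mem hu⟩
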